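/- The algebra U = U_q(A(0,2)^{(4)})^+ has the following ℂ-vector-space basis (PBW basis). For each quadruple of finitely supported functions a, b, c, d : {1, 2, 3, …} → ℕ, form the monomial (Y₁^{a(1)} Y₂^{a(2)} Y₃^{a(3)} ⋯) · (M₁^{b(1)} M₃^{b(2)} M₅^{b(3)} ⋯) · (L₂^{c(1)} L₄^{c(2)} L₆^{c(3)} ⋯) · (⋯ X₃^{d(3)} X₂^{d(2)} X₁^{d(1)}), where within each group the factors are ordered as written (Y's by increasing index, M's by increasing index, L's by increasing index, X's by decreasing index) and only finitely many exponents are nonzero. Then this family of monomials, indexed by (a, b, c, d), is linearly independent over ℂ and spans U. -/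

import Mathlib

noncomputable section

namespace QAff

abbrev F : Type := FreeAlgebra ℂ (Fin 2)

def x1 : F := FreeAlgebra.ι ℂ 0
def x2 : F := FreeAlgebra.ι ℂ 1

def θ (q : ℂ) : ℂ := q - q⁻¹

def L1F (q : ℂ) : F := x1 * x2 - q⁻¹ • (x2 * x1)

def X2F (q : ℂ) : F := x1 * L1F q - L1F q * x1

def Y2F (q : ℂ) : F := L1F q * x2 + x2 * L1F q

/-- the quantum Serre relator `[x₁,[x₁,[x₁,x₂]]]` (braided brackets w.r.t. the bicharacter
`χ((a,b),(c,d)) = (-1)^(bd) q^(ac-ad-bc+bd)`). -/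
def serre1 (q : ℂ) : F := x1 * X2F q - q • (X2F q * x1)

/-- the quantum Serre relator `[[[x₁,x₂],x₂],x₂]` (braided brackets). -/
def serre2 (q : ℂ) : F := Y2F q * x2 - q • (x2 * Y2F q)

inductive Rel (q : ℂ) : F → F → Prop
  | one : Rel q (serre1 q) 0
  | two : Rel q (serre2 q) 0

/-- `U = U_q(A(0,2)^{(4)})^+`, the free algebra on `x₁, x₂` modulo the two-sided ideal
generated by the quantum Serre relators. -/
abbrev U (q : ℂ) : Type := RingQuot (Rel q)

def π (q : ℂ) : F →ₐ[ℂ] U q := RingQuot.mkAlgHom ℂ (Rel q)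

/-- `L₁ = [X₁,Y₁] = x₁x₂ - q⁻¹ x₂x₁` in `U`. -/
def L1U (q : ℂ) : U q := π q x1 * π q x2 - q⁻¹ • (π q x2 * π q x1)

/-- real root vectors `X_n`, `n ≥ 1` (`X 0 := 0` is junk):
`X₁ = x₁`, `X_{n+1} = [X_n, L₁] = X_n L₁ - (-1)^(n-1) L₁ X_n`
(the braiding scalar is `χ((n,n-1),(1,1)) = (-1)^(n-1)`). -/
def X (q : ℂ) : ℕ → U q
  | 0 => 0
  | 1 => π q x1
  | (n+2) => X q (n+1) * L1U q - ((-1 : ℂ)^n) • (L1U q * X q (n+1))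

/-- real root vectors `Y_n`, `n ≥ 1` (`Y 0 := 0` is junk):
`Y₁ = x₂`, `Y_{n+1} = [L₁, Y_n] = L₁ Y_n - (-1)^n Y_n L₁`
(the braiding scalar is `χ((1,1),(n-1,n)) = (-1)^n`). -/
def Y (q : ℂ) : ℕ → U q
  | 0 => 0
  | 1 => π q x2
  | (n+2) => L1U q * Y q (n+1) - ((-1 : ℂ)^(n+1)) • (Y q (n+1) * L1U q)

/-- `L₀ = θ⁻¹·1`, and `L_n = [X₁, Y_n] = X₁Y_n - q⁻¹ Y_n X₁` for `n ≥ 1`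
(the braiding scalar is `χ((1,0),(n-1,n)) = q⁻¹`). -/
def L (q : ℂ) : ℕ → U q
  | 0 => (θ q)⁻¹ • 1
  | (n+1) => X q 1 * Y q (n+1) - q⁻¹ • (Y q (n+1) * X q 1)

/-- `L₀′ = θ⁻¹·1`, `L₁′ = L₁`, and
`L_n′ = [X₂, Y_{n-1}] = X₂Y_{n-1} - (-1)^(n-1) q⁻¹ Y_{n-1}X₂` for `n ≥ 2`
(the braiding scalar is `χ((2,1),(n-2,n-1)) = (-1)^(n-1) q⁻¹`). -/
def L' (q : ℂ) : ℕ → U q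
  | 0 => (θ q)⁻¹ • 1
  | 1 => L q 1
  | (n+2) => X q 2 * Y q (n+1) - ((-1 : ℂ)^(n+1) * q⁻¹) • (Y q (n+1) * X q 2)

/-- `M q n` is the element `M_{2n+1}`:  `M₁ = L₁`, `M_{2n+1} = [L₂, M_{2n-1}]`
(a plain commutator, the braiding scalar being `1`). -/
def M (q : ℂ) : ℕ → U q
  | 0 => L q 1
  | (n+1) => L q 2 * M q n - M q n * L q 2

/-- `L̃_n = (L_n + L_n′)/2`, with the convention `L̃_n = 0` for `n < 0`
(note `L̃₀ = θ⁻¹·1`). -/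
def Lt (q : ℂ) (n : ℤ) : U q :=
  if 0 ≤ n then ((2 : ℂ)⁻¹) • (L q n.toNat + L' q n.toNat) else 0

/-- `L̂_{n+1} = [L_n, L₁] = L_n L₁ - (-1)^n L₁ L_n`
(the braiding scalar is `χ((n,n),(1,1)) = (-1)^n`); in particular `L̂₁ = 0`. -/
def Lhat (q : ℂ) : ℕ → U q
  | 0 => 0
  | (n+1) => L q n * L q 1 - ((-1 : ℂ)^n) • (L q 1 * L q n)

/-- the sequence `P₀ = 1`, `P_n = q^n + q^(n-1) + (-1)^(n-1) P_(n-1)`. -/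
def P (q : ℂ) : ℕ → ℂ
  | 0 => 1
  | (n+1) => q^(n+1) + q^n + (-1 : ℂ)^n * P q n

/-- the sequence `Q₀ = 1`, `Q_n = q^n - q^(n-1) + (-1)^n Q_(n-1)`. -/
def Q (q : ℂ) : ℕ → ℂ
  | 0 => 1
  | (n+1) => q^(n+1) - q^n + (-1 : ℂ)^(n+1) * Q q n

/-- `q` is not a root of unity. -/
def NotRootOfUnity (q : ℂ) : Prop := ∀ n : ℕ, n ≠ 0 → q ^ n ≠ 1

end QAff

open QAff

/-- ascending ordered product `g 1 ^ f 0 * g 2 ^ f 1 * ⋯` attached to a finitely supported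
exponent function `f` (where `f i` is the exponent of the generator `g (i+1)`). -/
def ascProd (q : ℂ) (g : ℕ → U q) (f : ℕ →₀ ℕ) : U q :=
  ((List.range (f.support.sup id + 1)).map (fun i => g (i+1) ^ f i)).prod

/-- descending ordered product `⋯ * g 2 ^ f 1 * g 1 ^ f 0`. -/
def descProd (q : ℂ) (g : ℕ → U q) (f : ℕ →₀ ℕ) : U q :=
  ((List.range (f.support.sup id + 1)).reverse.map (fun i => g (i+1) ^ f i)).prod

/-- the PBW monomial
`(Y₁^{a(1)}Y₂^{a(2)}⋯)·(M₁^{b(1)}M₃^{b(2)}⋯)·(L₂^{c(1)}L₄^{c(2)}⋯)·(⋯X₂^{d(2)}X₁^{d(1)})`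
attached to `t = (a, b, c, d)` (indices shifted: `t.1 i` is the exponent `a(i+1)` of `Y_{i+1}`,
`t.2.1 i` the exponent of `M_{2i+1}`, `t.2.2.1 i` the exponent of `L_{2i+2}`, and
`t.2.2.2 i` the exponent of `X_{i+1}`). -/
def pbwMonomial (q : ℂ) (t : (ℕ →₀ ℕ) × (ℕ →₀ ℕ) × (ℕ →₀ ℕ) × (ℕ →₀ ℕ)) : U q :=
  ascProd q (Y q) t.1 * ascProd q (fun j => M q (j - 1)) t.2.1 *
    ascProd q (fun j => L q (2*j)) t.2.2.1 * descProd q (X q) t.2.2.2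

set_option linter.unusedSimpArgs false

structure QDatum (A : Type) [Ring A] [Algebra ℂ A] where
  q : ℂ
  α : ℂ
  x : A
  y : A
  q_ne : q ≠ 0
  not_root : ∀ n : ℕ, n ≠ 0 → q ^ n ≠ 1
  sign : α = 1 ∨ α = -1
  serreX : x * (x * (x * y - q⁻¹ • (y * x)) - α • ((x * y - q⁻¹ • (y * x)) * x)) =
    q • ((x * (x * y - q⁻¹ • (y * x)) - α • ((x * y - q⁻¹ • (y * x)) * x)) * x)
  serreY : ((x * y - q⁻¹ • (y * x)) * y + α • (y * (x * y - q⁻¹ • (y * x)))) * y =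
    q • (y * ((x * y - q⁻¹ • (y * x)) * y + α • (y * (x * y - q⁻¹ • (y * x)))))

namespace QDatum

variable {A : Type} [Ring A] [Algebra ℂ A] (D : QDatum A)

def l : A := D.x * D.y - D.q⁻¹ • (D.y * D.x)

def Y : ℕ → A
  | 0 => D.y
  | n + 1 => D.l * Y n + (D.α * (-1) ^ n) • (Y n * D.l)

def X : ℕ → A
  | 0 => D.x
  | n + 1 => X n * D.l - (D.α * (-1) ^ n) • (D.l * X n)

lemma Y_succ (n : ℕ) : D.Y (n + 1) = D.l * D.Y n + (D.α * (-1) ^ n) • (D.Y n * D.l) := rfl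
lemma X_succ (n : ℕ) : D.X (n + 1) = D.X n * D.l - (D.α * (-1) ^ n) • (D.l * D.X n) := rfl

def op : QDatum Aᵐᵒᵖ where
  q := D.q
  α := -D.α
  x := MulOpposite.op D.y
  y := MulOpposite.op D.x
  q_ne := D.q_ne
  not_root := D.not_root
  sign := by rcases D.sign with h | h <;> simp [h]
  serreX := by
    apply MulOpposite.unop_injective
    simpa using D.serreY
  serreY := by
    apply MulOpposite.unop_injective
    simpa [sub_eq_add_neg] using D.serreX

@[simp] lemma op_q : D.op.q = D.q := rfl
@[simp] lemma op_α : D.op.α = -D.α := rfl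
@[simp] lemma op_l : D.op.l = MulOpposite.op D.l := rfl

@[simp] lemma op_Y (n : ℕ) : D.op.Y n = MulOpposite.op (D.X n) := by
  induction n with
  | zero => rfl
  | succ n ih =>
    rw [Y_succ, ih, X_succ]; simp [sub_eq_add_neg]

@[simp] lemma op_X (n : ℕ) : D.op.X n = MulOpposite.op (D.Y n) := by
  induction n with
  | zero => rfl
  | succ n ih =>
    rw [X_succ, ih, Y_succ]; simp [sub_eq_add_neg]

lemma serreY' : D.Y 1 * D.y = D.q • (D.y * D.Y 1) := by
  have := D.serreY
  simpa [Y, l] using this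

lemma sq_Y (n : ℕ) : D.l * D.l * D.Y n - D.Y n * (D.l * D.l) = D.Y (n + 2) := by
  simp only [Y_succ, pow_succ]
  rcases D.sign with h | h <;> rcases neg_one_pow_eq_or ℂ n with e | e <;> rw [h, e] <;>
  simp only [mul_add, add_mul, mul_sub, sub_mul, smul_mul_assoc, mul_smul_comm, smul_sub, smul_add, smul_smul, mul_assoc] <;> module

lemma sq_X (n : ℕ) : D.l * D.l * D.X n - D.X n * (D.l * D.l) = - D.X (n + 2) := by
  have := congrArg MulOpposite.unop (D.op.sq_Y n)
  simp [mul_assoc] at this ⊢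
  linear_combination (norm := skip) - this
  module

end QDatum

namespace QDatum
variable {A : Type} [Ring A] [Algebra ℂ A] (D : QDatum A)

/-- The braiding scalar between `Y j` and `X i`. -/
def k (i j : ℕ) : ℂ :=
  D.q⁻¹ * ((1 + D.α * (-1) ^ i - D.α * (-1) ^ j + (-1) ^ i * (-1) ^ j) / 2)

def e (i j : ℕ) : A := D.X i * D.Y j - D.k i j • (D.Y j * D.X i)

def N : A := D.e 0 1 - D.α • (D.l * D.l)

lemma op_k (i j : ℕ) : D.op.k i j = D.k j i := by
  simp only [k, op_q, op_α]; ring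

@[simp] lemma op_e (i j : ℕ) : D.op.e i j = MulOpposite.op (D.e j i) := by
  simp [e, op_k]

lemma e_zero : D.e 0 0 = D.l := by
  simp [e, l, k, X, Y]

lemma X_zero : D.X 0 = D.x := rfl

lemma Y_zero : D.Y 0 = D.y := rfl

lemma XY (i j : ℕ) : D.X i * D.Y j = D.e i j + D.k i j • (D.Y j * D.X i) := by
  rw [e]; abel

lemma l_e (i j : ℕ) : D.l * D.e i j + ((-1) ^ i * (-1) ^ j : ℂ) • (D.e i j * D.l) =
    (D.α * (-1) ^ i) • (D.e i (j + 1) - D.e (i + 1) j) := by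
  simp only [e, Y_succ, X_succ, k, pow_succ]
  rcases D.sign with h | h <;> rcases neg_one_pow_eq_or ℂ i with a | a <;>
  rcases neg_one_pow_eq_or ℂ j with b | b <;> rw [h, a, b] <;>
  simp only [mul_add, add_mul, mul_sub, sub_mul, smul_mul_assoc, mul_smul_comm, smul_sub, smul_add,
    smul_smul, mul_assoc] <;> module

lemma sq_e (i j : ℕ) : D.l * D.l * D.e i j - D.e i j * (D.l * D.l) =
    D.e i (j + 2) - D.e (i + 2) j := by
  have h1 := D.sq_Y j
  have h2 := D.sq_X i
  simp only [e, k, pow_succ]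
  linear_combination (norm := skip) D.X i * h1 + h2 * D.Y j - D.k i j • (h1 * D.X i + D.Y j * h2)
  simp only [k, mul_add, add_mul, mul_sub, sub_mul, smul_mul_assoc, mul_smul_comm, smul_sub, smul_add,
    smul_smul, mul_assoc, mul_neg, neg_mul, smul_neg, mul_one, neg_neg]
  match_scalars <;> ring1

lemma e_two : D.e 0 2 = D.e 2 0 := by
  have := D.sq_e 0 0
  rw [e_zero, mul_assoc, sub_self] at this
  exact (sub_eq_zero.mp this.symm)

lemma e_one : D.e 0 1 = D.e 1 0 + (2 * D.α) • (D.l * D.l) := by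
  have h := D.l_e 0 0
  rw [e_zero] at h
  rcases D.sign with s | s <;> rw [s] at h ⊢
  · linear_combination (norm := skip) -h
    simp only [pow_zero]
    match_scalars <;> ring1
  · linear_combination (norm := skip) h
    simp only [pow_zero]
    match_scalars <;> ring1

@[simp] lemma op_N : D.op.N = MulOpposite.op D.N := by
  apply MulOpposite.unop_injective
  simp only [N, op_e, op_α, op_l, MulOpposite.unop_sub, MulOpposite.unop_op, MulOpposite.unop_smul,
    MulOpposite.unop_mul, e_one, MulOpposite.unop_add]
  module

/-- The scalar `q - q⁻¹`. -/
def th : ℂ := D.q - D.q⁻¹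

@[simp] lemma op_th : D.op.th = D.th := rfl

lemma N_Y_zero : D.N * D.Y 0 - D.Y 0 * D.N =
    (D.q - D.α) • D.Y 2 + (D.α * D.th) • (D.Y 1 * D.l) := by
  have hq := D.q_ne
  have S := D.serreY'
  have hxy : D.x * D.y = D.l + D.q⁻¹ • (D.y * D.x) := by rw [l]; abel
  have h2 := D.sq_Y 0
  have h3 := D.Y_succ 1
  have e1 : D.X 0 = D.x := rfl
  have e2 : D.Y 0 = D.y := rfl
  rw [N, e, e1, e2]
  rw [e2] at h2
  linear_combination (norm := skip) D.x * S - (D.α * D.q⁻¹ * D.q⁻¹) • (S * D.x)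
    - (D.α * D.q⁻¹) • (D.Y 1 * hxy) + D.q • (hxy * D.Y 1) - D.α • h2 - D.q • h3
  rcases D.sign with s | s <;>
  simp only [k, th, s, mul_add, add_mul, mul_sub, sub_mul, smul_mul_assoc, mul_smul_comm, smul_sub, smul_add,
    smul_smul, mul_assoc, mul_neg, neg_mul, smul_neg, mul_one, neg_neg, one_mul, one_smul, smul_zero, mul_zero, zero_mul, neg_smul,
    Nat.reduceAdd, zero_add] <;>
  match_scalars <;> field_simp <;> ring1

lemma N_X_zero : D.N * D.X 0 - D.X 0 * D.N =
    -((D.q + D.α) • D.X 2) + (D.α * D.th) • (D.l * D.X 1) := by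
  have := congrArg MulOpposite.unop D.op.N_Y_zero
  simp at this
  linear_combination (norm := module) - this

end QDatum

namespace QDatum
variable {A : Type} [Ring A] [Algebra ℂ A] (D : QDatum A)

lemma N_eq : D.N = D.e 0 1 - D.α • (D.l * D.l) := rfl
lemma N_eq' : D.N = D.e 1 0 + D.α • (D.l * D.l) := by
  rw [N_eq, e_one]; module

lemma N_l : D.N * D.l - D.l * D.N =
    -((2 * D.α) • D.e 0 2) + (D.α * D.th) • (D.N * D.l + D.l * D.N) := by
  have hq := D.q_ne
  have hl : D.l = D.x * D.y - D.q⁻¹ • (D.y * D.x) := rfl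
  have h0 := D.N_eq
  have h1 := D.N_eq'
  have hy := D.N_Y_zero
  have hx := D.N_X_zero
  have h2 := D.e_two
  have hY := D.Y_succ 0
  have hX := D.X_succ 0
  rw [e] at h0 h1
  rw [e, e] at h2
  rw [e]
  linear_combination (norm := skip) D.N * hl - hl * D.N + hx * D.y + D.x * hy - D.q⁻¹ • (hy * D.x + D.y * hx)
    - (D.α * D.th) • (h0 * D.l + D.l * h1) + (D.q + D.α) • h2
    + (D.th * D.q⁻¹) • (hY * D.X 1 - D.Y 1 * hX)
  rcases D.sign with s | s <;>
  simp only [k, th, s, mul_add, add_mul, mul_sub, sub_mul, smul_mul_assoc, mul_smul_comm, smul_sub, smul_add,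
    smul_smul, mul_assoc, mul_neg, neg_mul, smul_neg, mul_one, neg_neg, one_mul, one_smul, smul_zero,
    mul_zero, zero_mul, neg_smul, Nat.reduceAdd, zero_add, X_zero, Y_zero] <;>
  match_scalars <;> field_simp <;> ring1

lemma e_add : D.e 0 2 + D.e 1 1 = D.th • (D.N * D.l + D.l * D.N) := by
  have h := D.N_l
  have h2 := D.l_e 0 1
  have h0 := D.N_eq
  rcases D.sign with s | s <;> rw [s] at h h2 h0
  · linear_combination (norm := skip) h + h2 + D.l * h0 - h0 * D.l
    simp only [mul_add, add_mul, mul_sub, sub_mul, smul_mul_assoc, mul_smul_comm, smul_sub, smul_add,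
    smul_smul, mul_assoc, mul_neg, neg_mul, smul_neg, mul_one, neg_neg, one_mul, one_smul, smul_zero,
    mul_zero, zero_mul, neg_smul, Nat.reduceAdd, zero_add, X_zero, Y_zero]
    match_scalars <;> ring1
  · linear_combination (norm := skip) -h - h2 - D.l * h0 + h0 * D.l
    simp only [mul_add, add_mul, mul_sub, sub_mul, smul_mul_assoc, mul_smul_comm, smul_sub, smul_add,
    smul_smul, mul_assoc, mul_neg, neg_mul, smul_neg, mul_one, neg_neg, one_mul, one_smul, smul_zero,
    mul_zero, zero_mul, neg_smul, Nat.reduceAdd, zero_add, X_zero, Y_zero]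
    match_scalars <;> ring1

end QDatum

namespace QDatum
variable {A : Type} [Ring A] [Algebra ℂ A] (D : QDatum A)

lemma coeff_ne : D.q + D.q⁻¹ - D.α ≠ 0 := by
  intro h
  have hq := D.q_ne
  have h3 := D.not_root 6 (by norm_num)
  rcases D.sign with s | s <;> rw [s] at h <;> field_simp at h <;> apply h3
  · linear_combination (D.q ^ 4 + D.q ^ 3 - D.q - 1) * h
  · linear_combination (D.q ^ 4 - D.q ^ 3 + D.q - 1) * h

lemma l_serreY : D.Y 2 * D.y - (D.q - D.α) • (D.Y 1 * D.Y 1) + (D.q * D.α) • (D.y * D.Y 2) = 0 := by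
  have S := D.serreY'
  have hY := D.Y_succ 0
  have hY1 := D.Y_succ 1
  rcases D.sign with s | s <;> rw [s] at hY hY1 ⊢
  · linear_combination (norm := skip) D.l * S + S * D.l + hY1 * D.y + D.Y 1 * hY
      + D.q • (D.y * hY1 - hY * D.Y 1)
    simp only [mul_add, add_mul, mul_sub, sub_mul, smul_mul_assoc, mul_smul_comm, smul_sub, smul_add,
    smul_smul, mul_assoc, mul_neg, neg_mul, smul_neg, mul_one, neg_neg, one_mul, one_smul, smul_zero,
    mul_zero, zero_mul, neg_smul, Nat.reduceAdd, zero_add, X_zero, Y_zero]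
    match_scalars <;> ring1
  · linear_combination (norm := skip) D.l * S + S * D.l + hY1 * D.y - D.Y 1 * hY
      - D.q • (D.y * hY1 + hY * D.Y 1)
    simp only [mul_add, add_mul, mul_sub, sub_mul, smul_mul_assoc, mul_smul_comm, smul_sub, smul_add,
    smul_smul, mul_assoc, mul_neg, neg_mul, smul_neg, mul_one, neg_neg, one_mul, one_smul, smul_zero,
    mul_zero, zero_mul, neg_smul, Nat.reduceAdd, zero_add, X_zero, Y_zero]
    match_scalars <;> ring1

lemma x_l_serreY : D.e 0 2 * D.y + D.α • (D.y * D.e 0 2) + D.q⁻¹ • (D.Y 2 * D.l)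
    + (D.q * D.α) • (D.l * D.Y 2)
    - (D.q - D.α) • (D.e 0 1 * D.Y 1 + (D.α * D.q⁻¹) • (D.Y 1 * D.e 0 1)) = 0 := by
  have hq := D.q_ne
  have S := D.l_serreY
  have hxy : D.x * D.y = D.l + D.q⁻¹ • (D.y * D.x) := by rw [l]; abel
  linear_combination (norm := skip) D.x * S - (D.q⁻¹ * D.q⁻¹) • (S * D.x) - D.q⁻¹ • (D.Y 2 * hxy)
    - (D.q * D.α) • (hxy * D.Y 2)
  rcases D.sign with s | s <;>
  simp only [e, k, th, s, mul_add, add_mul, mul_sub, sub_mul, smul_mul_assoc, mul_smul_comm, smul_sub, smul_add,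
    smul_smul, mul_assoc, mul_neg, neg_mul, smul_neg, mul_one, neg_neg, one_mul, one_smul, smul_zero,
    mul_zero, zero_mul, neg_smul, Nat.reduceAdd, zero_add, X_zero, Y_zero] <;>
  match_scalars <;> field_simp <;> ring1

lemma two_e : (2 : ℂ) • D.e 0 2 = (D.th - D.α) • (D.N * D.l) + (D.th + D.α) • (D.l * D.N) := by
  have h := D.N_l
  rcases D.sign with s | s <;> rw [s] at h ⊢
  · linear_combination (norm := module) (1:ℂ) • h
  · linear_combination (norm := module) -h

lemma N_Y_one : D.N * D.Y 1 - D.Y 1 * D.N =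
    (D.q + D.α) • D.Y 3 - (D.α * D.th) • (D.Y 2 * D.l) := by
  have hq := D.q_ne
  suffices h : (D.q + D.q⁻¹ - D.α) • (D.N * D.Y 1 - D.Y 1 * D.N -
    ((D.q + D.α) • D.Y 3 - (D.α * D.th) • (D.Y 2 * D.l))) = 0 by
    exact sub_eq_zero.mp ((smul_eq_zero.mp h).resolve_left D.coeff_ne)
  have h0 : D.e 0 1 = D.N + D.α • (D.l * D.l) := by rw [N]; abel
  have hy := D.N_Y_zero
  have hY := D.Y_succ 0
  have hY1 := D.Y_succ 1
  have hY2 := D.Y_succ 2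
  have hs := D.sq_Y 1
  have hE := D.two_e
  have R2 := D.x_l_serreY
  linear_combination (norm := skip) (-2 : ℂ) • R2 + hE * D.y + D.α • (D.y * hE)
    - (D.th - D.α) • (D.N * hY + D.α • (hy * D.l)) + (D.th + D.α) • (D.l * hy - hY * D.N)
    - ((D.th + D.α) * (D.q - D.α) + 2 * D.q * D.α) • hY2
    - (D.α * D.th * (D.th + D.α)) • (hY1 * D.l)
    - (2 * (D.q - D.α)) • (h0 * D.Y 1 + (D.α * D.q⁻¹) • (D.Y 1 * h0)) - (2 * (D.q - D.α) * D.α) • hs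
  rcases D.sign with s | s <;>
  simp only [th, s, mul_add, add_mul, mul_sub, sub_mul, smul_mul_assoc, mul_smul_comm, smul_sub, smul_add,
    smul_smul, mul_assoc, mul_neg, neg_mul, smul_neg, mul_one, neg_neg, one_mul, one_smul, smul_zero,
    mul_zero, zero_mul, neg_smul, Nat.reduceAdd, zero_add, X_zero, Y_zero] <;>
  match_scalars <;> field_simp <;> ring1

lemma N_X_one : D.N * D.X 1 - D.X 1 * D.N =
    -((D.q - D.α) • D.X 3) - (D.α * D.th) • (D.l * D.X 2) := by
  have := congrArg MulOpposite.unop D.op.N_Y_one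
  simp at this
  linear_combination (norm := module) - this

end QDatum

namespace QDatum
variable {A : Type} [Ring A] [Algebra ℂ A] (D : QDatum A)

def NYRel (p : ℕ) : Prop := D.N * D.Y p - D.Y p * D.N =
    (D.q - D.α * (-1) ^ p) • D.Y (p + 2) + (D.α * (-1) ^ p * D.th) • (D.Y (p + 1) * D.l)

def NXRel (m : ℕ) : Prop := D.N * D.X m - D.X m * D.N =
    -((D.q + D.α * (-1) ^ m) • D.X (m + 2)) + (D.α * (-1) ^ m * D.th) • (D.l * D.X (m + 1))

lemma N_e_of {m p : ℕ} (hX : D.NXRel m) (hY : D.NYRel p) :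
    D.N * D.e m p - D.e m p * D.N =
    (D.q - D.α * (-1) ^ p) • D.e m (p + 2) - (D.q + D.α * (-1) ^ m) • D.e (m + 2) p
    + (D.α * (-1) ^ p * D.th) • (D.e m (p + 1) * D.l)
    + (D.α * (-1) ^ m * D.th) • (D.l * D.e (m + 1) p) := by
  have hq := D.q_ne
  rw [NXRel] at hX
  rw [NYRel] at hY
  have h1 := D.Y_succ p
  have h2 := D.X_succ m
  linear_combination (norm := skip) D.X m * hY + hX * D.Y p - D.k m p • (D.Y p * hX + hY * D.X m)
    - (D.k m p * (-1 : ℂ) ^ m * (-1 : ℂ) ^ p * D.th) • (D.Y (p + 1) * h2)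
    + (D.k m p * (-1 : ℂ) ^ m * (-1 : ℂ) ^ p * D.th) • (h1 * D.X (m + 1))
  rcases D.sign with h | h <;> rcases neg_one_pow_eq_or ℂ m with a | a <;>
  rcases neg_one_pow_eq_or ℂ p with b | b <;>
  simp only [h, a, b, e, k, th, pow_succ, pow_zero, pow_one, add_assoc, mul_add, add_mul, mul_sub, sub_mul, smul_mul_assoc, mul_smul_comm, smul_sub, smul_add,
    smul_smul, mul_assoc, mul_neg, neg_mul, smul_neg, mul_one, neg_neg, one_mul, one_smul, smul_zero,
    mul_zero, zero_mul, neg_smul, Nat.reduceAdd, zero_add, X_zero, Y_zero] <;>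
  match_scalars <;> field_simp <;> ring1

lemma sq_add_one_ne : D.q + D.q⁻¹ ≠ 0 := by
  intro h
  have hq := D.q_ne
  have h3 := D.not_root 4 (by norm_num)
  field_simp at h
  apply h3
  linear_combination (D.q ^ 2 - 1) * h

lemma NYRel_zero : D.NYRel 0 := by
  rw [NYRel, N_Y_zero]; module

lemma NYRel_one : D.NYRel 1 := by
  rw [NYRel, N_Y_one]; module

lemma NXRel_zero : D.NXRel 0 := by
  rw [NXRel, N_X_zero]; module

lemma NXRel_one : D.NXRel 1 := by
  rw [NXRel, N_X_one]; module

lemma sq_N : D.l * D.l * D.N - D.N * (D.l * D.l) = 0 := by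
  have h := D.N_e_of D.NXRel_zero D.NYRel_one
  have h' := D.N_e_of D.NXRel_one D.NYRel_zero
  have a1 := D.sq_e 0 1
  have a2 := D.sq_e 1 0
  have b := D.l_e 0 1
  have h0 := D.N_eq
  have h1 := D.N_eq'
  have h2 := D.e_two
  suffices h : (D.q + D.q⁻¹) • (D.l * D.l * D.N - D.N * (D.l * D.l)) = 0 by
    exact (smul_eq_zero.mp h).resolve_left D.sq_add_one_ne
  have hq := D.q_ne
  linear_combination (norm := skip) -(h + h' + (D.N * h0 - h0 * D.N) + (D.N * h1 - h1 * D.N)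
    - (D.q + D.α) • (a1 + (D.l * D.l * h0 - h0 * (D.l * D.l)))
    - (D.q - D.α) • (a2 + (D.l * D.l * h1 - h1 * (D.l * D.l))))
    - D.th • (D.l * b + b * D.l + (D.l * D.l * h0 - h0 * (D.l * D.l)))
    - (D.α * D.th) • (D.l * h2)
  rcases D.sign with h | h <;>
  simp only [h, th, pow_succ, pow_zero, pow_one, add_assoc, mul_add, add_mul, mul_sub, sub_mul, smul_mul_assoc, mul_smul_comm, smul_sub, smul_add,
    smul_smul, mul_assoc, mul_neg, neg_mul, smul_neg, mul_one, neg_neg, one_mul, one_smul, smul_zero,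
    mul_zero, zero_mul, neg_smul, Nat.reduceAdd, zero_add, X_zero, Y_zero] <;>
  match_scalars <;> field_simp <;> ring1

end QDatum

namespace QDatum
variable {A : Type} [Ring A] [Algebra ℂ A] (D : QDatum A)

lemma NYRel_add_two {p : ℕ} (h : D.NYRel p) : D.NYRel (p + 2) := by
  rw [NYRel] at *
  have a := D.sq_Y p
  have b := D.sq_Y (p + 1)
  have c := D.sq_Y (p + 2)
  have e := D.sq_N
  have hl : D.l * D.l * (D.Y (p + 1) * D.l) - D.Y (p + 1) * D.l * (D.l * D.l)
    = (D.l * D.l * D.Y (p + 1) - D.Y (p + 1) * (D.l * D.l)) * D.l := by noncomm_ring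
  linear_combination (norm := skip) D.l * D.l * h - h * (D.l * D.l) - D.N * a + a * D.N
    - e * D.Y p + D.Y p * e + (D.q - D.α * (-1 : ℂ) ^ p) • c
    + (D.α * (-1 : ℂ) ^ p * D.th) • (b * D.l)
  simp only [pow_succ, pow_zero, pow_one, add_assoc, mul_add, add_mul, mul_sub, sub_mul, smul_mul_assoc, mul_smul_comm, smul_sub, smul_add,
    smul_smul, mul_assoc, mul_neg, neg_mul, smul_neg, mul_one, neg_neg, one_mul, one_smul, smul_zero,
    mul_zero, zero_mul, neg_smul, Nat.reduceAdd, zero_add, X_zero, Y_zero]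
  match_scalars <;> ring1

theorem N_Y (p : ℕ) : D.NYRel p := by
  induction p using Nat.twoStepInduction with
  | zero => exact D.NYRel_zero
  | one => exact D.NYRel_one
  | more n h _ => exact D.NYRel_add_two h

lemma NXRel_add_two {p : ℕ} (h : D.NXRel p) : D.NXRel (p + 2) := by
  rw [NXRel] at *
  have a := D.sq_X p
  have b := D.sq_X (p + 1)
  have c := D.sq_X (p + 2)
  have e := D.sq_N
  linear_combination (norm := skip) -(D.l * D.l * h - h * (D.l * D.l)) + D.N * a - a * D.N
    + e * D.X p - D.X p * e + (D.q + D.α * (-1 : ℂ) ^ p) • c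
    - (D.α * (-1 : ℂ) ^ p * D.th) • (D.l * b)
  simp only [pow_succ, pow_zero, pow_one, add_assoc, mul_add, add_mul, mul_sub, sub_mul, smul_mul_assoc, mul_smul_comm, smul_sub, smul_add,
    smul_smul, mul_assoc, mul_neg, neg_mul, smul_neg, mul_one, neg_neg, one_mul, one_smul, smul_zero,
    mul_zero, zero_mul, neg_smul, Nat.reduceAdd, zero_add, X_zero, Y_zero]
  match_scalars <;> ring1

theorem N_X (p : ℕ) : D.NXRel p := by
  induction p using Nat.twoStepInduction with
  | zero => exact D.NXRel_zero
  | one => exact D.NXRel_one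
  | more n h _ => exact D.NXRel_add_two h

theorem N_e (m p : ℕ) : D.N * D.e m p - D.e m p * D.N =
    (D.q - D.α * (-1) ^ p) • D.e m (p + 2) - (D.q + D.α * (-1) ^ m) • D.e (m + 2) p
    + (D.α * (-1) ^ p * D.th) • (D.e m (p + 1) * D.l)
    + (D.α * (-1) ^ m * D.th) • (D.l * D.e (m + 1) p) :=
  D.N_e_of (D.N_X m) (D.N_Y p)

/-- the quadratic relation between real root vectors of indices of equal parity -/
def E (n m : ℕ) : A := D.Y (n + 1) * D.Y m - D.q • (D.Y n * D.Y (m + 1))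
    - D.q • (D.Y m * D.Y (n + 1)) + D.Y (m + 1) * D.Y n

lemma E_symm (n m : ℕ) : D.E n m = D.E m n := by
  simp only [E]; abel

lemma sq_E (n m : ℕ) : D.l * D.l * D.E n m - D.E n m * (D.l * D.l)
    = D.E (n + 2) m + D.E n (m + 2) := by
  have a := D.sq_Y n
  have b := D.sq_Y m
  have c := D.sq_Y (n + 1)
  have d := D.sq_Y (m + 1)
  simp only [E]
  linear_combination (norm := skip) c * D.Y m + D.Y (n + 1) * b
    - D.q • (a * D.Y (m + 1) + D.Y n * d) - D.q • (b * D.Y (n + 1) + D.Y m * c)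
    + d * D.Y n + D.Y (m + 1) * a
  simp only [pow_succ, pow_zero, pow_one, add_assoc, mul_add, add_mul, mul_sub, sub_mul, smul_mul_assoc, mul_smul_comm, smul_sub, smul_add,
    smul_smul, mul_assoc, mul_neg, neg_mul, smul_neg, mul_one, neg_neg, one_mul, one_smul, smul_zero,
    mul_zero, zero_mul, neg_smul, Nat.reduceAdd, zero_add, X_zero, Y_zero]
  match_scalars <;> ring1

lemma E_zero : D.E 0 0 = 0 := by
  have h := D.serreY'
  simp only [E, zero_add, Y_zero]
  linear_combination (norm := module) (2 : ℂ) • h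

/-- `ad l` applied to `E n m` -/
lemma DE {n m : ℕ} (s : (-1 : ℂ) ^ m = (-1) ^ n) (h : D.E n m = 0) :
    D.Y (n + 2) * D.Y m + D.Y (m + 2) * D.Y n
    - (D.q - D.α * (-1) ^ n) • (D.Y (n + 1) * D.Y (m + 1) + D.Y (m + 1) * D.Y (n + 1))
    + (D.q * D.α * (-1) ^ n) • (D.Y n * D.Y (m + 2) + D.Y m * D.Y (n + 2)) = 0 := by
  have a := D.Y_succ n
  have b := D.Y_succ m
  have c := D.Y_succ (n + 1)
  have d := D.Y_succ (m + 1)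
  rw [E] at h
  rw [pow_succ] at c d
  rw [s] at b d
  linear_combination (norm := skip) D.l * h + h * D.l
    + (c * D.Y m + (D.α * (-1 : ℂ) ^ n) • (D.Y (n + 1) * b))
    - D.q • (a * D.Y (m + 1) - (D.α * (-1 : ℂ) ^ n) • (D.Y n * d))
    - D.q • (b * D.Y (n + 1) - (D.α * (-1 : ℂ) ^ n) • (D.Y m * c))
    + (d * D.Y n + (D.α * (-1 : ℂ) ^ n) • (D.Y (m + 1) * a))
  rcases D.sign with a | a <;> rcases neg_one_pow_eq_or ℂ n with b | b <;>
  simp only [a, b, s, pow_succ, add_assoc, mul_add, add_mul, mul_sub, sub_mul, smul_mul_assoc, mul_smul_comm, smul_sub, smul_add,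
    smul_smul, mul_assoc, mul_neg, neg_mul, smul_neg, mul_one, neg_neg, one_mul, one_smul, smul_zero,
    mul_zero, zero_mul, neg_smul, Nat.reduceAdd, zero_add, X_zero, Y_zero] <;>
  match_scalars <;> ring1

lemma E_succ_self {c : ℕ} (h : D.E c c = 0) : D.E (c + 1) (c + 1) = 0 := by
  suffices h : (D.q + D.q⁻¹) • D.E (c + 1) (c + 1) = 0 by
    exact (smul_eq_zero.mp h).resolve_left D.sq_add_one_ne
  have d := D.DE rfl h
  have a := D.N_Y c
  have b := D.N_Y (c + 1)
  have e := D.Y_succ c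
  have e' := D.Y_succ (c + 1)
  have s2 := D.sq_E c c
  rw [NYRel] at a b
  rw [h] at s2
  have hq := D.q_ne
  have t : (-1 : ℂ) ^ (c + 1) = - (-1) ^ c := by rw [pow_succ]; ring
  rw [t] at e' b
  simp only [E] at h s2 ⊢
  set s : ℂ := (-1) ^ c with hs
  linear_combination (norm := skip) (D.α * s) • (D.N * h - h * D.N
    - (2 : ℂ) • (b * D.Y c + D.Y (c + 1) * a - D.q • (a * D.Y (c + 1) + D.Y c * b))
    + (D.q + D.α * s) • s2 - D.th • (d * D.l)
    - (2 * D.α * s * D.th) • (D.Y (c + 2) * e)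
    - (2 * D.q * D.α * s * D.th) • (D.Y (c + 1) * e'))
  rcases D.sign with a | a <;> rcases neg_one_pow_eq_or ℂ c with b | b <;> rw [← hs] at b <;>
  simp only [a, b, th, add_assoc, mul_add, add_mul, mul_sub, sub_mul, smul_mul_assoc, mul_smul_comm, smul_sub, smul_add,
    smul_smul, mul_assoc, mul_neg, neg_mul, smul_neg, mul_one, neg_neg, one_mul, one_smul, smul_zero,
    mul_zero, zero_mul, neg_smul, Nat.reduceAdd, zero_add, X_zero, Y_zero] <;>
  match_scalars <;> field_simp <;> ring1

theorem E_self (c : ℕ) : D.E c c = 0 := by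
  induction c with
  | zero => exact D.E_zero
  | succ c h => exact D.E_succ_self h

theorem E_add_two_mul (d c : ℕ) : D.E (c + 2 * d) c = 0 := by
  induction d using Nat.twoStepInduction generalizing c with
  | zero => exact D.E_self c
  | one =>
    have h := D.sq_E c c
    rw [D.E_self, D.E_symm c (c + 2), mul_zero, zero_mul, sub_zero] at h
    have : (2 : ℂ) • D.E (c + 2 * 1) c = 0 := by rw [two_smul]; exact h.symm
    exact (smul_eq_zero.mp this).resolve_left two_ne_zero
  | more d h1 h2 =>
    have h := D.sq_E (c + 2 * (d + 1)) c
    have h3 := h1 (c + 2)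
    rw [show c + 2 + 2 * d = c + 2 * (d + 1) by ring] at h3
    rw [h2, h3, mul_zero, zero_mul, sub_zero, add_zero] at h
    exact h.symm

theorem E_eq_zero {n m : ℕ} (h : n % 2 = m % 2) : D.E n m = 0 := by
  rcases le_total n m with h' | h'
  · rw [E_symm]
    have := D.E_add_two_mul ((m - n) / 2) n
    rwa [show n + 2 * ((m - n) / 2) = m by omega] at this
  · have := D.E_add_two_mul ((n - m) / 2) m
    rwa [show m + 2 * ((n - m) / 2) = n by omega] at this

end QDatum

namespace QDatum
variable {A : Type} [Ring A] [Algebra ℂ A] (D : QDatum A)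

lemma k_congr {i i' j j' : ℕ} (hi : i % 2 = i' % 2) (hj : j % 2 = j' % 2) :
    D.k i j = D.k i' j' := by
  have h1 : (-1 : ℂ) ^ i = (-1) ^ i' := by
    rw [neg_one_pow_eq_pow_mod_two, hi, ← neg_one_pow_eq_pow_mod_two]
  have h2 : (-1 : ℂ) ^ j = (-1) ^ j' := by
    rw [neg_one_pow_eq_pow_mod_two, hj, ← neg_one_pow_eq_pow_mod_two]
  simp only [k, h1, h2]

/-- the relation exchanging `e i _` with `Y _` -/
def Phi (i n m : ℕ) : A := D.e i (n + 1) * D.Y m - D.q • (D.e i n * D.Y (m + 1))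
    - (D.q * D.k i m) • (D.Y m * D.e i (n + 1)) + D.k i (m + 1) • (D.Y (m + 1) * D.e i n)

lemma Phi_add (i : ℕ) {n m : ℕ} (h : n % 2 = m % 2) : D.Phi i n m + D.Phi i m n = 0 := by
  have a := D.E_eq_zero h
  have h1 : D.k i m = D.k i n := D.k_congr rfl h.symm
  have h2 : D.k i (m + 1) = D.k i (n + 1) := D.k_congr rfl (by omega)
  simp only [E] at a
  simp only [Phi, e, h1, h2]
  linear_combination (norm := skip) D.X i * a - (D.k i n * D.k i (n + 1)) • (a * D.X i)
  simp only [mul_add, add_mul, mul_sub, sub_mul, smul_mul_assoc, mul_smul_comm, smul_sub, smul_add,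
    smul_smul, mul_assoc, mul_neg, neg_mul, smul_neg, mul_one, neg_neg, one_mul, one_smul, smul_zero,
    mul_zero, zero_mul, neg_smul, Nat.reduceAdd, zero_add, X_zero, Y_zero]
  match_scalars <;> ring1

lemma Phi_self (i n : ℕ) : D.Phi i n n = 0 := by
  have : (2 : ℂ) • D.Phi i n n = 0 := by rw [two_smul]; exact D.Phi_add i rfl
  exact (smul_eq_zero.mp this).resolve_left two_ne_zero

/-- the square of `l` commutes with `e i j` -/
def SqComm (i j : ℕ) : Prop := D.l * D.l * D.e i j - D.e i j * (D.l * D.l) = 0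

lemma sq_Phi {i n : ℕ} (m : ℕ) (h1 : D.SqComm i n) (h2 : D.SqComm i (n + 1)) :
    D.l * D.l * D.Phi i n m - D.Phi i n m * (D.l * D.l) = D.Phi i n (m + 2) := by
  have a := D.sq_Y m
  have b := D.sq_Y (m + 1)
  rw [SqComm] at h1 h2
  simp only [Phi, D.k_congr rfl (show (m + 2) % 2 = m % 2 by omega),
    D.k_congr rfl (show (m + 2 + 1) % 2 = (m + 1) % 2 by omega)]
  linear_combination (norm := skip) h2 * D.Y m + D.e i (n + 1) * a
    - D.q • (h1 * D.Y (m + 1) + D.e i n * b)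
    - (D.q * D.k i m) • (a * D.e i (n + 1) + D.Y m * h2)
    + D.k i (m + 1) • (b * D.e i n + D.Y (m + 1) * h1)
  simp only [add_assoc, mul_add, add_mul, mul_sub, sub_mul, smul_mul_assoc, mul_smul_comm, smul_sub, smul_add,
    smul_smul, mul_assoc, mul_neg, neg_mul, smul_neg, mul_one, neg_neg, one_mul, one_smul, smul_zero,
    mul_zero, zero_mul, neg_smul, Nat.reduceAdd, zero_add, X_zero, Y_zero]
  match_scalars <;> ring1

lemma Phi_add_two_mul {i n : ℕ} (h1 : D.SqComm i n) (h2 : D.SqComm i (n + 1)) (d : ℕ) :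
    D.Phi i n (n + 2 * d) = 0 := by
  induction d with
  | zero => exact D.Phi_self i n
  | succ d ih =>
    have := D.sq_Phi (n + 2 * d) h1 h2
    rw [ih, mul_zero, zero_mul, sub_zero] at this
    exact this.symm

theorem Phi_eq_zero {i n m : ℕ} (h : n % 2 = m % 2) (h1 : D.SqComm i (min n m))
    (h2 : D.SqComm i (min n m + 1)) : D.Phi i n m = 0 := by
  rcases le_total n m with h' | h'
  · rw [min_eq_left h'] at h1 h2
    have := D.Phi_add_two_mul h1 h2 ((m - n) / 2)
    rwa [show n + 2 * ((m - n) / 2) = m by omega] at this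
  · rw [min_eq_right h'] at h1 h2
    have := D.Phi_add_two_mul h1 h2 ((n - m) / 2)
    rw [show m + 2 * ((n - m) / 2) = n by omega] at this
    have h3 := D.Phi_add i h
    rwa [this, add_zero] at h3

/-- the mirror image of `Phi`, exchanging `X _` with `e _ j` -/
def PhiX (j n m : ℕ) : A := D.X m * D.e (n + 1) j - D.q • (D.X (m + 1) * D.e n j)
    - (D.q * D.k m j) • (D.e (n + 1) j * D.X m) + D.k (m + 1) j • (D.e n j * D.X (m + 1))

theorem PhiX_eq_zero {j n m : ℕ} (h : n % 2 = m % 2) (h1 : D.SqComm (min n m) j)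
    (h2 : D.SqComm (min n m + 1) j) : D.PhiX j n m = 0 := by
  have aux (i j : ℕ) (h : D.SqComm i j) : D.op.SqComm j i := by
    have := congrArg MulOpposite.op h
    simp only [SqComm, op_l, op_e] at this ⊢
    simp only [MulOpposite.op_sub, MulOpposite.op_mul, MulOpposite.op_zero] at this
    rw [← neg_eq_zero, neg_sub]
    simpa only [mul_assoc] using this
  have := congrArg MulOpposite.unop (D.op.Phi_eq_zero h (aux _ _ h1) (aux _ _ h2))
  simpa [Phi, op_e, op_k, PhiX] using this

end QDatum

namespace QDatum
variable {A : Type} [Ring A] [Algebra ℂ A] (D : QDatum A)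

/-- the root vectors of weight `(n, n)`, first version -/
def a : ℕ → A
  | 0 => D.th⁻¹ • 1
  | n + 1 => D.e 0 n

/-- the root vectors of weight `(n, n)`, second version -/
def b : ℕ → A
  | 0 => D.th⁻¹ • 1
  | 1 => D.l
  | n + 2 => D.e 1 n

lemma a_succ (n : ℕ) : D.a (n + 1) = D.e 0 n := rfl
lemma b_one : D.b 1 = D.l := rfl
lemma b_add_two (n : ℕ) : D.b (n + 2) = D.e 1 n := rfl

lemma th_ne : D.th ≠ 0 := by
  intro h
  have hq := D.q_ne
  have := D.not_root 2 (by norm_num)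
  rw [th] at h
  field_simp at h
  apply this
  linear_combination h

lemma exchange {u₂ u₁ v₁ v₀ : A} {i p : ℕ}
    (hY₁ : u₂ * D.Y p - D.q • (u₁ * D.Y (p + 1)) - (D.q * D.k (i + 1) p) • (D.Y p * u₂)
      + D.k (i + 1) (p + 1) • (D.Y (p + 1) * u₁) = 0)
    (hY₂ : v₁ * D.Y p - D.q • (v₀ * D.Y (p + 1)) - (D.q * D.k i p) • (D.Y p * v₁)
      + D.k i (p + 1) • (D.Y (p + 1) * v₀) = 0)
    (hX₁ : D.X i * u₂ - D.q • (D.X (i + 1) * v₁) - (D.q * D.k i (p + 1)) • (u₂ * D.X i)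
      + D.k (i + 1) (p + 1) • (v₁ * D.X (i + 1)) = 0)
    (hX₀ : D.X i * u₁ - D.q • (D.X (i + 1) * v₀) - (D.q * D.k i p) • (u₁ * D.X i)
      + D.k (i + 1) p • (v₀ * D.X (i + 1)) = 0) :
    (D.q * D.k i (p + 1)) • (u₂ * D.e i p) - D.k (i + 1) (p + 1) • (v₁ * D.e (i + 1) p)
    - (D.q ^ 2 * D.k i p) • (u₁ * D.e i (p + 1))
    + (D.q * D.k (i + 1) p) • (v₀ * D.e (i + 1) (p + 1))
    - (D.q * D.k (i + 1) p) • (D.e i p * u₂) + D.k (i + 1) (p + 1) • (D.e i (p + 1) * u₁)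
    + (D.q ^ 2 * D.k i p) • (D.e (i + 1) p * v₁)
    - (D.q * D.k i (p + 1)) • (D.e (i + 1) (p + 1) * v₀) = 0 := by
  simp only [e]
  linear_combination (norm := skip) D.X i * hY₁ - D.q • (D.X (i + 1) * hY₂) - hX₁ * D.Y p
    + D.q • (hX₀ * D.Y (p + 1)) - (D.q * D.k i p * D.k i (p + 1)) • (hY₁ * D.X i)
    + (D.k (i + 1) p * D.k (i + 1) (p + 1)) • (hY₂ * D.X (i + 1))
    + (D.q * D.k (i + 1) p * D.k i p) • (D.Y p * hX₁)
    - (D.k (i + 1) (p + 1) * D.k i (p + 1)) • (D.Y (p + 1) * hX₀)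
  simp only [add_assoc, mul_add, add_mul, mul_sub, sub_mul, smul_mul_assoc, mul_smul_comm, smul_sub, smul_add,
    smul_smul, mul_assoc, mul_neg, neg_mul, smul_neg, mul_one, neg_neg, one_mul, one_smul, smul_zero,
    mul_zero, zero_mul, neg_smul, Nat.reduceAdd, zero_add, X_zero, Y_zero]
  match_scalars <;> ring1

def RYa (n m : ℕ) : Prop := D.a (n + 1) * D.Y m - D.q • (D.a n * D.Y (m + 1))
  - (D.q * D.k 0 m) • (D.Y m * D.a (n + 1)) + D.k 0 (m + 1) • (D.Y (m + 1) * D.a n) = 0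

def RYb (n m : ℕ) : Prop := D.b (n + 1) * D.Y m - D.q • (D.b n * D.Y (m + 1))
  - (D.q * D.k 1 m) • (D.Y m * D.b (n + 1)) + D.k 1 (m + 1) • (D.Y (m + 1) * D.b n) = 0

def RXb (n m : ℕ) : Prop := D.X m * D.b (n + 1) - D.q • (D.X (m + 1) * D.a n)
  - (D.q * D.k m (n + 1)) • (D.b (n + 1) * D.X m)
  + D.k (m + 1) (n + 1) • (D.a n * D.X (m + 1)) = 0

def RXa (n m : ℕ) : Prop := D.X m * D.a (n + 1) - D.q • (D.X (m + 1) * D.b n)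
  - (D.q * D.k m n) • (D.a (n + 1) * D.X m) + D.k (m + 1) n • (D.b n * D.X (m + 1)) = 0

lemma sq_sub_one_ne : D.q ^ 2 - 1 ≠ 0 := by
  have := D.not_root 2 (by norm_num)
  exact sub_ne_zero.mpr this

variable {D} (hα : D.α = 1)
include hα

lemma RYa_zero {m : ℕ} (h : m % 2 = 1) : D.RYa 0 m := by
  have hs : (-1 : ℂ) ^ m = -1 := Odd.neg_one_pow (Nat.odd_iff.mpr h)
  have h1 := D.Y_succ m
  have hq := D.q_ne
  have ht := D.sq_sub_one_ne
  rw [RYa, a, a, e_zero, h1]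
  simp only [th, k, hα, hs, pow_succ, mul_add, add_mul, mul_sub, sub_mul, smul_mul_assoc, mul_smul_comm, smul_sub, smul_add,
    smul_smul, mul_assoc, mul_neg, neg_mul, smul_neg, mul_one, neg_neg, one_mul, one_smul, smul_zero,
    mul_zero, zero_mul, neg_smul, Nat.reduceAdd, zero_add, X_zero, Y_zero]
  match_scalars <;> field_simp <;> ring1

lemma RYb_zero {m : ℕ} (h : m % 2 = 0) : D.RYb 0 m := by
  have hs : (-1 : ℂ) ^ m = 1 := Even.neg_one_pow (Nat.even_iff.mpr h)
  have h1 := D.Y_succ m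
  have hq := D.q_ne
  have ht := D.sq_sub_one_ne
  rw [RYb, b, b, h1]
  simp only [th, k, hα, hs, pow_succ, mul_add, add_mul, mul_sub, sub_mul, smul_mul_assoc, mul_smul_comm, smul_sub, smul_add,
    smul_smul, mul_assoc, mul_neg, neg_mul, smul_neg, mul_one, neg_neg, one_mul, one_smul, smul_zero,
    mul_zero, zero_mul, neg_smul, Nat.reduceAdd, zero_add, X_zero, Y_zero]
  match_scalars <;> field_simp <;> ring1

lemma RYb_one {m : ℕ} (h : m % 2 = 1) : D.RYb 1 m := by
  have hs : (-1 : ℂ) ^ m = -1 := Odd.neg_one_pow (Nat.odd_iff.mpr h)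
  have h2 := D.Y_succ (m + 1)
  have hq := D.q_ne
  have h3 := D.N_Y m
  rw [NYRel, N_eq'] at h3
  rw [RYb, b, b]
  linear_combination (norm := skip) h3 - D.sq_Y m + D.q • h2
  simp only [th, k, hα, hs, pow_succ, mul_add, add_mul, mul_sub, sub_mul, smul_mul_assoc, mul_smul_comm, smul_sub, smul_add,
    smul_smul, mul_assoc, mul_neg, neg_mul, smul_neg, mul_one, neg_neg, one_mul, one_smul, smul_zero,
    mul_zero, zero_mul, neg_smul, Nat.reduceAdd, zero_add, X_zero, Y_zero]
  match_scalars <;> field_simp <;> ring1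

lemma RXb_zero : D.RXb 0 0 := by
  have h1 := D.X_succ 0
  have hq := D.q_ne
  have ht := D.sq_sub_one_ne
  rw [RXb, a, b, h1]
  simp only [th, k, hα, pow_zero, pow_succ, mul_add, add_mul, mul_sub, sub_mul, smul_mul_assoc, mul_smul_comm, smul_sub, smul_add,
    smul_smul, mul_assoc, mul_neg, neg_mul, smul_neg, mul_one, neg_neg, one_mul, one_smul, smul_zero,
    mul_zero, zero_mul, neg_smul, Nat.reduceAdd, zero_add, X_zero, Y_zero]
  match_scalars <;> field_simp <;> ring1

lemma RXa_one : D.RXa 1 1 := by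
  have h2 := D.X_succ 2
  have hq := D.q_ne
  have h3 := D.N_X 1
  rw [NXRel, N_eq] at h3
  rw [RXa, a, b]
  linear_combination (norm := skip) -h3 - D.sq_X 1 + D.q • h2
  simp only [th, k, hα, pow_zero, pow_succ, mul_add, add_mul, mul_sub, sub_mul, smul_mul_assoc, mul_smul_comm, smul_sub, smul_add,
    smul_smul, mul_assoc, mul_neg, neg_mul, smul_neg, mul_one, neg_neg, one_mul, one_smul, smul_zero,
    mul_zero, zero_mul, neg_smul, Nat.reduceAdd, zero_add, X_zero, Y_zero]
  match_scalars <;> field_simp <;> ring1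

end QDatum

namespace QDatum
variable {A : Type} [Ring A] [Algebra ℂ A] (D : QDatum A)

lemma PhiX_self (j n : ℕ) : D.PhiX j n n = 0 := by
  have := congrArg MulOpposite.unop (D.op.Phi_self j n)
  simpa [Phi, op_e, op_k, PhiX] using this

def SqCommLT (d : ℕ) : Prop := ∀ i j, i + j + 1 < d → D.SqComm i j

variable {D}

lemma SqComm.e_add_two {i j : ℕ} (h : D.SqComm i j) : D.e (i + 2) j = D.e i (j + 2) := by
  have := D.sq_e i j
  rw [h] at this
  exact (sub_eq_zero.mp this.symm).symm

lemma k_add_two_right (i j : ℕ) : D.k i (j + 2) = D.k i j := D.k_congr rfl (by omega)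

variable (hα : D.α = 1)
include hα

lemma RYa_of {d n m : ℕ} (hZ : D.SqCommLT d) (h : (n + m) % 2 = 1)
    (h' : n = m + 1 ∨ min n (m + 1) + 1 < d) : D.RYa n m := by
  rcases n with _ | n
  · exact RYa_zero hα (by omega)
  · by_cases hnm : n = m
    · subst hnm; exact D.Phi_self 0 n
    · exact D.Phi_eq_zero (by omega) (hZ _ _ (by omega)) (hZ _ _ (by omega))

lemma RYb_of {d n m : ℕ} (hZ : D.SqCommLT d) (h : (n + m) % 2 = 0)
    (h' : n = m + 2 ∨ min n (m + 2) + 1 < d) : D.RYb n m := by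
  rcases n with _ | _ | n
  · exact RYb_zero hα (by omega)
  · exact RYb_one hα (by omega)
  · by_cases hnm : n = m
    · subst hnm; exact D.Phi_self 1 n
    · exact D.Phi_eq_zero (by omega) (hZ _ _ (by omega)) (hZ _ _ (by omega))

lemma RXb_at_zero (n : ℕ) : D.RXb n 0 := by
  rcases n with _ | n
  · exact RXb_zero hα
  · have := D.PhiX_self n 0
    simp only [PhiX] at this
    rw [RXb, show n + 1 + 1 = n + 2 from rfl, k_add_two_right, k_add_two_right]
    exact this

lemma RXa_at_one {n d : ℕ} (hZ : D.SqCommLT d) (h : n ≤ d) (h1 : 1 ≤ n) : D.RXa n 1 := by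
  rcases n with _ | _ | n
  · omega
  · exact RXa_one hα
  · have := D.PhiX_self n 1
    simp only [PhiX] at this
    have h2 := (hZ 0 n (by omega)).e_add_two
    rw [show D.e (1 + 1) n = D.e 0 (n + 2) from h2] at this
    rw [RXa, show n + 1 + 1 = n + 2 from rfl, k_add_two_right, k_add_two_right]
    exact this

omit hα in
variable (D) in
def S (i j : ℕ) : A := ((-1 : ℂ) ^ i) • (D.a i * D.b j - D.a j * D.b i) + D.b i * D.a j - D.b j * D.a i

lemma S_rec {n p d : ℕ} (hZ : D.SqCommLT d) (hn : 1 ≤ n) (h : n + p + 2 = d) (hd : d % 2 = 0) :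
    D.S (n + 2) (p + 2) - (D.q + D.q⁻¹) • D.S (n + 1) (p + 3) + D.S n (p + 4) = 0 := by
  have y1 := RYa_of hα hZ (n := n + 1) (m := p) (by omega) (by omega)
  have y2 := RYb_of hα hZ (n := n) (m := p) (by omega) (by omega)
  have y3 := RYb_of hα hZ (n := n + 1) (m := p + 1) (by omega) (by omega)
  have y4 := RYa_of hα hZ (n := n) (m := p + 1) (by omega) (by omega)
  have x1 := RXa_at_one hα hZ (n := n + 1) (by omega) (by omega)
  have x2 := RXa_at_one hα hZ (n := n) (by omega) (by omega)
  have x3 := RXb_at_zero hα (n + 1)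
  have x4 := RXb_at_zero hα n
  have e1 : D.e 2 p = D.a (p + 3) := (hZ 0 p (by omega)).e_add_two
  have e2 : D.e 2 (p + 1) = D.a (p + 4) := (hZ 0 (p + 1) (by omega)).e_add_two
  have hn' : n % 2 = p % 2 := by omega
  have k1 (i) : D.k i n = D.k i p := D.k_congr rfl hn'
  have k2 (i) : D.k i (n + 1) = D.k i (p + 1) := D.k_congr rfl (by omega)
  have k3 (i) : D.k i (n + 1 + 1) = D.k i p := D.k_congr rfl (by omega)
  have k4 (i) : D.k i (p + 1 + 1) = D.k i p := D.k_congr rfl (by omega)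
  have k5 (j) : D.k (1 + 1) j = D.k 0 j := D.k_congr rfl rfl
  have a1 := exchange D (i := 1) (p := p) (u₂ := D.a (n + 2)) (u₁ := D.a (n + 1)) (v₁ := D.b (n + 1))
    (v₀ := D.b n) (by simpa only [RYa, k5] using y1) (by simpa only [RYb] using y2)
    (by simpa only [RXa, k2] using x1) (by simpa only [RXa, k1] using x2)
  have a2 := exchange D (i := 0) (p := p + 1) (u₂ := D.b (n + 2)) (u₁ := D.b (n + 1))
    (v₁ := D.a (n + 1)) (v₀ := D.a n) (by simpa only [RYb, zero_add] using y3)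
    (by simpa only [RYa] using y4)
    (by simpa only [RXb, k2, k3, k4, zero_add] using x3) (by simpa only [RXb, k2, zero_add] using x4)
  simp only [Nat.reduceAdd, zero_add, add_assoc, e1, e2, ← b_add_two, ← a_succ] at a1 a2
  have hq := D.q_ne
  simp only [S]
  have hs : (-1 : ℂ) ^ p = (-1) ^ n := by
    rw [neg_one_pow_eq_pow_mod_two, ← hn', ← neg_one_pow_eq_pow_mod_two]
  rcases neg_one_pow_eq_or ℂ n with s | s
  · linear_combination (norm := skip) a1 + a2
    simp only [k, hα, hs, s, pow_succ, pow_zero, add_assoc, mul_add, add_mul, mul_sub, sub_mul, smul_mul_assoc, mul_smul_comm, smul_sub, smul_add,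
    smul_smul, mul_assoc, mul_neg, neg_mul, smul_neg, mul_one, neg_neg, one_mul, one_smul, smul_zero,
    mul_zero, zero_mul, neg_smul, Nat.reduceAdd, zero_add, X_zero, Y_zero]
    match_scalars <;> field_simp <;> ring1
  · linear_combination (norm := skip) a1 + a2
    simp only [k, hα, hs, s, pow_succ, pow_zero, add_assoc, mul_add, add_mul, mul_sub, sub_mul, smul_mul_assoc, mul_smul_comm, smul_sub, smul_add,
    smul_smul, mul_assoc, mul_neg, neg_mul, smul_neg, mul_one, neg_neg, one_mul, one_smul, smul_zero,
    mul_zero, zero_mul, neg_smul, Nat.reduceAdd, zero_add, X_zero, Y_zero]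
    match_scalars <;> field_simp <;> ring1

end QDatum

namespace QDatum
variable {A : Type} [Ring A] [Algebra ℂ A] {D : QDatum A}

lemma SqComm.add_two {i j : ℕ} (h : D.SqComm i (j + 2)) (h' : D.SqComm i j) :
    D.SqComm (i + 2) j := by
  rwa [SqComm, h'.e_add_two]

variable (hα : D.α = 1)
include hα

lemma S_one {n : ℕ} (hn : n % 2 = 0) :
    D.S 1 (n + 3) = D.l * D.l * D.e 0 (n + 1) - D.e 0 (n + 1) * (D.l * D.l) := by
  have s : (-1 : ℂ) ^ n = 1 := Even.neg_one_pow (Nat.even_iff.mpr hn)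
  have h := D.l_e 0 (n + 1)
  simp only [hα, pow_zero, pow_succ, s, pow_zero, add_assoc, Nat.reduceAdd, zero_add] at h
  rw [S, b_add_two, a_succ, b_one, a_succ, e_zero]
  linear_combination (norm := skip) - (D.l * h + h * D.l)
  simp only [mul_add, add_mul, mul_sub, sub_mul, smul_mul_assoc, mul_smul_comm, smul_sub, smul_add,
    smul_smul, mul_assoc, mul_neg, neg_mul, smul_neg, mul_one, neg_neg, one_mul, one_smul, smul_zero,
    mul_zero, zero_mul, neg_smul, Nat.reduceAdd, zero_add, X_zero, Y_zero]
  match_scalars <;> ring1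

lemma S_two {n : ℕ} (hn : n % 2 = 0) (hZ : D.SqCommLT (n + 2)) : D.S 2 (n + 2) =
    (D.q + D.q⁻¹) • (D.l * D.l * D.e 0 (n + 1) - D.e 0 (n + 1) * (D.l * D.l)) := by
  have s : (-1 : ℂ) ^ n = 1 := Even.neg_one_pow (Nat.even_iff.mpr hn)
  have h1 := D.l_e 0 (n + 1)
  have h2 := D.l_e 0 n
  have h3 := D.N_e 0 (n + 1)
  have h4 := D.N_e 1 n
  have h5 := D.N_eq
  have h6 := D.N_eq'
  have h7 := D.sq_e 0 (n + 1)
  have h8 := D.sq_e 1 n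
  have h9 := hZ 0 n (by omega)
  have h10 := h9.e_add_two
  rw [SqComm] at h9
  simp only [hα, pow_zero, pow_succ, s, pow_zero, add_assoc, Nat.reduceAdd, zero_add]
    at h1 h2 h3 h4 h5 h6 h7 h8 h9 h10
  rw [h10] at h4
  rw [S, b_add_two, a_succ, show D.b 2 = D.e 1 0 from rfl, a_succ]
  have hq := D.q_ne
  linear_combination (norm := skip) h3 - (D.q + 1) • h7 + h4 - (D.q - 1) • h8
    - (h5 * D.e 1 n - D.e 1 n * h5) - (h6 * D.e 0 (n + 1) - D.e 0 (n + 1) * h6)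
    + D.q • ((D.l * D.l * h2 - h2 * (D.l * D.l)) - (D.l * h9 + h9 * D.l))
    + D.th • (D.l * h1 + h1 * D.l)
  simp only [th, pow_zero, pow_succ, mul_add, add_mul, mul_sub, sub_mul, smul_mul_assoc, mul_smul_comm, smul_sub, smul_add,
    smul_smul, mul_assoc, mul_neg, neg_mul, smul_neg, mul_one, neg_neg, one_mul, one_smul, smul_zero,
    mul_zero, zero_mul, neg_smul, Nat.reduceAdd, zero_add, X_zero, Y_zero]
  match_scalars <;> field_simp <;> ring1

lemma S_eq {n : ℕ} (hn : n % 2 = 0) (hZ : D.SqCommLT (n + 2)) (m p : ℕ)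
    (h : m + p = n + 1) : D.th • D.S (m + 1) (p + 2) = (D.q ^ (m + 1) - D.q⁻¹ ^ (m + 1)) •
      (D.l * D.l * D.e 0 (n + 1) - D.e 0 (n + 1) * (D.l * D.l)) := by
  induction m using Nat.twoStepInduction generalizing p with
  | zero => rw [show p + 2 = n + 3 by omega, zero_add, S_one hα hn, pow_one, pow_one, th]
  | one =>
    rw [show p + 2 = n + 2 by omega, S_two hα hn hZ, smul_smul, th]; congr 1; ring
  | more m h1 h2 =>
    have r := S_rec hα hZ (n := m + 1) (p := p) (by omega) (by omega) (by omega)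
    have r1 := h1 (p + 2) (by omega)
    have r2 := h2 (p + 1) (by omega)
    have hq := D.q_ne
    linear_combination (norm := skip) D.th • r - r1 + (D.q + D.q⁻¹) • r2
    simp only [add_assoc, smul_add, smul_sub, smul_smul, Nat.reduceAdd, inv_pow]
    match_scalars <;> field_simp <;> ring1

lemma sqComm_even {n : ℕ} (hn : n % 2 = 0) (hZ : D.SqCommLT (n + 2)) :
    D.SqComm 0 (n + 1) := by
  have h := S_eq hα hn hZ (n / 2 + 1) (n / 2) (by omega)
  have h0 : D.S (n / 2 + 1 + 1) (n / 2 + 2) = 0 := by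
    simp only [S, add_assoc, Nat.reduceAdd, sub_self, smul_zero, zero_add, add_sub_cancel_left]
  rw [h0, smul_zero] at h
  refine (smul_eq_zero.mp h.symm).resolve_left fun h => ?_
  have hq := D.q_ne
  apply D.not_root (2 * (n / 2 + 2)) (by omega)
  rw [inv_pow, sub_eq_zero] at h
  rw [two_mul, pow_add]
  nth_rw 1 [show n / 2 + 2 = n / 2 + 1 + 1 from rfl, h]
  exact inv_mul_cancel₀ (pow_ne_zero _ hq)

lemma sqComm_odd {i j : ℕ} (h : i % 2 = j % 2) (hZ : D.SqCommLT (i + j + 3)) :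
    D.SqComm i (j + 2) := by
  have s : (-1 : ℂ) ^ j = (-1) ^ i := by
    rw [neg_one_pow_eq_pow_mod_two, ← h, ← neg_one_pow_eq_pow_mod_two]
  have a1 := hZ i j (by omega)
  have a2 := hZ (i + 1) j (by omega)
  have a3 := hZ i (j + 1) (by omega)
  have a4 := D.N_e i j
  have a5 := D.sq_N
  rw [a1.e_add_two] at a4
  rw [SqComm] at *
  have h2 : (-(2 * (-1 : ℂ) ^ i)) ≠ 0 := by simp
  refine (smul_eq_zero.mp ?_).resolve_left h2
  have hq := D.q_ne
  linear_combination (norm := skip) -(D.l * D.l * a4 - a4 * (D.l * D.l))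
    + a5 * D.e i j - D.e i j * a5 + D.N * a1 - a1 * D.N
    - ((-1 : ℂ) ^ i * D.th) • (a3 * D.l + D.l * a2)
  simp only [s, hα, pow_zero, pow_succ, mul_add, add_mul, mul_sub, sub_mul, smul_mul_assoc, mul_smul_comm, smul_sub, smul_add,
    smul_smul, mul_assoc, mul_neg, neg_mul, smul_neg, mul_one, neg_neg, one_mul, one_smul, smul_zero,
    mul_zero, zero_mul, neg_smul, Nat.reduceAdd, zero_add, X_zero, Y_zero]
  match_scalars <;> field_simp <;> ring1

omit hα in
lemma sqComm_of_le_one {t : ℕ} (h0 : D.SqComm 0 t) (h1 : ∀ j, j + 1 = t → D.SqComm 1 j)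
    (hZ : D.SqCommLT (t + 1)) (i j : ℕ) (h : i + j = t) : D.SqComm i j := by
  induction i using Nat.twoStepInduction generalizing j with
  | zero => rwa [show j = t by omega]
  | one => exact h1 j (by omega)
  | more i ih _ => exact (ih (j + 2) (by omega)).add_two (hZ i j (by omega))

lemma sqComm_zero {u : ℕ} (ih : D.SqCommLT (u + 1)) : D.SqComm 0 u := by
  rcases Nat.mod_two_eq_zero_or_one u with h | h
  · rcases u with _ | _ | u
    · simp [SqComm, e_zero, mul_assoc]
    · omega
    · exact sqComm_odd hα (by omega) (by rwa [zero_add])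
  · obtain ⟨n, rfl⟩ : ∃ n, u = n + 1 := ⟨u - 1, by omega⟩
    exact sqComm_even hα (by omega) ih

lemma sqComm_one {j : ℕ} (ih : D.SqCommLT (j + 2)) : D.SqComm 1 j := by
  have h0 := sqComm_zero hα ih
  have h0' := ih 0 j (by omega)
  rcases Nat.mod_two_eq_zero_or_one j with h | h
  · have s : (-1 : ℂ) ^ j = 1 := Even.neg_one_pow (Nat.even_iff.mpr h)
    have h1 := D.l_e 0 j
    rw [SqComm] at *
    linear_combination (norm := skip) h0 + D.l * D.l * h1 - h1 * (D.l * D.l) - D.l * h0' - h0' * D.l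
    simp only [s, hα, pow_zero, pow_succ, mul_add, add_mul, mul_sub, sub_mul, smul_mul_assoc, mul_smul_comm, smul_sub, smul_add,
    smul_smul, mul_assoc, mul_neg, neg_mul, smul_neg, mul_one, neg_neg, one_mul, one_smul, smul_zero,
    mul_zero, zero_mul, neg_smul, Nat.reduceAdd, zero_add, X_zero, Y_zero]
    match_scalars <;> ring1
  · rcases j with _ | _ | j
    · omega
    · have h1 := D.e_add
      have h2 := D.sq_N
      rw [SqComm] at *
      linear_combination (norm := skip) D.l * D.l * h1 - h1 * (D.l * D.l) - h0
        + D.th • (D.l * h2 + h2 * D.l)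
      simp only [pow_zero, pow_succ, mul_add, add_mul, mul_sub, sub_mul, smul_mul_assoc, mul_smul_comm, smul_sub, smul_add,
    smul_smul, mul_assoc, mul_neg, neg_mul, smul_neg, mul_one, neg_neg, one_mul, one_smul, smul_zero,
    mul_zero, zero_mul, neg_smul, Nat.reduceAdd, zero_add, X_zero, Y_zero]
      match_scalars <;> ring1
    · exact sqComm_odd hα (by omega) (by rwa [show 1 + j + 3 = j + 2 + 2 by omega])

theorem sqCommLT (d : ℕ) : D.SqCommLT d := by
  induction d with
  | zero => intro i j h; omega
  | succ t ih =>
    intro i j hij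
    by_cases h' : i + j + 1 < t
    · exact ih i j h'
    obtain rfl : t = i + j + 1 := by omega
    refine sqComm_of_le_one (sqComm_zero hα ih) (fun j' h => sqComm_one hα ?_) ih i j rfl
    rwa [show j' + 2 = i + j + 1 by omega]

theorem sqComm (i j : ℕ) : D.SqComm i j := sqCommLT hα _ i j (Nat.lt_succ_self _)

end QDatum

namespace QDatum
variable {A : Type} [Ring A] [Algebra ℂ A] (D : QDatum A)

/-- the half sum of the two root vectors of weight `(n, n)` -/
def T (n : ℕ) : A := (2⁻¹ : ℂ) • (D.a n + D.b n)

/-- the difference of the two root vectors of weight `(n, n)` -/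
def K (n : ℕ) : A := D.a n - D.b n

lemma a_eq (n : ℕ) : D.a n = D.T n + (2⁻¹ : ℂ) • D.K n := by
  simp only [T, K]; module

lemma b_eq (n : ℕ) : D.b n = D.T n - (2⁻¹ : ℂ) • D.K n := by
  simp only [T, K]; module

lemma T_zero : D.T 0 = D.th⁻¹ • 1 := by
  simp only [T, a, b]; module

lemma T_one : D.T 1 = D.l := by
  simp only [T, a, b, e_zero]; module

lemma K_one : D.K 1 = 0 := by
  simp only [K, a, b, e_zero]; module

variable {D} (hα : D.α = 1)
include hα

lemma e_add_two (i j : ℕ) : D.e (i + 2) j = D.e i (j + 2) := (sqComm hα i j).e_add_two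

lemma l_a (n : ℕ) : D.l * D.a (n + 1) + ((-1 : ℂ) ^ n) • (D.a (n + 1) * D.l) = D.K (n + 2) := by
  have h := D.l_e 0 n
  rw [hα, pow_zero, one_mul, one_mul, one_smul] at h
  exact h

lemma l_b (n : ℕ) : D.l * D.b (n + 1) + ((-1 : ℂ) ^ n) • (D.b (n + 1) * D.l) = D.K (n + 2) := by
  cases n with
  | zero =>
    have h := l_a hα 0
    rwa [D.a_succ 0, e_zero, ← b_one] at h
  | succ n =>
    have h := D.l_e 1 n
    rw [hα, show D.e (1 + 1) n = _ from e_add_two hα 0 n] at h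
    rw [K, a_succ, b_add_two, b_add_two]
    linear_combination (norm := skip) h
    simp only [pow_succ, pow_zero, one_mul]
    match_scalars <;> ring1

lemma l_T (n : ℕ) : D.l * D.T (n + 1) + ((-1 : ℂ) ^ n) • (D.T (n + 1) * D.l) = D.K (n + 2) := by
  have h1 := l_a hα n
  have h2 := l_b hα n
  simp only [T]
  linear_combination (norm := skip) (2⁻¹ : ℂ) • (h1 + h2)
  simp only [mul_add, add_mul, mul_sub, sub_mul, smul_mul_assoc, mul_smul_comm, smul_sub, smul_add,
    smul_smul, mul_assoc, mul_neg, neg_mul, smul_neg, mul_one, neg_neg, one_mul, one_smul, smul_zero,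
    mul_zero, zero_mul, neg_smul, Nat.reduceAdd, zero_add, X_zero, Y_zero]
  match_scalars <;> ring1

lemma l_K (n : ℕ) : D.l * D.K (n + 1) + ((-1 : ℂ) ^ n) • (D.K (n + 1) * D.l) = 0 := by
  have h1 := l_a hα n
  have h2 := l_b hα n
  rw [K]
  linear_combination (norm := skip) h1 - h2
  simp only [mul_add, add_mul, mul_sub, sub_mul, smul_mul_assoc, mul_smul_comm, smul_sub, smul_add,
    smul_smul, mul_assoc, mul_neg, neg_mul, smul_neg, mul_one, neg_neg, one_mul, one_smul, smul_zero,
    mul_zero, zero_mul, neg_smul, Nat.reduceAdd, zero_add, X_zero, Y_zero]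
  match_scalars <;> ring1

lemma N_a (n : ℕ) : D.N * D.a (n + 1) - D.a (n + 1) * D.N =
    -(1 + (-1 : ℂ) ^ n) • D.a (n + 3) + ((-1 : ℂ) ^ n * D.th) • (D.a (n + 2) * D.l)
      + D.th • (D.l * D.b (n + 2)) := by
  have h := D.N_e 0 n
  rw [hα, show D.e (0 + 2) n = _ from e_add_two hα 0 n] at h
  simp only [a_succ, b_add_two]
  linear_combination (norm := skip) h
  simp only [zero_add, pow_zero, one_mul]
  match_scalars <;> ring1

lemma N_b (n : ℕ) : D.N * D.b (n + 1) - D.b (n + 1) * D.N =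
    (1 + (-1 : ℂ) ^ n) • D.b (n + 3) - ((-1 : ℂ) ^ n * D.th) • (D.b (n + 2) * D.l)
      - D.th • (D.l * D.a (n + 2)) := by
  cases n with
  | zero =>
    have h := N_a hα 0
    have h1 := D.e_add
    have h2 := D.N_eq'
    have h3 : D.N = D.e 0 1 - D.α • (D.l * D.l) := rfl
    rw [hα] at h2 h3
    simp only [a_succ, b_add_two, b_one, e_zero, zero_add, pow_zero] at h ⊢
    linear_combination (norm := skip) h - (2 : ℂ) • h1 - D.th • (h2 * D.l + D.l * h2 + h3 * D.l + D.l * h3)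
    simp only [mul_add, add_mul, mul_sub, sub_mul, smul_mul_assoc, mul_smul_comm, smul_sub, smul_add,
    smul_smul, mul_assoc, mul_neg, neg_mul, smul_neg, mul_one, neg_neg, one_mul, one_smul, smul_zero,
    mul_zero, zero_mul, neg_smul, Nat.reduceAdd, zero_add, X_zero, Y_zero]
    match_scalars <;> ring1
  | succ n =>
    have h := D.N_e 1 n
    rw [hα, show D.e (1 + 2) n = _ from e_add_two hα 1 n,
      show D.e (1 + 1) n = _ from e_add_two hα 0 n] at h
    simp only [a_succ, b_add_two]
    linear_combination (norm := skip) h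
    simp only [zero_add, pow_succ, pow_zero, one_mul]
    match_scalars <;> ring1

lemma N_T_even (n : ℕ) (hn : n % 2 = 0) : D.N * D.T n - D.T n * D.N = 0 := by
  rcases n with _ | n
  · simp [T_zero]
  · have s : (-1 : ℂ) ^ n = -1 := Odd.neg_one_pow (Nat.odd_iff.mpr (by omega))
    have h1 := N_a hα n
    have h2 := N_b hα n
    have h3 := l_K hα (n + 1)
    rw [K] at h3
    rw [T]
    linear_combination (norm := skip) (2⁻¹ : ℂ) • (h1 + h2) - (2⁻¹ * D.th : ℂ) • h3
    simp only [s, pow_succ, add_assoc, mul_add, add_mul, mul_sub, sub_mul, smul_mul_assoc, mul_smul_comm, smul_sub, smul_add,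
    smul_smul, mul_assoc, mul_neg, neg_mul, smul_neg, mul_one, neg_neg, one_mul, one_smul, smul_zero,
    mul_zero, zero_mul, neg_smul, Nat.reduceAdd, zero_add, X_zero, Y_zero]
    match_scalars <;> ring1

lemma K_odd (n : ℕ) (hn : n % 2 = 0) : D.K (n + 3) = -(D.N * D.T (n + 1) - D.T (n + 1) * D.N) := by
  have s : (-1 : ℂ) ^ n = 1 := Even.neg_one_pow (Nat.even_iff.mpr hn)
  have h1 := N_a hα n
  have h2 := N_b hα n
  have h3 := l_K hα (n + 1)
  rw [K] at h3 ⊢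
  rw [T]
  linear_combination (norm := skip) (2⁻¹ : ℂ) • (h1 + h2) - (2⁻¹ * D.th : ℂ) • h3
  simp only [s, pow_succ, add_assoc, mul_add, add_mul, mul_sub, sub_mul, smul_mul_assoc, mul_smul_comm, smul_sub, smul_add,
    smul_smul, mul_assoc, mul_neg, neg_mul, smul_neg, mul_one, neg_neg, one_mul, one_smul, smul_zero,
    mul_zero, zero_mul, neg_smul, Nat.reduceAdd, zero_add, X_zero, Y_zero]
  match_scalars <;> ring1

lemma T_odd (n : ℕ) (hn : n % 2 = 0) : D.T (n + 3) =
    (D.th / 2) • (D.l * D.T (n + 2) + D.T (n + 2) * D.l)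
      - (4⁻¹ : ℂ) • (D.N * D.K (n + 1) - D.K (n + 1) * D.N) := by
  have s : (-1 : ℂ) ^ n = 1 := Even.neg_one_pow (Nat.even_iff.mpr hn)
  have h1 := N_a hα n
  have h2 := N_b hα n
  simp only [T, K]
  linear_combination (norm := skip) (4⁻¹ : ℂ) • (h1 - h2)
  simp only [s, pow_succ, add_assoc, mul_add, add_mul, mul_sub, sub_mul, smul_mul_assoc, mul_smul_comm, smul_sub, smul_add,
    smul_smul, mul_assoc, mul_neg, neg_mul, smul_neg, mul_one, neg_neg, one_mul, one_smul, smul_zero,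
    mul_zero, zero_mul, neg_smul, Nat.reduceAdd, zero_add, X_zero, Y_zero]
  match_scalars <;> ring1

lemma S_eq_zero {i j : ℕ} (h : i % 2 = j % 2) (hi : 1 ≤ i) (hj : 2 ≤ j) : D.S i j = 0 := by
  obtain ⟨m, rfl⟩ : ∃ m, i = m + 1 := ⟨i - 1, by omega⟩
  obtain ⟨p, rfl⟩ : ∃ p, j = p + 2 := ⟨j - 2, by omega⟩
  have h0 := S_eq hα (n := m + p - 1) (by omega) (sqCommLT hα _) m p (by omega)
  rw [show D.l * D.l * D.e 0 (m + p - 1 + 1) - D.e 0 (m + p - 1 + 1) * (D.l * D.l) = 0 from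
    sqComm hα _ _, smul_zero] at h0
  exact (smul_eq_zero.mp h0).resolve_left D.th_ne

lemma T_T {i j : ℕ} (hi : i % 2 = 0) (hj : j % 2 = 0) :
    D.T i * D.T j - D.T j * D.T i = (4⁻¹ : ℂ) • (D.K i * D.K j - D.K j * D.K i) := by
  rcases i with _ | i
  · simp [K, a, b, T_zero]
  rcases j with _ | j
  · simp [K, a, b, T_zero]
  have h := S_eq_zero hα (i := i + 1) (j := j + 1) (by omega) (by omega) (by omega)
  have s : (-1 : ℂ) ^ (i + 1) = 1 := Even.neg_one_pow (Nat.even_iff.mpr hi)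
  rw [S, s] at h
  simp only [T, K]
  linear_combination (norm := skip) (2⁻¹ : ℂ) • h
  simp only [add_assoc, mul_add, add_mul, mul_sub, sub_mul, smul_mul_assoc, mul_smul_comm, smul_sub, smul_add,
    smul_smul, mul_assoc, mul_neg, neg_mul, smul_neg, mul_one, neg_neg, one_mul, one_smul, smul_zero,
    mul_zero, zero_mul, neg_smul, Nat.reduceAdd, zero_add, X_zero, Y_zero]
  match_scalars <;> ring1

end QDatum

section Scalars
open PowerSeries

/-- coefficients of `(1 + a t)(1 + b t) / ((1 - a t)(1 - b t))` where `a + b = -θ/2`, `a b = -1/4` -/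
def gCoeff (θ : ℂ) : ℕ → ℂ
  | 0 => 1
  | 1 => -θ
  | 2 => θ ^ 2 / 2
  | n + 3 => -(θ / 2) * gCoeff θ (n + 2) + 4⁻¹ * gCoeff θ (n + 1)

lemma gCoeff_succ (θ : ℂ) (n : ℕ) : gCoeff θ (n + 2) = -(θ / 2) * gCoeff θ (n + 1) +
    4⁻¹ * gCoeff θ n - if n = 0 then 4⁻¹ else 0 := by
  cases n with
  | zero => simp [gCoeff]; ring
  | succ n => simp [gCoeff]

lemma gCoeff_series (θ : ℂ) : mk (gCoeff θ) * (1 + C (θ / 2) * PowerSeries.X - C 4⁻¹ * PowerSeries.X ^ 2) =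
    1 - C (θ / 2) * PowerSeries.X - C 4⁻¹ * PowerSeries.X ^ 2 := by
  ext n
  rw [show mk (gCoeff θ) * (1 + C (θ / 2) * PowerSeries.X - C 4⁻¹ * PowerSeries.X ^ 2) = mk (gCoeff θ) +
    C (θ / 2) * (mk (gCoeff θ) * PowerSeries.X) - C 4⁻¹ * (mk (gCoeff θ) * PowerSeries.X ^ 2) by ring]
  rcases n with _ | _ | n
  · simp [coeff_mul_X_pow', gCoeff]
  · have h1 : coeff 1 (mk (gCoeff θ) * PowerSeries.X) = gCoeff θ 0 := by
      rw [show (1 : ℕ) = 0 + 1 from rfl, coeff_succ_mul_X, coeff_mk]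
    simp [coeff_mul_X_pow', coeff_X_pow, coeff_one, gCoeff, h1, coeff_X]
    ring
  · have := gCoeff_succ θ n
    have h2 : coeff (n + 1 + 1) (mk (gCoeff θ) * PowerSeries.X ^ 2) = gCoeff θ n := by
      rw [add_assoc, coeff_mul_X_pow, coeff_mk]
    simp only [map_sub, map_add, coeff_C_mul, coeff_succ_mul_X, coeff_mk, this, h2]
    simp [coeff_one, coeff_X, coeff_X_pow]
    ring

lemma mk_pow_mul (a : ℂ) : mk (fun n => a ^ n) * (1 - C a * PowerSeries.X) = 1 := by
  ext n
  rw [show mk (fun n => a ^ n) * (1 - C a * PowerSeries.X) =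
    mk (fun n => a ^ n) - C a * (mk (fun n => a ^ n) * PowerSeries.X) by ring]
  rcases n with _ | n
  · simp
  · simp [coeff_succ_mul_X, coeff_one]; ring

lemma logDeriv_aux {R : Type*} [CommRing R] [IsDomain R] {A B x G H dG dH a₁ b₁ a₂ b₂ : R}
    (h : (1 - A * x) * (1 - B * x) * ((1 + A * x) * (1 + B * x)) ≠ 0)
    (hG : G * ((1 - A * x) * (1 - B * x)) = (1 + A * x) * (1 + B * x))
    (hH : H * ((1 + A * x) * (1 + B * x)) = (1 - A * x) * (1 - B * x))
    (dG' : G * (-(A + B) + 2 * A * B * x) + (1 - A * x) * (1 - B * x) * dG = A + B + 2 * A * B * x)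
    (dH' : H * (A + B + 2 * A * B * x) + (1 + A * x) * (1 + B * x) * dH = -(A + B) + 2 * A * B * x)
    (ha₁ : a₁ * (1 - A * x) = 1) (hb₁ : b₁ * (1 - B * x) = 1)
    (ha₂ : a₂ * (1 + A * x) = 1) (hb₂ : b₂ * (1 + B * x) = 1) :
    H * (x * dG) - (x * dH) * G = 2 * (a₁ + b₁ - a₂ - b₂) := by
  apply mul_left_cancel₀ h
  linear_combination (x * H * ((1 + A * x) * (1 + B * x))) * dG'
    - x * G * ((1 - A * x) * (1 - B * x)) * dH'
    + 2 * x * (A + B + 2 * A * B * x) * hH - 2 * x * (-(A + B) + 2 * A * B * x) * hG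
    - x * (-(A + B) + 2 * A * B * x) * G * hH + x * (A + B + 2 * A * B * x) * H * hG
    - 2 * (1 + A * x) * (1 - B * x) * (1 + B * x) * ha₁
    - 2 * (1 + B * x) * (1 - A * x) * (1 + A * x) * hb₁
    + 2 * (1 - A * x) * (1 - B * x) * (1 + B * x) * ha₂
    + 2 * (1 - B * x) * (1 - A * x) * (1 + A * x) * hb₂

lemma alternating_gCoeff {a b θ : ℂ} (h1 : a + b = -(θ / 2)) (h2 : a * b = -4⁻¹) {r : ℕ}
    (hr : r % 2 = 1) :
    ∑ p ∈ Finset.HasAntidiagonal.antidiagonal r, (-1) ^ p.1 * ((p.2 : ℂ) - p.1) * (gCoeff θ p.1 * gCoeff θ p.2) =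
      4 * (a ^ r + b ^ r) := by
  set x : ℂ⟦X⟧ := PowerSeries.X
  set G := mk (gCoeff θ)
  have hG := gCoeff_series θ
  have hC : C (θ / 2) = -(C a + C b) := by rw [← map_add, h1, map_neg, neg_neg]
  have hC' : C (4⁻¹ : ℂ) = - (C a * C b) := by rw [← map_mul, h2, map_neg, neg_neg]
  rw [hC, hC'] at hG
  have hG' := congrArg evalNegHom hG
  have hc (c : ℂ) : evalNegHom (C c) = C c := by ext n; rcases n with _ | n <;> simp [evalNegHom, coeff_C]
  simp only [map_mul, map_sub, map_add, map_one, map_neg, map_pow, evalNegHom_X, hc] at hG'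
  set H := evalNegHom G
  have d1 := congrArg (derivative ℂ) hG
  have d2 := congrArg (derivative ℂ) hG'
  simp only [Derivation.leibniz, map_add, map_sub, map_neg, derivative_C, derivative_X, smul_eq_mul,
    map_one_eq_zero, pow_two, Derivation.map_one_eq_zero] at d1 d2
  set dG := derivative ℂ G
  set dH := derivative ℂ H
  have ea := mk_pow_mul a
  have eb := mk_pow_mul b
  have ea' := mk_pow_mul (-a)
  have eb' := mk_pow_mul (-b)
  rw [map_neg] at ea' eb'
  set R := mk (fun n => a ^ n) + mk (fun n => b ^ n) - mk (fun n => (-a) ^ n) - mk (fun n => (-b) ^ n)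
  have key : H * (x * dG) - (x * dH) * G = 2 * R := by
    apply logDeriv_aux (A := C a) (B := C b)
    · intro h0
      have := congrArg constantCoeff h0
      simp [x] at this
    · linear_combination hG
    · linear_combination hG'
    · linear_combination d1
    · linear_combination d2
    · exact ea
    · exact eb
    · linear_combination ea'
    · linear_combination eb'
  have hr' : Odd r := Nat.odd_iff.mpr hr
  obtain ⟨s, rfl⟩ : ∃ s, r = s + 1 := ⟨r - 1, by omega⟩
  have cG (n : ℕ) : coeff n (x * dG) = n * gCoeff θ n := by
    cases n <;> simp [x, dG, coeff_succ_X_mul, coeff_derivative, G, mul_comm]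
  have cH0 (n : ℕ) : coeff n H = (-1) ^ n * gCoeff θ n := by
    simp [H, evalNegHom, G]
  have cH (n : ℕ) : coeff n (x * dH) = n * ((-1) ^ n * gCoeff θ n) := by
    cases n <;> simp [x, dH, coeff_succ_X_mul, coeff_derivative, cH0, mul_comm]
  have := congrArg (coeff (s + 1)) key
  rw [map_sub, coeff_mul, coeff_mul, ← Finset.sum_sub_distrib] at this
  rw [show (2 : ℂ⟦X⟧) = C 2 by rw [map_ofNat], coeff_C_mul] at this
  simp only [cG, cH, cH0, R, map_sub, map_add, coeff_mk, hr'.neg_pow, G] at this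
  rw [Finset.sum_congr rfl (fun p _ => ?_), this]
  · ring
  · ring

end Scalars

namespace QDatum
open Finset.HasAntidiagonal (antidiagonal)
variable {A : Type} [Ring A] [Algebra ℂ A] (D : QDatum A)

/-- iterated commutators of `N` with `l` -/
def lM : ℕ → A
  | 0 => D.l
  | n + 1 => D.N * lM n - lM n * D.N

lemma lM_succ (n : ℕ) : D.lM (n + 1) = D.N * D.lM n - D.lM n * D.N := rfl

variable {D} (hα : D.α = 1)
include hα

lemma T_two : D.T 2 = D.N := by
  have h1 := D.N_eq'
  have h2 : D.N = D.e 0 1 - D.α • (D.l * D.l) := rfl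
  rw [hα] at h1 h2
  simp only [T, a, b]
  linear_combination (norm := module) (-2⁻¹ : ℂ) • (h1 + h2)

lemma lM_T_two (j : ℕ) : D.lM j * D.T 2 - D.T 2 * D.lM j = - D.lM (j + 1) := by
  rw [T_two hα, lM_succ, neg_sub]

lemma lM_T (k j : ℕ) : D.lM j * D.T (2 * k + 4) - D.T (2 * k + 4) * D.lM j =
    -(D.th / 2) • (D.lM (j + 1) * D.T (2 * k + 2) + D.T (2 * k + 2) * D.lM (j + 1))
    + (4⁻¹ : ℂ) • (D.lM (j + 2) * D.T (2 * k) - D.T (2 * k) * D.lM (j + 2)) := by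
  have n0 := N_T_even hα (2 * k) (by omega)
  have n2 := N_T_even hα (2 * k + 2) (by omega)
  have n4 := N_T_even hα (2 * k + 4) (by omega)
  induction j with
  | zero =>
    have s : (-1 : ℂ) ^ (2 * k + 2) = 1 := Even.neg_one_pow (Nat.even_iff.mpr (by omega))
    have h1 := l_T hα (2 * k + 3)
    have h2 := K_odd hα (2 * k + 2) (by omega)
    have h3 := T_odd hα (2 * k) (by omega)
    have h4 : D.K (2 * k + 1) = D.l * D.T (2 * k) - D.T (2 * k) * D.l := by
      rcases k with _ | k
      · simp [K_one, T_zero]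
      · have := l_T hα (2 * k + 1)
        rw [pow_succ, show (-1 : ℂ) ^ (2 * k) = 1 from Even.neg_one_pow (by simp)] at this
        rw [show 2 * (k + 1) + 1 = 2 * k + 1 + 2 by ring, show 2 * (k + 1) = 2 * k + 1 + 1 by ring]
        linear_combination (norm := module) -this
    rw [h4] at h3
    rw [pow_succ, s] at h1
    simp only [lM]
    linear_combination (norm := skip) h1 + h2 - (D.N * h3 - h3 * D.N)
      - (D.th / 2) • (n2 * D.l + D.l * n2)
      + (4⁻¹ : ℂ) • ((D.N * D.l - D.l * D.N) * n0 - n0 * (D.N * D.l - D.l * D.N)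
        + D.N * (D.l * n0 - n0 * D.l) - (D.l * n0 - n0 * D.l) * D.N)
    simp only [add_assoc, mul_add, add_mul, mul_sub, sub_mul, smul_mul_assoc, mul_smul_comm, smul_sub, smul_add,
    smul_smul, mul_assoc, mul_neg, neg_mul, smul_neg, mul_one, neg_neg, one_mul, one_smul, smul_zero,
    mul_zero, zero_mul, neg_smul, Nat.reduceAdd, zero_add, X_zero, Y_zero]
    match_scalars <;> ring1
  | succ j ih =>
    have a1 := D.lM_succ j
    have a2 := D.lM_succ (j + 1)
    have a3 := D.lM_succ (j + 2)
    linear_combination (norm := skip) D.N * ih - ih * D.N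
      - D.lM j * n4 + n4 * D.lM j
      + a1 * D.T (2 * k + 4) - D.T (2 * k + 4) * a1
      - (D.th / 2) • (D.lM (j + 1) * n2 + n2 * D.lM (j + 1)
        - (a2 * D.T (2 * k + 2) + D.T (2 * k + 2) * a2))
      + (4⁻¹ : ℂ) • (D.lM (j + 2) * n0 - n0 * D.lM (j + 2)
        - (a3 * D.T (2 * k) - D.T (2 * k) * a3))
    simp only [add_assoc, mul_add, add_mul, mul_sub, sub_mul, smul_mul_assoc, mul_smul_comm, smul_sub, smul_add,
    smul_smul, mul_assoc, mul_neg, neg_mul, smul_neg, mul_one, neg_neg, one_mul, one_smul, smul_zero,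
    mul_zero, zero_mul, neg_smul, Nat.reduceAdd, zero_add, X_zero, Y_zero]
    match_scalars <;> ring1

end QDatum

namespace QDatum
open Finset.HasAntidiagonal (antidiagonal)
variable {A : Type} [Ring A] [Algebra ℂ A] {D : QDatum A} (hα : D.α = 1)
include hα

lemma lM_mul_T (k j : ℕ) : D.lM j * D.T (2 * k) =
    ∑ p ∈ antidiagonal k, D.T (2 * p.1) * (gCoeff D.th p.2 • D.lM (j + p.2)) := by
  have hth := D.th_ne
  induction k using Nat.twoStepInduction generalizing j with
  | zero => simp [gCoeff, T_zero]
  | one =>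
    rw [show (1 : ℕ) = 0 + 1 from rfl, Finset.Nat.sum_antidiagonal_succ']
    simp only [Finset.HasAntidiagonal.antidiagonal_zero, Finset.sum_singleton]
    have h := lM_T_two hα j
    simp only [gCoeff, mul_zero, T_zero, zero_add, mul_one, add_zero]
    linear_combination (norm := skip) h
    simp only [add_assoc, mul_add, add_mul, mul_sub, sub_mul, smul_mul_assoc, mul_smul_comm, smul_sub, smul_add,
    smul_smul, mul_assoc, mul_neg, neg_mul, smul_neg, mul_one, neg_neg, one_mul, one_smul, smul_zero,
    mul_zero, zero_mul, neg_smul, Nat.reduceAdd, zero_add, X_zero, Y_zero]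
    match_scalars <;> first | ring1 | (field_simp; ring1)
  | more k h0 h1 =>
    have h := lM_T hα k j
    rw [show 2 * k + 2 = 2 * (k + 1) by ring, h0 (j + 2), h1 (j + 1)] at h
    rw [Finset.Nat.sum_antidiagonal_succ'] at h
    rw [Finset.Nat.sum_antidiagonal_succ', Finset.Nat.sum_antidiagonal_succ']
    have e1 : ∑ p ∈ antidiagonal k, D.T (2 * p.1) * (gCoeff D.th (p.2 + 1 + 1) • D.lM (j + (p.2 + 1 + 1)))
        = -(D.th / 2) • ∑ p ∈ antidiagonal k, D.T (2 * p.1) * (gCoeff D.th (p.2 + 1) • D.lM (j + 1 + (p.2 + 1)))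
        + (4⁻¹ : ℂ) • ∑ p ∈ antidiagonal k, D.T (2 * p.1) * (gCoeff D.th p.2 • D.lM (j + 2 + p.2))
        - (4⁻¹ : ℂ) • (D.T (2 * k) * D.lM (j + 2)) := by
      have e2 : (4⁻¹ : ℂ) • (D.T (2 * k) * D.lM (j + 2)) = ∑ p ∈ antidiagonal k,
          (if p.2 = 0 then (4⁻¹ : ℂ) else 0) • (D.T (2 * p.1) * D.lM (j + 2 + p.2)) := by
        rw [Finset.sum_eq_single (k, 0)]
        · simp
        · rintro ⟨u, v⟩ huv hne
          rw [Finset.HasAntidiagonal.mem_antidiagonal] at huv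
          rw [if_neg, zero_smul]
          rintro rfl
          exact hne (by simpa using huv)
        · simp
      rw [e2, Finset.smul_sum, Finset.smul_sum, ← Finset.sum_add_distrib, ← Finset.sum_sub_distrib]
      refine Finset.sum_congr rfl fun p _ => ?_
      rw [gCoeff_succ, show j + (p.2 + 1 + 1) = j + 2 + p.2 by ring,
        show j + 1 + (p.2 + 1) = j + 2 + p.2 by ring]
      simp only [mul_smul_comm]
      module
    rw [e1]
    simp only [gCoeff, zero_add, add_zero, mul_zero, one_smul] at h ⊢
    rw [show 2 * (k + 2) = 2 * k + 4 by ring]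
    linear_combination (norm := skip) h
    simp only [add_assoc, mul_add, add_mul, mul_sub, sub_mul, smul_mul_assoc, mul_smul_comm, smul_sub, smul_add,
    smul_smul, mul_assoc, mul_neg, neg_mul, smul_neg, mul_one, neg_neg, one_mul, one_smul, smul_zero,
    mul_zero, zero_mul, neg_smul, Nat.reduceAdd, zero_add, X_zero, Y_zero]
    match_scalars <;> ring1

/-- the relations among the iterated commutators, in terms of their generating series -/
lemma lM_series : ∀ r : ℕ, 1 ≤ r → ∑ p ∈ antidiagonal r,
    (gCoeff D.th p.1 * gCoeff D.th p.2) • (D.lM p.1 * D.lM p.2) = 0 := by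
  have hl : D.lM 0 = D.l := rfl
  set τ : PowerSeries A := .mk fun k => D.T (2 * k)
  set G : PowerSeries A := .mk fun k => gCoeff D.th k • D.lM k
  have h : PowerSeries.C D.l * τ = τ * G := by
    ext k
    rw [PowerSeries.coeff_C_mul, PowerSeries.coeff_mul]
    simpa [τ, G, hl] using lM_mul_T hα k 0
  have h2 : PowerSeries.C (D.l * D.l) * τ = τ * (G * G) := by
    rw [map_mul, mul_assoc, h, ← mul_assoc, h, mul_assoc]
  have hc (i j) : D.l * D.l * D.e i j = D.e i j * (D.l * D.l) := sub_eq_zero.mp (sqComm hα i j)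
  have h3 : PowerSeries.C (D.l * D.l) * τ = τ * PowerSeries.C (D.l * D.l) := by
    ext k
    rw [PowerSeries.coeff_C_mul, PowerSeries.coeff_mul_C]
    rcases k with _ | k
    · simp [τ, T_zero]
    · have : 2 * (k + 1) = 2 * k + 2 := by ring
      simp only [τ, PowerSeries.coeff_mk, this, T, mul_smul_comm, smul_mul_assoc, mul_add, add_mul,
        a_succ, b_add_two, hc]
  have h4 : τ * (G * G - PowerSeries.C (D.l * D.l)) = 0 := by rw [mul_sub, ← h2, h3, sub_self]
  set V := G * G - PowerSeries.C (D.l * D.l)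
  have hV : ∀ r, PowerSeries.coeff r V = 0 := by
    intro r
    induction r using Nat.strong_induction_on with
    | _ r ih =>
      have := congrArg (PowerSeries.coeff r) h4
      rw [PowerSeries.coeff_mul, Finset.sum_eq_single (0, r)] at this
      · simpa [τ, T_zero, D.th_ne] using this
      · rintro ⟨u, v⟩ huv hne
        rw [Finset.HasAntidiagonal.mem_antidiagonal] at huv
        have : v < r := by
          rcases Nat.eq_zero_or_pos u with rfl | hu
          · exact absurd (by simpa using huv) hne
          · simp only at huv; omega
        rw [ih v this, mul_zero]
      · simp
  intro r hr
  have := hV r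
  rw [map_sub, PowerSeries.coeff_mul, PowerSeries.coeff_C, if_neg (by omega), sub_zero] at this
  rw [← this]
  refine Finset.sum_congr rfl fun p _ => ?_
  simp [G, smul_smul, mul_comm]

end QDatum

namespace QDatum
open Finset.HasAntidiagonal (antidiagonal)
variable {A : Type} [Ring A] [Algebra ℂ A] {D : QDatum A}

variable (D) in
/-- anticommutators of the iterated commutators `lM` -/
def c (m n : ℕ) : A := D.lM m * D.lM n + D.lM n * D.lM m

lemma c_symm (m n : ℕ) : D.c m n = D.c n m := add_comm _ _

lemma N_c (m n : ℕ) : D.N * D.c m n - D.c m n * D.N = D.c (m + 1) n + D.c m (n + 1) := by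
  simp only [c, lM_succ]
  noncomm_ring

lemma alternating_ne {r : ℕ} (hr : r % 2 = 1) :
    ∑ p ∈ antidiagonal r, (-1) ^ p.1 * ((p.2 : ℂ) - p.1) * (gCoeff D.th p.1 * gCoeff D.th p.2) ≠ 0 := by
  have hq := D.q_ne
  rw [alternating_gCoeff (a := D.q⁻¹ / 2) (b := -(D.q / 2)) (by rw [th]; ring) (by have := mul_inv_cancel₀ hq; linear_combination (-4⁻¹) * this) hr,
    (Nat.odd_iff.mpr hr).neg_pow]
  have h2 := D.not_root (r + r) (by omega)
  intro h
  apply h2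
  rw [div_pow, div_pow, inv_pow] at h
  have h2 : (2 : ℂ) ^ r ≠ 0 := pow_ne_zero _ two_ne_zero
  have hqr : D.q ^ r ≠ 0 := pow_ne_zero _ hq
  rw [pow_add]
  field_simp at h
  linear_combination (-1 / 4) * h

variable (hα : D.α = 1)
include hα

lemma c_odd_of {r : ℕ} (hr : r % 2 = 0)
    (h : ∀ m n, m + n = r → ((-1 : ℂ) ^ m) • D.c m n = D.c 0 r) (m n : ℕ) (hmn : m + n = r + 1) :
    D.c m n = 0 := by
  have step (m n : ℕ) (hmn : m + n = r) : ((-1 : ℂ) ^ m) • (D.c (m + 1) n + D.c m (n + 1)) =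
      D.c 1 r + D.c 0 (r + 1) := by
    have := h m n hmn
    have e := D.N_c 0 r
    rw [← N_c, ← e, ← this]
    simp only [mul_smul_comm, smul_mul_assoc, smul_sub]
  have lin (m n : ℕ) (hmn : m + n = r + 1) : ((-1 : ℂ) ^ m) • D.c m n =
      D.c 0 (r + 1) - (m : ℂ) • (D.c 1 r + D.c 0 (r + 1)) := by
    induction m generalizing n with
    | zero => rw [show n = r + 1 by omega]; simp
    | succ m ih =>
      have h1 := ih (n + 1) (by omega)
      have h2 := step m n (by omega)
      push_cast
      linear_combination (norm := skip) h1 - h2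
      simp only [pow_succ]
      match_scalars <;> ring1
  have last := lin (r + 1) 0 (by omega)
  rw [c_symm (r + 1) 0, Odd.neg_one_pow (Nat.odd_iff.mpr (by omega))] at last
  have lin' (m n : ℕ) (hmn : m + n = r + 1) : ((r : ℂ) + 1) • D.c m n =
      ((-1 : ℂ) ^ m * (n - m)) • D.c 0 (r + 1) := by
    have h1 := lin m n hmn
    have : (n : ℂ) = r + 1 - m := by
      rw [eq_sub_iff_add_eq]; exact_mod_cast (by omega)
    rw [this]
    push_cast at last
    linear_combination (norm := skip) ((-1 : ℂ) ^ m * (r + 1)) • h1 - ((-1 : ℂ) ^ m * m) • last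
    rcases neg_one_pow_eq_or ℂ m with s | s <;> rw [s] <;> match_scalars <;> ring1
  have W := lM_series hα (r + 1) (by omega)
  have W' : ∑ p ∈ antidiagonal (r + 1), (gCoeff D.th p.1 * gCoeff D.th p.2) • D.c p.1 p.2 = 0 := by
    have W2 := (Finset.Nat.sum_antidiagonal_swap (n := r + 1) (f := fun p : ℕ × ℕ =>
      (gCoeff D.th p.1 * gCoeff D.th p.2) • (D.lM p.1 * D.lM p.2))).trans W
    have W3 := congrArg₂ (· + ·) W W2
    rw [← Finset.sum_add_distrib, add_zero] at W3
    rw [← W3]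
    refine Finset.sum_congr rfl fun p _ => ?_
    simp only [c, Prod.fst_swap, Prod.snd_swap, smul_add, mul_comm (gCoeff D.th p.2)]
  have h0 : D.c 0 (r + 1) = 0 := by
    have e : ((r : ℂ) + 1) • ∑ p ∈ antidiagonal (r + 1), (gCoeff D.th p.1 * gCoeff D.th p.2) • D.c p.1 p.2
        = (∑ p ∈ antidiagonal (r + 1), (-1) ^ p.1 * ((p.2 : ℂ) - p.1) *
            (gCoeff D.th p.1 * gCoeff D.th p.2)) • D.c 0 (r + 1) := by
      rw [Finset.smul_sum, Finset.sum_smul]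
      refine Finset.sum_congr rfl fun p hp => ?_
      rw [smul_comm, lin' p.1 p.2 (Finset.HasAntidiagonal.mem_antidiagonal.mp hp), smul_smul, mul_comm]
    rw [W', smul_zero] at e
    exact (smul_eq_zero.mp e.symm).resolve_left (D.alternating_ne (by omega))
  have := lin' m n hmn
  rw [h0, smul_zero] at this
  exact (smul_eq_zero.mp this).resolve_left (by exact_mod_cast Nat.succ_ne_zero r)

theorem c_even (k : ℕ) : ∀ m n, m + n = 2 * k → ((-1 : ℂ) ^ m) • D.c m n = D.c 0 (2 * k) := by
  induction k with
  | zero =>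
    intro m n h
    rw [show m = 0 by omega, show n = 0 by omega]; simp
  | succ k ih =>
    intro m n h
    induction m generalizing n with
    | zero => rw [show n = 2 * (k + 1) by omega]; simp
    | succ m ihm =>
      rw [← ihm (n + 1) (by omega)]
      have h0 := D.N_c m n
      rw [c_odd_of hα (by omega) ih m n (by omega)] at h0
      rw [pow_succ, eq_sub_of_add_eq h0.symm]
      simp

theorem c_odd (m n : ℕ) (h : (m + n) % 2 = 1) : D.c m n = 0 :=
  c_odd_of hα (r := 2 * ((m + n) / 2)) (by omega) (c_even hα _) m n (by omega)

/-- reordering of the iterated commutators `lM` -/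
theorem lM_mul_lM {m n : ℕ} (h : n < m) : ∃ r s : ℂ, ∃ j < m, D.lM m * D.lM n =
    r • (D.lM n * D.lM m) + s • (D.lM j * D.lM j) := by
  rcases Nat.mod_two_eq_zero_or_one (m + n) with h2 | h2
  · obtain ⟨k, hk⟩ : ∃ k, m + n = 2 * k := ⟨(m + n) / 2, by omega⟩
    refine ⟨-1, (-1) ^ m * (-1) ^ k * 2, k, by omega, ?_⟩
    have h1 := c_even hα k m n hk
    have h3 := c_even hα k k k (by omega)
    rw [← h3] at h1
    simp only [c] at h1
    linear_combination (norm := skip) ((-1 : ℂ) ^ m) • h1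
    rcases neg_one_pow_eq_or ℂ m with s | s <;> rw [s] <;> match_scalars <;> ring1
  · refine ⟨-1, 0, n, h, ?_⟩
    have h1 := c_odd hα m n h2
    rw [c] at h1
    linear_combination (norm := module) h1

end QDatum

namespace QDatum
variable {A : Type} [Ring A] [Algebra ℂ A] {D : QDatum A}

variable (D) in
/-- the subalgebra generated by the `lM j` and the `T (2 * i)`, `i ≤ k` -/
def HS (k : ℕ) : Subalgebra ℂ A :=
  Algebra.adjoin ℂ (Set.range D.lM ∪ (fun i => D.T (2 * i)) '' Set.Iic k)

lemma lM_mem_HS (j k : ℕ) : D.lM j ∈ D.HS k := Algebra.subset_adjoin (Or.inl ⟨j, rfl⟩)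

lemma T_mem_HS {i k : ℕ} (h : i ≤ k) : D.T (2 * i) ∈ D.HS k :=
  Algebra.subset_adjoin (Or.inr ⟨i, h, rfl⟩)

lemma HS_mono {k k' : ℕ} (h : k ≤ k') : D.HS k ≤ D.HS k' :=
  Algebra.adjoin_mono (Set.union_subset_union_right _ (Set.image_mono (Set.Iic_subset_Iic.mpr h)))

lemma l_mem_HS (k : ℕ) : D.l ∈ D.HS k := lM_mem_HS 0 k

lemma commutator_mem {B : Subalgebra ℂ A} {s t : A} (hs : s ∈ B) (ht : t ∈ B) : s * t - t * s ∈ B :=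
  sub_mem (mul_mem hs ht) (mul_mem ht hs)

lemma commutator_mem_adjoin {s : Set A} {t : A}
    (h : ∀ u ∈ s, t * u - u * t ∈ Algebra.adjoin ℂ s) {u : A} (hu : u ∈ Algebra.adjoin ℂ s) :
    t * u - u * t ∈ Algebra.adjoin ℂ s := by
  induction hu using Algebra.adjoin_induction with
  | mem u hu => exact h u hu
  | algebraMap r => rw [Algebra.commutes, sub_self]; exact zero_mem _
  | add u v hu hv h1 h2 =>
    rw [show t * (u + v) - (u + v) * t = (t * u - u * t) + (t * v - v * t) by noncomm_ring]
    exact add_mem h1 h2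
  | mul u v hu hv h1 h2 =>
    rw [show t * (u * v) - (u * v) * t = (t * u - u * t) * v + u * (t * v - v * t) by noncomm_ring]
    exact add_mem (mul_mem h1 hv) (mul_mem hu h2)

variable (hα : D.α = 1)
include hα

lemma N_mem_HS (k : ℕ) : D.N ∈ D.HS (k + 1) := by
  rw [← T_two hα]; exact T_mem_HS (Nat.succ_le_succ (Nat.zero_le k))

lemma mem_HS_aux (k : ℕ) : D.K (2 * k + 1) ∈ D.HS k ∧ D.T (2 * k + 1) ∈ D.HS k ∧
    D.K (2 * k + 2) ∈ D.HS k ∧ D.K (2 * k + 3) ∈ D.HS k := by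
  have even {k : ℕ} (h : D.T (2 * k + 1) ∈ D.HS k) : D.K (2 * k + 2) ∈ D.HS k := by
    rw [← l_T hα]
    exact add_mem (mul_mem (l_mem_HS k) h) (Subalgebra.smul_mem _ (mul_mem h (l_mem_HS k)) _)
  induction k with
  | zero =>
    have h1 : D.T (2 * 0 + 1) ∈ D.HS 0 := by rw [T_one]; exact l_mem_HS 0
    refine ⟨by rw [K_one]; exact zero_mem _, h1, even h1, ?_⟩
    rw [K_odd hα _ (by omega), show D.T (2 * 0 + 1) = D.lM 0 from D.T_one, ← lM_succ]
    exact neg_mem (lM_mem_HS 1 0)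
  | succ k ih =>
    have mono := D.HS_mono (Nat.le_succ k)
    have hK : D.K (2 * (k + 1) + 1) ∈ D.HS (k + 1) := mono ih.2.2.2
    have hN := N_mem_HS hα k
    have hl := D.l_mem_HS (k + 1)
    have hTT : D.T (2 * k + 2) ∈ D.HS (k + 1) := T_mem_HS (i := k + 1) le_rfl
    have hT : D.T (2 * (k + 1) + 1) ∈ D.HS (k + 1) := by
      rw [show 2 * (k + 1) + 1 = 2 * k + 3 by ring, T_odd hα _ (by omega)]
      exact sub_mem (Subalgebra.smul_mem _ (add_mem (mul_mem hl hTT) (mul_mem hTT hl)) _)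
        (Subalgebra.smul_mem _ (commutator_mem hN (mono ih.1)) _)
    refine ⟨hK, hT, even hT, ?_⟩
    rw [K_odd hα _ (by omega)]
    exact neg_mem (commutator_mem hN hT)

lemma a_even_mem (k : ℕ) : D.a (2 * k) ∈ D.HS k := by
  rw [a_eq]
  refine add_mem (T_mem_HS le_rfl) (Subalgebra.smul_mem _ ?_ _)
  cases k with
  | zero => simp [K, a, b]
  | succ k => exact HS_mono (Nat.le_succ k) (mem_HS_aux hα k).2.2.1

lemma a_sub_T_mem (k : ℕ) : D.a (2 * k + 2) - D.T (2 * k + 2) ∈ D.HS k := by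
  rw [a_eq, add_sub_cancel_left]
  exact Subalgebra.smul_mem _ (mem_HS_aux hα k).2.2.1 _

lemma b_sub_T_mem (k : ℕ) : D.b (2 * k + 2) - D.T (2 * k + 2) ∈ D.HS k := by
  rw [b_eq, sub_sub_cancel_left]
  exact neg_mem (Subalgebra.smul_mem _ (mem_HS_aux hα k).2.2.1 _)

lemma b_even_mem (k : ℕ) : D.b (2 * k) ∈ D.HS k := by
  have : D.b (2 * k) = D.a (2 * k) - D.K (2 * k) := by rw [K]; abel
  rw [this]
  refine sub_mem (a_even_mem hα k) ?_
  cases k with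
  | zero => simp [K, a, b]
  | succ k => exact HS_mono (Nat.le_succ k) (mem_HS_aux hα k).2.2.1

lemma a_odd_mem (k : ℕ) : D.a (2 * k + 1) ∈ D.HS k := by
  rw [a_eq]
  exact add_mem (mem_HS_aux hα k).2.1 (Subalgebra.smul_mem _ (mem_HS_aux hα k).1 _)

lemma b_odd_mem (k : ℕ) : D.b (2 * k + 1) ∈ D.HS k := by
  rw [b_eq]
  exact sub_mem (mem_HS_aux hα k).2.1 (Subalgebra.smul_mem _ (mem_HS_aux hα k).1 _)

lemma K_even_mem {i k : ℕ} (h : i ≤ k + 1) : D.K (2 * i) ∈ D.HS k := by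
  cases i with
  | zero => simp [K, a, b]
  | succ i => exact HS_mono (by omega) (mem_HS_aux hα i).2.2.1

lemma commutator_T_mem (k : ℕ) {u : A} (hu : u ∈ D.HS k) :
    D.T (2 * k + 2) * u - u * D.T (2 * k + 2) ∈ D.HS k := by
  refine commutator_mem_adjoin ?_ hu
  rintro _ (⟨j, rfl⟩ | ⟨i, hi, rfl⟩)
  · rw [← neg_sub]
    refine neg_mem ?_
    cases k with
    | zero => rw [lM_T_two hα]; exact neg_mem (lM_mem_HS _ _)
    | succ k =>
      rw [show 2 * (k + 1) + 2 = 2 * k + 4 by ring, lM_T hα]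
      have h1 : D.T (2 * k + 2) ∈ D.HS (k + 1) := T_mem_HS (i := k + 1) le_rfl
      have h0 : D.T (2 * k) ∈ D.HS (k + 1) := T_mem_HS (Nat.le_succ k)
      exact add_mem (Subalgebra.smul_mem _ (add_mem (mul_mem (lM_mem_HS _ _) h1)
        (mul_mem h1 (lM_mem_HS _ _))) _)
        (Subalgebra.smul_mem _ (commutator_mem (lM_mem_HS _ _) h0) _)
  · have h := T_T hα (i := 2 * k + 2) (j := 2 * i) (by omega) (by omega)
    change D.T (2 * k + 2) * D.T (2 * i) - D.T (2 * i) * D.T (2 * k + 2) ∈ D.HS k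
    rw [h]
    exact Subalgebra.smul_mem _ (commutator_mem (K_even_mem hα (i := k + 1) le_rfl)
      (K_even_mem hα (Set.mem_Iic.mp hi |>.trans (Nat.le_succ k)))) _

lemma commutator_a_mem (k : ℕ) {u : A} (hu : u ∈ D.HS k) :
    D.a (2 * k + 2) * u - u * D.a (2 * k + 2) ∈ D.HS k := by
  have h := add_mem (commutator_T_mem hα k hu) (commutator_mem (a_sub_T_mem hα k) hu)
  convert h using 1
  noncomm_ring

end QDatum

namespace QDatum
variable {A : Type} [Ring A] [Algebra ℂ A] {D : QDatum A}
open Submodule (mul_mem_mul)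

variable (D) in
/-- the span of the root vectors `Y n` -/
def YS : Submodule ℂ A := Submodule.span ℂ (Set.range D.Y)

variable (D) in
/-- the span of the root vectors `X n` -/
def XS : Submodule ℂ A := Submodule.span ℂ (Set.range D.X)

variable (D) in
/-- the subalgebra generated by all `lM j` and `T (2 * i)` -/
def HT : Subalgebra ℂ A := Algebra.adjoin ℂ (Set.range D.lM ∪ Set.range fun i => D.T (2 * i))

lemma Y_mem_YS (n : ℕ) : D.Y n ∈ D.YS := Submodule.subset_span ⟨n, rfl⟩
lemma X_mem_XS (n : ℕ) : D.X n ∈ D.XS := Submodule.subset_span ⟨n, rfl⟩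

lemma HS_le_HT (k : ℕ) : D.HS k ≤ D.HT :=
  Algebra.adjoin_mono (Set.union_subset_union_right _ (Set.image_subset_range _ _))

/-- elements of a subalgebra `H` that can be moved to the right past `V` -/
def moveRight (V : Submodule ℂ A) (H : Subalgebra ℂ A) : Subalgebra ℂ A where
  carrier := {h | h ∈ H ∧ ∀ v ∈ V, h * v ∈ V * H.toSubmodule}
  mul_mem' := by
    rintro s t ⟨hs, hs'⟩ ⟨ht, ht'⟩
    refine ⟨mul_mem hs ht, fun v hv => ?_⟩
    rw [mul_assoc]
    have := ht' v hv
    generalize t * v = z at this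
    induction this using Submodule.mul_induction_on' with
    | mem_mul_mem w hw u hu =>
      rw [← mul_assoc]
      have := mul_mem_mul (hs' w hw) hu
      rwa [mul_assoc, (Subalgebra.isIdempotentElem_toSubmodule H).eq] at this
    | add a _ b _ h1 h2 => rw [mul_add]; exact add_mem h1 h2
  add_mem' := by
    rintro s t ⟨hs, hs'⟩ ⟨ht, ht'⟩
    refine ⟨add_mem hs ht, fun v hv => ?_⟩
    rw [add_mul]
    exact add_mem (hs' v hv) (ht' v hv)
  algebraMap_mem' r := by
    refine ⟨H.algebraMap_mem r, fun v hv => ?_⟩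
    rw [Algebra.commutes]
    exact mul_mem_mul hv (H.algebraMap_mem r)

lemma mul_le_of_moveRight {V : Submodule ℂ A} {H : Subalgebra ℂ A} (h : H ≤ moveRight V H) :
    H.toSubmodule * V ≤ V * H.toSubmodule :=
  Submodule.mul_le.mpr fun _ hs v hv => (h hs).2 v hv

lemma mem_moveRight_YS {H : Subalgebra ℂ A} {h : A} (hh : h ∈ H)
    (hY : ∀ m, h * D.Y m ∈ D.YS * H.toSubmodule) : h ∈ moveRight D.YS H := by
  refine ⟨hh, fun v hv => ?_⟩
  induction hv using Submodule.span_induction with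
  | mem v hv => obtain ⟨m, rfl⟩ := hv; exact hY m
  | zero => rw [mul_zero]; exact zero_mem _
  | add u v _ _ h1 h2 => rw [mul_add]; exact add_mem h1 h2
  | smul r v _ h => rw [mul_smul_comm]; exact Submodule.smul_mem _ _ h

variable (hα : D.α = 1)
include hα

lemma a_mul_Y_mem (k m : ℕ) (hN : D.N ∈ moveRight D.YS D.HT)
    (hk : D.HS k ≤ moveRight D.YS D.HT) :
    D.a (2 * k + 2) * D.Y m ∈ D.YS * D.HT.toSubmodule := by
  have YH (n : ℕ) {h : A} (hh : h ∈ D.HT) : D.Y n * h ∈ D.YS * D.HT.toSubmodule :=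
    mul_mem_mul (Y_mem_YS n) hh
  have hK := D.HS_le_HT k
  have hK' := D.HS_le_HT (k + 1)
  have ha : D.a (2 * k + 2) ∈ D.HT := hK' (a_even_mem hα (k + 1))
  have ha' : D.a (2 * k + 1) ∈ D.HS k := a_odd_mem hα k
  have hb : D.b (2 * k + 2) ∈ D.HT := hK' (b_even_mem hα (k + 1))
  have hb' : D.b (2 * k + 1) ∈ D.HS k := b_odd_mem hα k
  rcases Nat.mod_two_eq_zero_or_one m with h | h
  · have := D.Phi_eq_zero (i := 0) (n := 2 * k) (m := m) (by omega) (sqComm hα _ _) (sqComm hα _ _)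
    simp only [Phi, ← a_succ] at this
    rw [show D.a (2 * k + 2) * D.Y m = D.q • (D.a (2 * k + 1) * D.Y (m + 1)) +
      (D.q * D.k 0 m) • (D.Y m * D.a (2 * k + 2)) - D.k 0 (m + 1) • (D.Y (m + 1) * D.a (2 * k + 1))
      by linear_combination (norm := module) this]
    exact sub_mem (add_mem (Submodule.smul_mem _ _ ((hk ha').2 _ (Y_mem_YS _)))
      (Submodule.smul_mem _ _ (YH _ ha))) (Submodule.smul_mem _ _ (YH _ (hK ha')))
  · suffices hb2 : D.b (2 * k + 2) * D.Y m ∈ D.YS * D.HT.toSubmodule by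
      have := add_mem hb2 ((hk (mem_HS_aux hα k).2.2.1).2 _ (Y_mem_YS m))
      rwa [← add_mul, K, add_sub_cancel] at this
    cases k with
    | zero =>
      have := add_mem (hN.2 _ (Y_mem_YS m)) ((hk (b_sub_T_mem hα 0)).2 _ (Y_mem_YS m))
      rwa [← add_mul, ← T_two hα, add_sub_cancel] at this
    | succ k =>
      have := D.Phi_eq_zero (i := 1) (n := 2 * k + 1) (m := m) (by omega) (sqComm hα _ _) (sqComm hα _ _)
      simp only [Phi, ← b_add_two] at this
      rw [show D.b (2 * (k + 1) + 2) * D.Y m = D.q • (D.b (2 * (k + 1) + 1) * D.Y (m + 1)) +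
        (D.q * D.k 1 m) • (D.Y m * D.b (2 * (k + 1) + 2)) -
        D.k 1 (m + 1) • (D.Y (m + 1) * D.b (2 * (k + 1) + 1))
        by linear_combination (norm := module) this]
      exact sub_mem (add_mem (Submodule.smul_mem _ _ ((hk hb').2 _ (Y_mem_YS _)))
        (Submodule.smul_mem _ _ (YH _ hb))) (Submodule.smul_mem _ _ (YH _ (hK hb')))

lemma YS_move : D.HT.toSubmodule * D.YS ≤ D.YS * D.HT.toSubmodule := by
  apply mul_le_of_moveRight
  have YH (n : ℕ) {h : A} (hh : h ∈ D.HT) : D.Y n * h ∈ D.YS * D.HT.toSubmodule :=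
    mul_mem_mul (Y_mem_YS n) hh
  have hl : D.l ∈ D.HT := HS_le_HT 0 (l_mem_HS 0)
  have hN : D.N ∈ D.HT := HS_le_HT 1 (N_mem_HS hα 0)
  have cl : D.l ∈ moveRight D.YS D.HT := mem_moveRight_YS hl fun m => by
    rw [show D.l * D.Y m = D.Y (m + 1) * 1 - (D.α * (-1) ^ m) • (D.Y m * D.l) by rw [Y_succ, mul_one]; module]
    exact sub_mem (YH _ (one_mem _)) (Submodule.smul_mem _ _ (YH _ hl))
  have cN : D.N ∈ moveRight D.YS D.HT := mem_moveRight_YS hN fun m => by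
    have h := D.N_Y m
    rw [NYRel] at h
    rw [sub_eq_iff_eq_add.mp h, ← mul_one (D.Y (m + 2))]
    exact add_mem (add_mem (Submodule.smul_mem _ _ (YH _ (one_mem _)))
      (Submodule.smul_mem _ _ (YH _ hl))) (YH _ hN)
  have clM (j : ℕ) : D.lM j ∈ moveRight D.YS D.HT := by
    induction j with
    | zero => exact cl
    | succ j ih => exact commutator_mem cN ih
  have cHS (k : ℕ) : D.HS k ≤ moveRight D.YS D.HT := by
    induction k with
    | zero =>
      refine Algebra.adjoin_le ?_
      rintro _ (⟨j, rfl⟩ | ⟨i, hi, rfl⟩)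
      · exact clM j
      · obtain rfl : i = 0 := by simpa using hi
        simp only [mul_zero, T_zero]
        exact Subalgebra.smul_mem _ (one_mem _) _
    | succ k ih =>
      refine Algebra.adjoin_le ?_
      rintro _ (⟨j, rfl⟩ | ⟨i, hi, rfl⟩)
      · exact clM j
      · rcases (Nat.le_succ_iff.mp (Set.mem_Iic.mp hi)) with h | rfl
        · exact ih (T_mem_HS h)
        · have h1 := mem_moveRight_YS (D.HS_le_HT (k + 1) (a_even_mem hα (k + 1)))
            fun m => a_mul_Y_mem hα k m cN ih
          have h2 := ih (a_sub_T_mem hα k)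
          have := sub_mem h1 h2
          rwa [show 2 * (k + 1) = 2 * k + 2 by ring, sub_sub_cancel] at this
  refine Algebra.adjoin_le ?_
  rintro _ (⟨j, rfl⟩ | ⟨i, rfl⟩)
  · exact clM j
  · exact cHS i (T_mem_HS le_rfl)

end QDatum

namespace QDatum
variable {A : Type} [Ring A] [Algebra ℂ A] {D : QDatum A}
open Submodule (mul_mem_mul)

/-- elements of a subalgebra `H` that can be moved to the left past `V` -/
def moveLeft (V : Submodule ℂ A) (H : Subalgebra ℂ A) : Subalgebra ℂ A where
  carrier := {h | h ∈ H ∧ ∀ v ∈ V, v * h ∈ H.toSubmodule * V}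
  mul_mem' := by
    rintro s t ⟨hs, hs'⟩ ⟨ht, ht'⟩
    refine ⟨mul_mem hs ht, fun v hv => ?_⟩
    rw [← mul_assoc]
    have := hs' v hv
    generalize v * s = z at this
    induction this using Submodule.mul_induction_on' with
    | mem_mul_mem u hu w hw =>
      rw [mul_assoc]
      have := mul_mem_mul hu (ht' w hw)
      rwa [← mul_assoc, (Subalgebra.isIdempotentElem_toSubmodule H).eq] at this
    | add a _ b _ h1 h2 => rw [add_mul]; exact add_mem h1 h2
  add_mem' := by
    rintro s t ⟨hs, hs'⟩ ⟨ht, ht'⟩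
    refine ⟨add_mem hs ht, fun v hv => ?_⟩
    rw [mul_add]
    exact add_mem (hs' v hv) (ht' v hv)
  algebraMap_mem' r := by
    refine ⟨H.algebraMap_mem r, fun v hv => ?_⟩
    rw [← Algebra.commutes]
    exact mul_mem_mul (H.algebraMap_mem r) hv

lemma mul_le_of_moveLeft {V : Submodule ℂ A} {H : Subalgebra ℂ A} (h : H ≤ moveLeft V H) :
    V * H.toSubmodule ≤ H.toSubmodule * V :=
  Submodule.mul_le.mpr fun v hv _ hs => (h hs).2 v hv

lemma mem_moveLeft_XS {H : Subalgebra ℂ A} {h : A} (hh : h ∈ H)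
    (hX : ∀ m, D.X m * h ∈ H.toSubmodule * D.XS) : h ∈ moveLeft D.XS H := by
  refine ⟨hh, fun v hv => ?_⟩
  induction hv using Submodule.span_induction with
  | mem v hv => obtain ⟨m, rfl⟩ := hv; exact hX m
  | zero => rw [zero_mul]; exact zero_mem _
  | add u v _ _ h1 h2 => rw [add_mul]; exact add_mem h1 h2
  | smul r v _ h => rw [smul_mul_assoc]; exact Submodule.smul_mem _ _ h

variable (hα : D.α = 1)
include hα

lemma X_mul_a_mem (k m : ℕ) (hN : D.N ∈ moveLeft D.XS D.HT)
    (hk : D.HS k ≤ moveLeft D.XS D.HT) :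
    D.X m * D.a (2 * k + 2) ∈ D.HT.toSubmodule * D.XS := by
  have HX (n : ℕ) {h : A} (hh : h ∈ D.HT) : h * D.X n ∈ D.HT.toSubmodule * D.XS :=
    mul_mem_mul hh (X_mem_XS n)
  have hK := D.HS_le_HT k
  have hK' := D.HS_le_HT (k + 1)
  have ha : D.a (2 * k + 2) ∈ D.HT := hK' (a_even_mem hα (k + 1))
  have ha' : D.a (2 * k + 1) ∈ D.HS k := a_odd_mem hα k
  have hb : D.b (2 * k + 2) ∈ D.HT := hK' (b_even_mem hα (k + 1))
  have hb' : D.b (2 * k + 1) ∈ D.HS k := b_odd_mem hα k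
  rcases Nat.mod_two_eq_zero_or_one m with h | h
  · suffices hb2 : D.X m * D.b (2 * k + 2) ∈ D.HT.toSubmodule * D.XS by
      have := add_mem hb2 ((hk (mem_HS_aux hα k).2.2.1).2 _ (X_mem_XS m))
      rwa [← mul_add, K, add_sub_cancel] at this
    have := D.PhiX_eq_zero (j := 2 * k) (n := 0) (m := m) (by omega) (sqComm hα _ _) (sqComm hα _ _)
    simp only [PhiX, ← a_succ, zero_add, ← b_add_two] at this
    rw [show D.X m * D.b (2 * k + 2) = D.q • (D.X (m + 1) * D.a (2 * k + 1)) +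
      (D.q * D.k m (2 * k)) • (D.b (2 * k + 2) * D.X m) -
      D.k (m + 1) (2 * k) • (D.a (2 * k + 1) * D.X (m + 1))
      by linear_combination (norm := module) this]
    exact sub_mem (add_mem (Submodule.smul_mem _ _ ((hk ha').2 _ (X_mem_XS _)))
      (Submodule.smul_mem _ _ (HX _ hb))) (Submodule.smul_mem _ _ (HX _ (hK ha')))
  · cases k with
    | zero =>
      have := add_mem (hN.2 _ (X_mem_XS m)) ((hk (a_sub_T_mem hα 0)).2 _ (X_mem_XS m))
      rwa [← mul_add, ← T_two hα, add_sub_cancel] at this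
    | succ k =>
      have := D.PhiX_eq_zero (j := 2 * k + 1) (n := 1) (m := m) (by omega) (sqComm hα _ _)
        (sqComm hα _ _)
      simp only [PhiX, show D.e (1 + 1) (2 * k + 1) = _ from e_add_two hα 0 _, ← a_succ,
        ← b_add_two] at this
      rw [show D.X m * D.a (2 * (k + 1) + 2) = D.q • (D.X (m + 1) * D.b (2 * (k + 1) + 1)) +
        (D.q * D.k m (2 * k + 1)) • (D.a (2 * (k + 1) + 2) * D.X m) -
        D.k (m + 1) (2 * k + 1) • (D.b (2 * (k + 1) + 1) * D.X (m + 1))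
        by linear_combination (norm := module) this]
      exact sub_mem (add_mem (Submodule.smul_mem _ _ ((hk hb').2 _ (X_mem_XS _)))
        (Submodule.smul_mem _ _ (HX _ ha))) (Submodule.smul_mem _ _ (HX _ (hK hb')))

lemma XS_move : D.XS * D.HT.toSubmodule ≤ D.HT.toSubmodule * D.XS := by
  apply mul_le_of_moveLeft
  have HX (n : ℕ) {h : A} (hh : h ∈ D.HT) : h * D.X n ∈ D.HT.toSubmodule * D.XS :=
    mul_mem_mul hh (X_mem_XS n)
  have hl : D.l ∈ D.HT := HS_le_HT 0 (l_mem_HS 0)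
  have hN : D.N ∈ D.HT := HS_le_HT 1 (N_mem_HS hα 0)
  have cl : D.l ∈ moveLeft D.XS D.HT := mem_moveLeft_XS hl fun m => by
    rw [show D.X m * D.l = 1 * D.X (m + 1) + (D.α * (-1) ^ m) • (D.l * D.X m) by
      rw [X_succ, one_mul]; module]
    exact add_mem (HX _ (one_mem _)) (Submodule.smul_mem _ _ (HX _ hl))
  have cN : D.N ∈ moveLeft D.XS D.HT := mem_moveLeft_XS hN fun m => by
    have h := D.N_X m
    rw [NXRel] at h
    rw [← sub_eq_iff_eq_add'.mpr (sub_eq_iff_eq_add.mp h), ← one_mul (D.X (m + 2))]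
    exact sub_mem (HX _ hN) (add_mem (neg_mem (Submodule.smul_mem _ _ (HX _ (one_mem _))))
      (Submodule.smul_mem _ _ (HX _ hl)))
  have clM (j : ℕ) : D.lM j ∈ moveLeft D.XS D.HT := by
    induction j with
    | zero => exact cl
    | succ j ih => exact commutator_mem cN ih
  have cHS (k : ℕ) : D.HS k ≤ moveLeft D.XS D.HT := by
    induction k with
    | zero =>
      refine Algebra.adjoin_le ?_
      rintro _ (⟨j, rfl⟩ | ⟨i, hi, rfl⟩)
      · exact clM j
      · obtain rfl : i = 0 := by simpa using hi
        simp only [mul_zero, T_zero]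
        exact Subalgebra.smul_mem _ (one_mem _) _
    | succ k ih =>
      refine Algebra.adjoin_le ?_
      rintro _ (⟨j, rfl⟩ | ⟨i, hi, rfl⟩)
      · exact clM j
      · rcases (Nat.le_succ_iff.mp (Set.mem_Iic.mp hi)) with h | rfl
        · exact ih (T_mem_HS h)
        · have h1 := mem_moveLeft_XS (D.HS_le_HT (k + 1) (a_even_mem hα (k + 1)))
            fun m => X_mul_a_mem hα k m cN ih
          have h2 := ih (a_sub_T_mem hα k)
          have := sub_mem h1 h2
          rwa [show 2 * (k + 1) = 2 * k + 2 by ring, sub_sub_cancel] at this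
  refine Algebra.adjoin_le ?_
  rintro _ (⟨j, rfl⟩ | ⟨i, rfl⟩)
  · exact clM j
  · exact cHS i (T_mem_HS le_rfl)

lemma e_mem_HT (i j : ℕ) : D.e i j ∈ D.HT := by
  have h (j : ℕ) : D.e 0 j ∈ D.HT ∧ D.e 1 j ∈ D.HT := by
    rw [← a_succ, ← b_add_two]
    rcases Nat.even_or_odd' j with ⟨k, rfl | rfl⟩
    · exact ⟨HS_le_HT _ (a_odd_mem hα k), HS_le_HT _ (b_even_mem hα (k + 1))⟩
    · exact ⟨HS_le_HT _ (a_even_mem hα (k + 1)), HS_le_HT _ (b_odd_mem hα (k + 1))⟩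
  induction i using Nat.twoStepInduction generalizing j with
  | zero => exact (h j).1
  | one => exact (h j).2
  | more i ih _ => rw [e_add_two hα]; exact ih _

end QDatum

namespace QDatum
variable {A : Type} [Ring A] [Algebra ℂ A] {D : QDatum A}
open Submodule (mul_mem_mul)

lemma toSubmodule_mul_self (B : Subalgebra ℂ A) :
    B.toSubmodule * B.toSubmodule = B.toSubmodule :=
  Subalgebra.isIdempotentElem_toSubmodule B

lemma span_le_adjoin (s : Set A) : Submodule.span ℂ s ≤ (Algebra.adjoin ℂ s).toSubmodule :=
  Submodule.span_le.mpr Algebra.subset_adjoin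

/-- a relation moving `V` past the generators of a subalgebra `N` extends to `N` -/
lemma mul_adjoin_le {Z : Submodule ℂ A} {s : Set A}
    (hZ : Z * Submodule.span ℂ s ≤ (Algebra.adjoin ℂ s).toSubmodule * Z) :
    Z * (Algebra.adjoin ℂ s).toSubmodule ≤ (Algebra.adjoin ℂ s).toSubmodule * Z := by
  refine Submodule.mul_le.mpr fun z hz w hw => ?_
  replace hw : w ∈ Algebra.adjoin ℂ s := hw
  induction hw using Algebra.adjoin_induction generalizing z with
  | mem u hu => exact hZ (mul_mem_mul hz (Submodule.subset_span hu))
  | algebraMap r => rw [← Algebra.commutes]; exact mul_mem_mul (Subalgebra.algebraMap_mem _ r) hz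
  | add u v _ _ hu hv => rw [mul_add]; exact add_mem (hu z hz) (hv z hz)
  | mul u v _ _ hu hv =>
    rw [← mul_assoc]
    have := hu z hz
    generalize z * u = t at this
    induction this using Submodule.mul_induction_on' with
    | mem_mul_mem n hn z' hz' =>
      have := mul_mem_mul hn (hv z' hz')
      rwa [← mul_assoc, ← mul_assoc, toSubmodule_mul_self] at this
    | add a _ b _ h1 h2 => rw [add_mul]; exact add_mem h1 h2

variable (D) in
/-- the subalgebra generated by the root vectors `Y n` -/
def NY : Subalgebra ℂ A := Algebra.adjoin ℂ (Set.range D.Y)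

variable (D) in
/-- the subalgebra generated by the root vectors `X n` -/
def NX : Subalgebra ℂ A := Algebra.adjoin ℂ (Set.range D.X)

variable (hα : D.α = 1)
include hα

lemma XS_mul_YS_le : D.XS * D.YS ≤ D.NY.toSubmodule * (D.XS ⊔ D.HT.toSubmodule) := by
  have h (i j : ℕ) : D.X i * D.Y j ∈ D.NY.toSubmodule * (D.XS ⊔ D.HT.toSubmodule) := by
    rw [XY]
    refine add_mem ?_ (Submodule.smul_mem _ _ ?_)
    · rw [← one_mul (D.e i j)]
      exact mul_mem_mul (one_mem D.NY) (Submodule.mem_sup_right (e_mem_HT hα i j))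
    · exact mul_mem_mul (span_le_adjoin _ (Y_mem_YS j)) (Submodule.mem_sup_left (X_mem_XS i))
  refine (Submodule.span_mul_span ℂ _ _).trans_le (Submodule.span_le.mpr ?_)
  rintro _ ⟨_, ⟨i, rfl⟩, _, ⟨j, rfl⟩, rfl⟩
  exact h i j

theorem triangular (hgen : Algebra.adjoin ℂ {D.x, D.y} = ⊤) :
    D.NY.toSubmodule * D.HT.toSubmodule * D.NX.toSubmodule = ⊤ := by
  obtain ⟨W, hW⟩ : ∃ W, W = D.NY.toSubmodule * D.HT.toSubmodule * D.NX.toSubmodule := ⟨_, rfl⟩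
  obtain ⟨Z, hZ⟩ : ∃ Z, Z = D.XS ⊔ D.HT.toSubmodule := ⟨_, rfl⟩
  rw [← hW]
  have one_le (B : Subalgebra ℂ A) : (1 : Submodule ℂ A) ≤ B.toSubmodule :=
    Submodule.one_le.mpr (one_mem B)
  have hYS : D.YS ≤ D.NY.toSubmodule := span_le_adjoin _
  have hXS : D.XS ≤ D.NX.toSubmodule := span_le_adjoin _
  have hHY : D.HT.toSubmodule * D.YS ≤ D.NY.toSubmodule * Z :=
    (YS_move hα).trans (mul_le_mul' hYS (hZ ▸ le_sup_right))
  have hXY : D.XS * D.YS ≤ D.NY.toSubmodule * Z := by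
    rw [hZ]
    exact XS_mul_YS_le hα
  have hZY : Z * D.NY.toSubmodule ≤ D.NY.toSubmodule * Z := by
    refine mul_adjoin_le ?_
    change Z * D.YS ≤ D.NY.toSubmodule * Z
    calc Z * D.YS = D.XS * D.YS ⊔ D.HT.toSubmodule * D.YS := by rw [hZ, Submodule.sup_mul]
      _ ≤ _ := sup_le hXY hHY
  have hZH : Z * D.HT.toSubmodule ≤ D.HT.toSubmodule * D.NX.toSubmodule := by
    rw [hZ, Submodule.sup_mul, toSubmodule_mul_self]
    refine sup_le ((XS_move hα).trans (mul_le_mul' le_rfl hXS)) ?_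
    calc D.HT.toSubmodule = D.HT.toSubmodule * 1 := (mul_one _).symm
      _ ≤ _ := mul_le_mul' le_rfl (one_le _)
  have hxW : Z * W ≤ W := calc
    Z * W = Z * D.NY.toSubmodule * D.HT.toSubmodule * D.NX.toSubmodule := by
      rw [hW, mul_assoc, mul_assoc, mul_assoc]
    _ ≤ D.NY.toSubmodule * Z * D.HT.toSubmodule * D.NX.toSubmodule := by gcongr
    _ = D.NY.toSubmodule * (Z * D.HT.toSubmodule) * D.NX.toSubmodule := by simp only [mul_assoc]
    _ ≤ D.NY.toSubmodule * (D.HT.toSubmodule * D.NX.toSubmodule) * D.NX.toSubmodule := by gcongr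
    _ = W := by rw [mul_assoc, mul_assoc, toSubmodule_mul_self, ← mul_assoc, hW]
  have hyW : D.NY.toSubmodule * W ≤ W := by
    rw [hW, ← mul_assoc, ← mul_assoc, toSubmodule_mul_self]
  have key (u : A) (w : A) (hw : w ∈ W) : u * w ∈ W := by
    have hu : u ∈ Algebra.adjoin ℂ {D.x, D.y} := hgen ▸ Algebra.mem_top
    induction hu using Algebra.adjoin_induction generalizing w with
    | mem u hu =>
      rcases hu with rfl | rfl
      · exact hxW (mul_mem_mul (hZ ▸ Submodule.mem_sup_left (X_mem_XS 0)) hw)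
      · exact hyW (mul_mem_mul (hYS (Y_mem_YS 0)) hw)
    | algebraMap r => rw [← Algebra.smul_def]; exact W.smul_mem _ hw
    | add u v _ _ h1 h2 => rw [add_mul]; exact add_mem (h1 w hw) (h2 w hw)
    | mul u v _ _ h1 h2 => rw [mul_assoc]; exact h1 _ (h2 w hw)
  have one_W : (1 : A) ∈ W := by
    rw [hW]
    have h (B : Subalgebra ℂ A) : (1 : A) ∈ B.toSubmodule := one_mem B
    have := mul_mem_mul (mul_mem_mul (h D.NY) (h D.HT)) (h D.NX)
    rwa [one_mul, one_mul] at this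
  exact Submodule.eq_top_iff'.mpr fun u => mul_one u ▸ key u 1 one_W

end QDatum

section Straightening
variable {A : Type} [Ring A] [Algebra ℂ A]

/-- the ordered product `g 0 ^ f 0 * ⋯ * g (n - 1) ^ f (n - 1)` -/
def ascTo (g : ℕ → A) (f : ℕ →₀ ℕ) (n : ℕ) : A := ((List.range n).map fun i => g i ^ f i).prod

/-- the ordered product `g 0 ^ f 0 * g 1 ^ f 1 * ⋯` -/
def asc (g : ℕ → A) (f : ℕ →₀ ℕ) : A := ascTo g f (f.support.sup id + 1)

lemma ascTo_succ (g : ℕ → A) (f : ℕ →₀ ℕ) (n : ℕ) :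
    ascTo g f (n + 1) = ascTo g f n * g n ^ f n := by
  simp [ascTo, List.range_succ]

lemma ascTo_eq_of_le (g : ℕ → A) {f : ℕ →₀ ℕ} {n m : ℕ} (h : n ≤ m) (hf : ∀ i, n ≤ i → f i = 0) :
    ascTo g f m = ascTo g f n := by
  induction m, h using Nat.le_induction with
  | base => rfl
  | succ m hm ih => rw [ascTo_succ, hf m hm, pow_zero, mul_one, ih]

lemma asc_eq_ascTo (g : ℕ → A) {f : ℕ →₀ ℕ} {n : ℕ} (hf : ∀ i, n ≤ i → f i = 0) :
    asc g f = ascTo g f n := by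
  have h : ∀ i, f.support.sup id + 1 ≤ i → f i = 0 := fun i hi => by
    by_contra h0
    have := Finset.le_sup (f := id) (Finsupp.mem_support_iff.mpr h0)
    simp only [id] at this
    omega
  rw [asc, ← ascTo_eq_of_le g (le_max_left _ n) h, ← ascTo_eq_of_le g (le_max_right _ n) hf]

lemma ascTo_congr {g : ℕ → A} {f f' : ℕ →₀ ℕ} {n : ℕ} (h : ∀ i < n, f i = f' i) :
    ascTo g f n = ascTo g f' n := by
  rw [ascTo, ascTo]
  congr 1
  exact List.map_congr_left fun i hi => by rw [h i (List.mem_range.mp hi)]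

lemma ascTo_eq_one {g : ℕ → A} {f : ℕ →₀ ℕ} {n : ℕ} (h : ∀ i < n, f i = 0) :
    ascTo g f n = 1 := by
  rw [ascTo_congr (f' := 0) h]
  simp [ascTo]

lemma mul_ascTo (g : ℕ → A) {f : ℕ →₀ ℕ} {b n : ℕ} (hb : b < n) (h : ∀ i < b, f i = 0) :
    g b * ascTo g f n = ascTo g (Finsupp.single b 1 + f) n := by
  induction n, hb using Nat.le_induction with
  | base =>
    rw [ascTo_succ, ascTo_succ, ascTo_eq_one h, ascTo_eq_one, one_mul, one_mul]
    · simp [pow_add]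
    · intro i hi
      simp [h i hi, hi.ne']
  | succ m hm ih =>
    rw [ascTo_succ, ascTo_succ, ← mul_assoc, ih]
    have : b ≠ m := by omega
    simp [this]

lemma exists_asc_eq_word (g : ℕ → A) (w : List ℕ) (hw : w.Pairwise (· ≤ ·)) :
    ∃ f : ℕ →₀ ℕ, (∀ i, f i ≠ 0 → i ∈ w) ∧ asc g f = (w.map g).prod := by
  induction w with
  | nil => exact ⟨0, by simp, by rw [asc, ascTo_eq_one] <;> simp⟩
  | cons b w ih =>
    obtain ⟨f, hf, e⟩ := ih hw.of_cons
    refine ⟨Finsupp.single b 1 + f, fun i hi => ?_, ?_⟩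
    · by_cases h : i = b
      · simp [h]
      · refine List.mem_cons_of_mem _ (hf i fun h0 => hi ?_)
        simp [h0, Ne.symm h]
    · have hb (i : ℕ) (hi : i < b) : f i = 0 := by
        by_contra h0
        have := List.rel_of_pairwise_cons hw (hf i h0)
        omega
      rw [List.map_cons, List.prod_cons, ← e]
      set n := max (b + 1) (f.support.sup id + 1) with hn
      have h1 : ∀ i, n ≤ i → f i = 0 := fun i hi => by
        by_contra h0
        have := Finset.le_sup (f := id) (Finsupp.mem_support_iff.mpr h0)
        simp only [id] at this
        omega
      rw [asc_eq_ascTo g h1, mul_ascTo g (by omega) hb, asc_eq_ascTo]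
      intro i hi
      have : b ≠ i := by omega
      simp [h1 i hi, this]

lemma word_mem_span (g : ℕ → A) (h : ∀ a b, b < a →
    g a * g b ∈ Submodule.span ℂ {z | ∃ c d, c < a ∧ z = g c * g d}) (n : ℕ) :
    ∀ (a : ℕ) (w : List ℕ), w.Pairwise (· ≤ ·) → w.length = n →
      g a * (w.map g).prod ∈ Submodule.span ℂ
        {z | ∃ w : List ℕ, w.Pairwise (· ≤ ·) ∧ w.length = n + 1 ∧ z = (w.map g).prod} := by
  induction n with
  | zero =>
    intro a w _ hl
    rw [List.length_eq_zero_iff.mp hl]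
    exact Submodule.subset_span ⟨[a], by simp⟩
  | succ n ih =>
    intro a
    induction a using Nat.strong_induction_on with
    | _ a iha =>
    rintro (_ | ⟨b, w⟩) hw hl
    · simp at hl
    rcases le_or_gt a b with hab | hab
    · refine Submodule.subset_span ⟨a :: b :: w, List.pairwise_cons.mpr ⟨?_, hw⟩, by simp_all, by simp⟩
      rintro c (_ | ⟨_, hc⟩)
      · exact hab
      · exact hab.trans (List.rel_of_pairwise_cons hw hc)
    · rw [List.map_cons, List.prod_cons, ← mul_assoc]
      have := h a b hab
      generalize g a * g b = u at this
      induction this using Submodule.span_induction with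
      | mem u hu =>
        obtain ⟨c, d, hc, rfl⟩ := hu
        rw [mul_assoc]
        have := ih d w hw.of_cons (by simpa using hl)
        generalize g d * (w.map g).prod = v at this
        induction this using Submodule.span_induction with
        | mem v hv =>
          obtain ⟨w', hw', hl', rfl⟩ := hv
          exact iha c hc w' hw' hl'
        | zero => rw [mul_zero]; exact zero_mem _
        | add u v _ _ h1 h2 => rw [mul_add]; exact add_mem h1 h2
        | smul r v _ h => rw [mul_smul_comm]; exact Submodule.smul_mem _ _ h
      | zero => rw [zero_mul]; exact zero_mem _
      | add u v _ _ h1 h2 => rw [add_mul]; exact add_mem h1 h2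
      | smul r v _ h => rw [smul_mul_assoc]; exact Submodule.smul_mem _ _ h

/-- the ordered monomials span if out of order products of two generators can be straightened -/
theorem adjoin_le_span_asc (g : ℕ → A) (h : ∀ a b, b < a →
    g a * g b ∈ Submodule.span ℂ {z | ∃ c d, c < a ∧ z = g c * g d}) :
    (Algebra.adjoin ℂ (Set.range g)).toSubmodule ≤ Submodule.span ℂ (Set.range (asc g)) := by
  have hle : Submodule.span ℂ {z | ∃ w : List ℕ, w.Pairwise (· ≤ ·) ∧ z = (w.map g).prod} ≤
      Submodule.span ℂ (Set.range (asc g)) := by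
    refine Submodule.span_mono ?_
    rintro _ ⟨w, hw, rfl⟩
    obtain ⟨f, -, hf⟩ := exists_asc_eq_word g w hw
    exact ⟨f, hf⟩
  refine le_trans ?_ hle
  have key (u : A) (hu : u ∈ Algebra.adjoin ℂ (Set.range g)) : ∀ v ∈ Submodule.span ℂ
      {z | ∃ w : List ℕ, w.Pairwise (· ≤ ·) ∧ z = (w.map g).prod}, u * v ∈ Submodule.span ℂ
      {z | ∃ w : List ℕ, w.Pairwise (· ≤ ·) ∧ z = (w.map g).prod} := by
    induction hu using Algebra.adjoin_induction with
    | mem u hu =>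
      obtain ⟨a, rfl⟩ := hu
      intro v hv
      induction hv using Submodule.span_induction with
      | mem v hv =>
        obtain ⟨w, hw, rfl⟩ := hv
        refine Submodule.span_mono ?_ (word_mem_span g h _ a w hw rfl)
        rintro _ ⟨w, hw, -, rfl⟩
        exact ⟨w, hw, rfl⟩
      | zero => rw [mul_zero]; exact zero_mem _
      | add u v _ _ h1 h2 => rw [mul_add]; exact add_mem h1 h2
      | smul r v _ h => rw [mul_smul_comm]; exact Submodule.smul_mem _ _ h
    | algebraMap r => intro v hv; rw [← Algebra.smul_def]; exact Submodule.smul_mem _ _ hv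
    | add u v _ _ h1 h2 => intro w hw; rw [add_mul]; exact add_mem (h1 w hw) (h2 w hw)
    | mul u v _ _ h1 h2 => intro w hw; rw [mul_assoc]; exact h1 _ (h2 w hw)
  intro u hu
  rw [← mul_one u]
  exact key u hu 1 (Submodule.subset_span ⟨[], by simp⟩)

end Straightening

namespace QDatum
variable {A : Type} [Ring A] [Algebra ℂ A] {D : QDatum A}
open Submodule (mul_mem_mul)

section Generic

lemma mul_self_mem_span {g : ℕ → A} {a c d : ℕ} (h : c < a) :
    g c * g d ∈ Submodule.span ℂ {z | ∃ c d, c < a ∧ z = g c * g d} :=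
  Submodule.subset_span ⟨c, d, h, rfl⟩

/-- a subalgebra `B` normalised by `t` together with `t` generates `∑ j, B * t ^ j` -/
lemma adjoin_le_mul_powers {B : Subalgebra ℂ A} {t : A} (h : ∀ u ∈ B, t * u - u * t ∈ B)
    {s : Set A} (hs : ∀ u ∈ s, u ∈ B ∨ u - t ∈ B) :
    (Algebra.adjoin ℂ s).toSubmodule ≤
      B.toSubmodule * Submodule.span ℂ (Set.range fun j : ℕ => t ^ j) := by
  set W := B.toSubmodule * Submodule.span ℂ (Set.range fun j : ℕ => t ^ j) with hW
  have pow_mem (u : A) (hu : u ∈ B) (j : ℕ) : u * t ^ j ∈ W :=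
    mul_mem_mul hu (Submodule.subset_span ⟨j, rfl⟩)
  have mulB (u : A) (hu : u ∈ B) (w : A) (hw : w ∈ W) : u * w ∈ W := by
    induction hw using Submodule.mul_induction_on' with
    | mem_mul_mem b hb p hp => rw [← mul_assoc]; exact mul_mem_mul (B.mul_mem hu hb) hp
    | add a _ b _ h1 h2 => rw [mul_add]; exact add_mem h1 h2
  have mult (w : A) (hw : w ∈ W) : t * w ∈ W := by
    induction hw using Submodule.mul_induction_on' with
    | mem_mul_mem b hb p hp =>
      rw [show t * (b * p) = (t * b - b * t) * p + b * (t * p) by noncomm_ring]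
      refine add_mem (mul_mem_mul (h b hb) hp) (mul_mem_mul hb ?_)
      induction hp using Submodule.span_induction with
      | mem p hp =>
        obtain ⟨j, rfl⟩ := hp
        exact Submodule.subset_span ⟨j + 1, pow_succ' t j⟩
      | zero => rw [mul_zero]; exact zero_mem _
      | add u v _ _ h1 h2 => rw [mul_add]; exact add_mem h1 h2
      | smul r v _ h => rw [mul_smul_comm]; exact Submodule.smul_mem _ _ h
    | add a _ b _ h1 h2 => rw [mul_add]; exact add_mem h1 h2
  have key (u : A) (hu : u ∈ Algebra.adjoin ℂ s) : ∀ w ∈ W, u * w ∈ W := by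
    induction hu using Algebra.adjoin_induction with
    | mem u hu =>
      intro w hw
      rcases hs u hu with h | h
      · exact mulB u h w hw
      · rw [← sub_add_cancel u t, add_mul]
        exact add_mem (mulB _ h w hw) (mult w hw)
    | algebraMap r => intro v hv; rw [← Algebra.smul_def]; exact Submodule.smul_mem _ _ hv
    | add u v _ _ h1 h2 => intro w hw; rw [add_mul]; exact add_mem (h1 w hw) (h2 w hw)
    | mul u v _ _ h1 h2 => intro w hw; rw [mul_assoc]; exact h1 _ (h2 w hw)
  intro u hu
  rw [← mul_one u]
  refine key u hu 1 ?_
  have := pow_mem 1 (one_mem B) 0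
  rwa [pow_zero, mul_one] at this

end Generic

variable (hα : D.α = 1)

lemma Y_straighten (n m : ℕ) (h : m < n) :
    D.Y n * D.Y m ∈ Submodule.span ℂ {z | ∃ c d, c < n ∧ z = D.Y c * D.Y d} := by
  have hS {c d : ℕ} (hc : c < n) : D.Y c * D.Y d ∈ Submodule.span ℂ
    {z | ∃ c d, c < n ∧ z = D.Y c * D.Y d} := mul_self_mem_span hc
  generalize Submodule.span ℂ {z | ∃ c d, c < n ∧ z = D.Y c * D.Y d} = V at hS
  rcases Nat.mod_two_eq_zero_or_one (n + m) with h2 | h2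
  · obtain ⟨p, rfl⟩ : ∃ p, n = p + 2 := ⟨n - 2, by omega⟩
    have s : (-1 : ℂ) ^ m = (-1) ^ p := by
      rw [neg_one_pow_eq_pow_mod_two, show m % 2 = p % 2 by omega, ← neg_one_pow_eq_pow_mod_two]
    have e := D.DE s (D.E_eq_zero (n := p) (m := m) (by omega))
    have h1 : D.Y (p + 2) * D.Y m + D.Y (m + 2) * D.Y p ∈ V := by
      rw [show D.Y (p + 2) * D.Y m + D.Y (m + 2) * D.Y p = (D.q - D.α * (-1) ^ p) •
        (D.Y (p + 1) * D.Y (m + 1) + D.Y (m + 1) * D.Y (p + 1)) - (D.q * D.α * (-1) ^ p) •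
          (D.Y p * D.Y (m + 2) + D.Y m * D.Y (p + 2)) by linear_combination (norm := module) e]
      exact sub_mem (V.smul_mem _ (add_mem (hS (by omega)) (hS (by omega))))
        (V.smul_mem _ (add_mem (hS (by omega)) (hS (by omega))))
    rcases eq_or_ne m p with rfl | hmp
    · rw [← two_smul ℂ] at h1
      exact (V.smul_mem_iff two_ne_zero).mp h1
    · exact (V.add_mem_iff_left (hS (by omega))).mp h1
  · obtain ⟨p, rfl⟩ : ∃ p, n = p + 1 := ⟨n - 1, by omega⟩
    have e := D.E_eq_zero (n := p) (m := m) (by omega)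
    rw [E] at e
    have h1 : D.Y (p + 1) * D.Y m + D.Y (m + 1) * D.Y p ∈ V := by
      rw [show D.Y (p + 1) * D.Y m + D.Y (m + 1) * D.Y p = D.q • (D.Y p * D.Y (m + 1)) +
          D.q • (D.Y m * D.Y (p + 1)) by linear_combination (norm := module) e]
      exact add_mem (V.smul_mem _ (hS (by omega))) (V.smul_mem _ (hS (by omega)))
    rcases eq_or_ne m p with rfl | hmp
    · rw [← two_smul ℂ] at h1
      exact (V.smul_mem_iff two_ne_zero).mp h1
    · exact (V.add_mem_iff_left (hS (by omega))).mp h1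

lemma NY_le : D.NY.toSubmodule ≤ Submodule.span ℂ (Set.range (asc D.Y)) :=
  adjoin_le_span_asc _ fun n m h => Y_straighten n m h

/-- the ordered product `⋯ * g 1 ^ f 1 * g 0 ^ f 0` -/
def _root_.desc (g : ℕ → A) (f : ℕ →₀ ℕ) : A :=
  ((List.range (f.support.sup id + 1)).reverse.map fun i => g i ^ f i).prod

lemma unop_asc (g : ℕ → A) (f : ℕ →₀ ℕ) :
    (asc (fun n => MulOpposite.op (g n)) f).unop = desc g f := by
  rw [asc, ascTo, desc, MulOpposite.unop_list_prod, List.map_map, ← List.map_reverse]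
  rfl

lemma NX_le : D.NX.toSubmodule ≤ Submodule.span ℂ (Set.range (desc D.X)) := by
  have h := D.op.NY_le
  have hY : D.op.Y = fun n => MulOpposite.op (D.X n) := funext D.op_Y
  intro u hu
  have hu' : MulOpposite.op u ∈ D.op.NY := by
    replace hu : u ∈ D.NX := hu
    induction hu using Algebra.adjoin_induction with
    | mem u hu =>
      obtain ⟨n, rfl⟩ := hu
      exact Algebra.subset_adjoin ⟨n, D.op_Y n⟩
    | algebraMap r => exact D.op.NY.algebraMap_mem r
    | add u v _ _ h1 h2 => exact add_mem h1 h2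
    | mul u v _ _ h1 h2 => exact mul_mem h2 h1
  have := Submodule.mem_map_of_mem (f := (MulOpposite.opLinearEquiv ℂ (M := A)).symm.toLinearMap) (h hu')
  rw [Submodule.map_span, ← Set.range_comp, hY] at this
  refine Submodule.span_mono ?_ this
  rintro _ ⟨f, rfl⟩
  exact ⟨f, (unop_asc _ _).symm⟩

include hα

lemma HS_le (k : ℕ) : (D.HS k).toSubmodule ≤ Submodule.span ℂ (Set.range (asc D.lM)) *
    Submodule.span ℂ (Set.range fun f => ascTo (fun i => D.a (2 * i + 2)) f k) := by
  induction k with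
  | zero =>
    have h1 : (D.HS 0).toSubmodule ≤ Submodule.span ℂ (Set.range (asc D.lM)) := by
      refine le_trans ?_ (adjoin_le_span_asc D.lM fun m n h => ?_)
      · refine Algebra.adjoin_le ?_
        rintro _ (⟨j, rfl⟩ | ⟨i, hi, rfl⟩)
        · exact Algebra.subset_adjoin ⟨j, rfl⟩
        · obtain rfl : i = 0 := by simpa using hi
          simp only [mul_zero, T_zero]
          exact Subalgebra.smul_mem _ (one_mem _) _
      · obtain ⟨r, s, j, hj, e⟩ := lM_mul_lM hα h
        rw [e]
        exact add_mem (Submodule.smul_mem _ _ (mul_self_mem_span h))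
          (Submodule.smul_mem _ _ (mul_self_mem_span hj))
    intro u hu
    rw [← mul_one u]
    exact mul_mem_mul (h1 hu) (Submodule.subset_span ⟨0, by simp [ascTo]⟩)
  | succ k ih =>
    have h := adjoin_le_mul_powers (B := D.HS k) (t := D.a (2 * k + 2))
      (fun u hu => commutator_a_mem hα k hu)
      (s := Set.range D.lM ∪ (fun i => D.T (2 * i)) '' Set.Iic (k + 1)) (by
        rintro _ (⟨j, rfl⟩ | ⟨i, hi, rfl⟩)
        · exact Or.inl (lM_mem_HS j k)
        · rcases (Nat.le_succ_iff.mp (Set.mem_Iic.mp hi)) with h | rfl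
          · exact Or.inl (T_mem_HS h)
          · refine Or.inr ?_
            rw [← neg_sub]
            exact neg_mem (a_sub_T_mem hα k))
    refine h.trans ((mul_le_mul' ih le_rfl).trans ?_)
    rw [mul_assoc, Submodule.span_mul_span]
    refine mul_le_mul' le_rfl (Submodule.span_mono ?_)
    rintro _ ⟨_, ⟨f, rfl⟩, _, ⟨j, rfl⟩, rfl⟩
    refine ⟨f.update k j, ?_⟩
    simp only [ascTo_succ]
    rw [ascTo_congr (f' := f)]
    · simp
    · intro i hi
      simp [hi.ne]

lemma HT_le : D.HT.toSubmodule ≤ Submodule.span ℂ (Set.range (asc D.lM)) *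
    Submodule.span ℂ (Set.range (asc fun i => D.a (2 * i + 2))) := by
  have h (k : ℕ) : (D.HS k).toSubmodule ≤ Submodule.span ℂ (Set.range (asc D.lM)) *
    Submodule.span ℂ (Set.range (asc fun i => D.a (2 * i + 2))) := by
    refine (HS_le hα k).trans (mul_le_mul' le_rfl (Submodule.span_mono ?_))
    rintro _ ⟨f, rfl⟩
    refine ⟨f.filter (· < k), ?_⟩
    rw [asc_eq_ascTo (n := k) _ fun i hi => by simp [hi]]
    exact ascTo_congr fun i hi => by simp [hi]
  have h2 (u : A) (hu : u ∈ D.HT) : ∃ k, u ∈ D.HS k := by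
    induction hu using Algebra.adjoin_induction with
    | mem u hu =>
      rcases hu with ⟨j, rfl⟩ | ⟨i, rfl⟩
      · exact ⟨0, lM_mem_HS j 0⟩
      · exact ⟨i, T_mem_HS le_rfl⟩
    | algebraMap r => exact ⟨0, Subalgebra.algebraMap_mem _ r⟩
    | add u v _ _ h1 h2 =>
      obtain ⟨k, hk⟩ := h1
      obtain ⟨k', hk'⟩ := h2
      exact ⟨max k k', add_mem (HS_mono (le_max_left _ _) hk) (HS_mono (le_max_right _ _) hk')⟩
    | mul u v _ _ h1 h2 =>
      obtain ⟨k, hk⟩ := h1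
      obtain ⟨k', hk'⟩ := h2
      exact ⟨max k k', mul_mem (HS_mono (le_max_left _ _) hk) (HS_mono (le_max_right _ _) hk')⟩
  intro u hu
  obtain ⟨k, hk⟩ := h2 u hu
  exact h k hk

theorem span_monomials (hgen : Algebra.adjoin ℂ {D.x, D.y} = ⊤) :
    Submodule.span ℂ (Set.range fun t : (ℕ →₀ ℕ) × (ℕ →₀ ℕ) × (ℕ →₀ ℕ) × (ℕ →₀ ℕ) =>
      asc D.Y t.1 * asc D.lM t.2.1 * asc (fun i => D.a (2 * i + 2)) t.2.2.1 * desc D.X t.2.2.2)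
      = ⊤ := by
  rw [eq_top_iff, ← triangular hα hgen]
  refine (mul_le_mul' (mul_le_mul' NY_le (HT_le hα)) NX_le).trans ?_
  rw [Submodule.span_mul_span, Submodule.span_mul_span, Submodule.span_mul_span]
  refine Submodule.span_mono ?_
  rintro _ ⟨_, ⟨_, ⟨a, rfl⟩, _, ⟨_, ⟨b, rfl⟩, _, ⟨c, rfl⟩, rfl⟩, rfl⟩, _, ⟨d, rfl⟩, rfl⟩
  exact ⟨(a, b, c, d), by simp only [mul_assoc]⟩

end QDatum

section Connection
variable {q : ℂ}

lemma π_serre1 (q : ℂ) : π q (serre1 q) = 0 := by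
  rw [π, ← map_zero (RingQuot.mkAlgHom ℂ (Rel q))]
  exact RingQuot.mkAlgHom_rel ℂ Rel.one

lemma π_serre2 (q : ℂ) : π q (serre2 q) = 0 := by
  rw [π, ← map_zero (RingQuot.mkAlgHom ℂ (Rel q))]
  exact RingQuot.mkAlgHom_rel ℂ Rel.two

/-- the generators of `U q` form a datum -/
def uDatum (hq0 : q ≠ 0) (hq : NotRootOfUnity q) : QDatum (U q) where
  q := q
  α := 1
  x := π q x1
  y := π q x2
  q_ne := hq0
  not_root := hq
  sign := Or.inl rfl
  serreX := by
    have h := π_serre1 q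
    simp only [serre1, X2F, L1F, map_sub, map_mul, map_smul] at h
    simpa only [one_smul] using sub_eq_zero.mp h
  serreY := by
    have h := π_serre2 q
    simp only [serre2, Y2F, L1F, map_sub, map_mul, map_smul, map_add] at h
    simpa only [one_smul] using sub_eq_zero.mp h

variable (hq0 : q ≠ 0) (hq : NotRootOfUnity q)

lemma uDatum_l : (uDatum hq0 hq).l = L1U q := rfl

lemma uDatum_Y (n : ℕ) : (uDatum hq0 hq).Y n = Y q (n + 1) := by
  induction n with
  | zero => rfl
  | succ n ih =>
    rw [QDatum.Y_succ, ih, uDatum_l, Y, pow_succ]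
    change _ + ((1 : ℂ) * _) • _ = _
    module

lemma uDatum_X (n : ℕ) : (uDatum hq0 hq).X n = QAff.X q (n + 1) := by
  induction n with
  | zero => rfl
  | succ n ih =>
    rw [QDatum.X_succ, ih, uDatum_l, QAff.X]
    change _ - ((1 : ℂ) * _) • _ = _
    rw [one_mul]

lemma uDatum_a (n : ℕ) : (uDatum hq0 hq).a n = L q n := by
  cases n with
  | zero => rfl
  | succ n =>
    rw [QDatum.a_succ, QDatum.e, uDatum_X, uDatum_Y, L]
    congr 2
    simp only [QDatum.k, uDatum]
    ring

lemma uDatum_lM (n : ℕ) : (uDatum hq0 hq).lM n = M q n := by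
  set D := uDatum hq0 hq
  induction n with
  | zero =>
    rw [M, ← uDatum_a hq0 hq, QDatum.a_succ, QDatum.e_zero]
    rfl
  | succ n ih =>
    have hl (n : ℕ) : D.l * D.l * D.lM n - D.lM n * (D.l * D.l) = 0 := by
      induction n with
      | zero => rw [show D.lM 0 = D.l from rfl]; noncomm_ring
      | succ n ih =>
        have h := D.sq_N
        rw [QDatum.lM_succ]
        linear_combination (norm := skip) h * D.lM n - D.lM n * h + D.N * ih - ih * D.N
        simp only [mul_sub, sub_mul, mul_assoc, mul_zero, zero_mul]
        abel
    have e : D.a 2 = D.N + D.l * D.l := by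
      rw [QDatum.a_succ, QDatum.N_eq, show D.α = 1 from rfl, one_smul, sub_add_cancel]
    rw [M, ← ih, ← uDatum_a hq0 hq, QDatum.lM_succ]
    change _ = D.a 2 * _ - _ * D.a 2
    rw [e]
    linear_combination (norm := noncomm_ring) - hl n

lemma adjoin_π : Algebra.adjoin ℂ {π q x1, π q x2} = ⊤ := by
  have h : Algebra.adjoin ℂ (Set.range (FreeAlgebra.ι ℂ : Fin 2 → F)) = ⊤ :=
    FreeAlgebra.adjoin_range_ι ..
  have hs : Function.Surjective (π q) := RingQuot.mkAlgHom_surjective ℂ (Rel q)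
  have := congrArg (Subalgebra.map (π q)) h
  rw [AlgHom.map_adjoin, Algebra.map_top, (AlgHom.range_eq_top _).mpr hs, ← Set.range_comp] at this
  rw [← this]
  congr 1
  ext z
  simp [Fin.exists_fin_two, x1, x2, eq_comm]

include hq0 hq in
theorem span_pbwMonomial : Submodule.span ℂ (Set.range (pbwMonomial q)) = ⊤ := by
  rw [← (uDatum hq0 hq).span_monomials rfl adjoin_π]
  congr 2
  funext t
  simp only [uDatum_a, funext (uDatum_Y hq0 hq), funext (uDatum_X hq0 hq), funext (uDatum_lM hq0 hq)]
  rfl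

end Connection

namespace Indep

/-- the action of a generator on sequences, deforming left multiplication -/
def Psi1 (q : ℂ) : Module.End ℂ (ℕ → F) where
  toFun G k :=
    match k % 4 with
    | 0 => G (k + 1) + x1 * G k
    | 1 => G (k + 1) + q⁻¹ • (x1 * G k)
    | 2 => (q⁻¹ * q⁻¹) • (x1 * G k)
    | _ => q⁻¹ • (x1 * G k)
  map_add' G H := by
    funext k
    simp only [Pi.add_apply, mul_add, smul_add]
    split <;> first | rfl | abel
  map_smul' r G := by
    funext k
    simp only [Pi.smul_apply, mul_smul_comm, RingHom.id_apply]
    split <;> simp only [smul_add, smul_comm r]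

/-- the action of the second generator -/
def Psi2 (q : ℂ) : Module.End ℂ (ℕ → F) where
  toFun G k :=
    match k % 4 with
    | 0 => x2 * G k
    | 1 => q • (x2 * G k)
    | 2 => G (k + 1) + (q * q) • (x2 * G k)
    | _ => G (k + 1) - q • (x2 * G k)
  map_add' G H := by
    funext k
    simp only [Pi.add_apply, mul_add, smul_add]
    split <;> first | rfl | abel
  map_smul' r G := by
    funext k
    simp only [Pi.smul_apply, mul_smul_comm, RingHom.id_apply]
    split <;> simp only [smul_add, smul_sub, smul_comm r]

/-- the algebra action of the free algebra on sequences; it is compatible with the Serre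
relations, see `Psi_serre1` and `Psi_serre2` -/
def Psi (q : ℂ) : F →ₐ[ℂ] Module.End ℂ (ℕ → F) := FreeAlgebra.lift ℂ ![Psi1 q, Psi2 q]

lemma Psi_x1 (q : ℂ) : Psi q x1 = Psi1 q := by simp [Psi, x1]
lemma Psi_x2 (q : ℂ) : Psi q x2 = Psi2 q := by simp [Psi, x2]

section
variable (q : ℂ) (G : ℕ → F) (m : ℕ)

lemma Psi1_zero : Psi1 q G (4 * m) = G (4 * m + 1) + x1 * G (4 * m) := by
  simp [Psi1]
lemma Psi1_one : Psi1 q G (4 * m + 1) = G (4 * m + 2) + q⁻¹ • (x1 * G (4 * m + 1)) := by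
  simp [Psi1, show (4 * m + 1) % 4 = 1 by omega]
lemma Psi1_two : Psi1 q G (4 * m + 2) = (q⁻¹ * q⁻¹) • (x1 * G (4 * m + 2)) := by
  simp [Psi1, show (4 * m + 2) % 4 = 2 by omega]
lemma Psi1_three : Psi1 q G (4 * m + 3) = q⁻¹ • (x1 * G (4 * m + 3)) := by
  simp [Psi1, show (4 * m + 3) % 4 = 3 by omega]
lemma Psi2_zero : Psi2 q G (4 * m) = x2 * G (4 * m) := by
  simp [Psi2]
lemma Psi2_one : Psi2 q G (4 * m + 1) = q • (x2 * G (4 * m + 1)) := by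
  simp [Psi2, show (4 * m + 1) % 4 = 1 by omega]
lemma Psi2_two : Psi2 q G (4 * m + 2) = G (4 * m + 3) + (q * q) • (x2 * G (4 * m + 2)) := by
  simp [Psi2, show (4 * m + 2) % 4 = 2 by omega]
lemma Psi2_three : Psi2 q G (4 * m + 3) = G (4 * (m + 1)) - q • (x2 * G (4 * m + 3)) := by
  simp [Psi2, show (4 * m + 3) % 4 = 3 by omega, mul_add]
end

lemma exists_four (k : ℕ) : ∃ m, k = 4 * m ∨ k = 4 * m + 1 ∨ k = 4 * m + 2 ∨ k = 4 * m + 3 :=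
  ⟨k / 4, by omega⟩

lemma Psi_serre1 {q : ℂ} (hq0 : q ≠ 0) (G : ℕ → F) (k : ℕ) :
    ∃ c : ℂ, Psi q (serre1 q) G k = c • (serre1 q * G k) := by
  obtain ⟨m, rfl | rfl | rfl | rfl⟩ := exists_four k
  on_goal 1 => use 1
  on_goal 2 => use q⁻¹ * q⁻¹
  on_goal 3 => use (q⁻¹) ^ 4
  on_goal 4 => use -(q⁻¹ * q⁻¹)
  all_goals
    simp only [serre1, X2F, L1F, map_sub, map_mul, map_smul, Psi_x1, Psi_x2, LinearMap.sub_apply,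
      LinearMap.smul_apply, Module.End.mul_apply, Pi.sub_apply, Pi.smul_apply, Psi1_zero, Psi1_one,
      Psi1_two, Psi1_three, Psi2_zero, Psi2_one, Psi2_two, Psi2_three]
    simp only [mul_add, add_mul, mul_sub, sub_mul, smul_add, smul_sub, mul_smul_comm, smul_mul_assoc,
      smul_smul, mul_assoc]
    match_scalars <;> field_simp <;> ring

lemma Psi_serre2 {q : ℂ} (hq0 : q ≠ 0) (G : ℕ → F) (k : ℕ) :
    ∃ c : ℂ, Psi q (serre2 q) G k = c • (serre2 q * G k) := by
  obtain ⟨m, rfl | rfl | rfl | rfl⟩ := exists_four k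
  on_goal 1 => use 1
  on_goal 2 => use q ^ 2
  on_goal 3 => use q ^ 4
  on_goal 4 => use -(q ^ 2)
  all_goals
    simp only [serre2, Y2F, L1F, map_sub, map_add, map_mul, map_smul, Psi_x1, Psi_x2, LinearMap.sub_apply,
      LinearMap.add_apply, Pi.add_apply,
      LinearMap.smul_apply, Module.End.mul_apply, Pi.sub_apply, Pi.smul_apply, Psi1_zero, Psi1_one,
      Psi1_two, Psi1_three, Psi2_zero, Psi2_one, Psi2_two, Psi2_three]
    simp only [mul_add, add_mul, mul_sub, sub_mul, smul_add, smul_sub, mul_smul_comm, smul_mul_assoc,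
      smul_smul, mul_assoc]
    match_scalars <;> field_simp <;> ring

/-- the homogeneous elements of total degree `n` -/
def Hom (n : ℕ) : Submodule ℂ F := Submodule.span ℂ {x1, x2} ^ n

lemma x1_mem : x1 ∈ Hom 1 := by
  rw [Hom, pow_one]; exact Submodule.subset_span (by simp)

lemma x2_mem : x2 ∈ Hom 1 := by
  rw [Hom, pow_one]; exact Submodule.subset_span (by simp)

lemma one_mem_Hom : (1 : F) ∈ Hom 0 := by
  rw [Hom, pow_zero]; exact Submodule.one_le.mp le_rfl

lemma mul_mem_Hom {u v : F} {m n : ℕ} (hu : u ∈ Hom m) (hv : v ∈ Hom n) : u * v ∈ Hom (m + n) := by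
  rw [Hom, pow_add]; exact Submodule.mul_mem_mul hu hv

lemma pow_mem_Hom {u : F} {m : ℕ} (hu : u ∈ Hom m) (n : ℕ) : u ^ n ∈ Hom (n * m) := by
  induction n with
  | zero => simpa using one_mem_Hom
  | succ n ih => rw [pow_succ, Nat.succ_mul]; exact mul_mem_Hom ih hu

instance (n : ℕ) : FiniteDimensional ℂ (Hom n) := by
  refine Module.Finite.of_fg (Submodule.FG.pow ?_ n)
  exact Submodule.fg_span (by simp)

lemma serre1_mem (q : ℂ) : serre1 q ∈ Hom 4 := by
  have h1 : L1F q ∈ Hom 2 := sub_mem (mul_mem_Hom x1_mem x2_mem)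
    (Submodule.smul_mem _ _ (mul_mem_Hom x2_mem x1_mem))
  have h2 : X2F q ∈ Hom 3 := sub_mem (mul_mem_Hom x1_mem h1) (mul_mem_Hom h1 x1_mem)
  exact sub_mem (mul_mem_Hom x1_mem h2) (Submodule.smul_mem _ _ (mul_mem_Hom h2 x1_mem))

lemma serre2_mem (q : ℂ) : serre2 q ∈ Hom 4 := by
  have h1 : L1F q ∈ Hom 2 := sub_mem (mul_mem_Hom x1_mem x2_mem)
    (Submodule.smul_mem _ _ (mul_mem_Hom x2_mem x1_mem))
  have h2 : Y2F q ∈ Hom 3 := add_mem (mul_mem_Hom h1 x2_mem) (mul_mem_Hom x2_mem h1)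
  exact sub_mem (mul_mem_Hom h2 x2_mem) (Submodule.smul_mem _ _ (mul_mem_Hom x2_mem h2))

/-- the grading as a coaction -/
def gr : F →ₐ[ℂ] Polynomial F :=
  FreeAlgebra.lift ℂ fun i => Polynomial.monomial 1 (FreeAlgebra.ι ℂ i)

lemma gr_of_mem {u : F} {n : ℕ} (hu : u ∈ Hom n) : gr u = Polynomial.monomial n u := by
  induction hu using Submodule.pow_induction_on_left' with
  | algebraMap r =>
    rw [AlgHom.commutes]; rfl
  | add u v i _ _ h1 h2 => rw [map_add, h1, h2, map_add]
  | mem_mul u hu i v _ h =>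
    have : gr u = Polynomial.monomial 1 u := by
      refine Submodule.span_induction (p := fun u _ => gr u = Polynomial.monomial 1 u)
        ?_ ?_ ?_ ?_ hu
      · rintro _ (rfl | rfl)
        · simp [gr, x1]
        · simp [gr, x2]
      · simp
      · intro u v _ _ h1 h2; rw [map_add, h1, h2, map_add]
      · intro r u _ h; rw [map_smul, h, Polynomial.smul_monomial]
    rw [map_mul, this, h, Polynomial.monomial_mul_monomial, add_comm]

/-- the projection to degree `n` -/
def proj (n : ℕ) : F →ₗ[ℂ] F := ((Polynomial.lcoeff F n).restrictScalars ℂ).comp gr.toLinearMap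

lemma proj_of_mem {u : F} {m : ℕ} (n : ℕ) (hu : u ∈ Hom m) : proj n u = if m = n then u else 0 := by
  change (gr u).coeff n = _
  rw [gr_of_mem hu, Polynomial.coeff_monomial]

/-- the degree `n` consequences of the Serre relations -/
def relSet (q : ℂ) (n : ℕ) : Set F :=
  {u | ∃ i j a b s, i + 4 + j = n ∧ a ∈ Hom i ∧ b ∈ Hom j ∧ (s = serre1 ∨ s = serre2) ∧
    u = a * s q * b}

lemma relSet_subset (q : ℂ) (n : ℕ) : relSet q n ⊆ Hom n := by
  rintro _ ⟨i, j, a, b, s, rfl, ha, hb, rfl | rfl, rfl⟩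
  · exact mul_mem_Hom (mul_mem_Hom ha (serre1_mem q)) hb
  · exact mul_mem_Hom (mul_mem_Hom ha (serre2_mem q)) hb

/-- the ideal generated by the Serre relations -/
def J (q : ℂ) : Submodule ℂ F := Submodule.span ℂ (⋃ n, relSet q n)

lemma proj_J {q : ℂ} {u : F} (hu : u ∈ J q) (n : ℕ) : proj n u ∈ Submodule.span ℂ (relSet q n) := by
  induction hu using Submodule.span_induction with
  | mem u hu =>
    obtain ⟨m, hm⟩ := Set.mem_iUnion.mp hu
    rw [proj_of_mem n (relSet_subset q m hm)]
    split_ifs with h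
    · subst h; exact Submodule.subset_span hm
    · exact zero_mem _
  | zero => rw [map_zero]; exact zero_mem _
  | add u v _ _ h1 h2 => rw [map_add]; exact add_mem h1 h2
  | smul r u _ h => rw [map_smul]; exact Submodule.smul_mem _ _ h

lemma gen_mem (i : Fin 2) : FreeAlgebra.ι ℂ i ∈ Hom 1 := by
  fin_cases i
  exacts [x1_mem, x2_mem]

lemma mul_mem_J {q : ℂ} (v : F) : ∀ u ∈ J q, v * u ∈ J q ∧ u * v ∈ J q := by
  induction v using FreeAlgebra.induction with
  | grade0 r =>
    intro u hu
    rw [← Algebra.smul_def, ← Algebra.commutes, ← Algebra.smul_def]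
    exact ⟨Submodule.smul_mem _ _ hu, Submodule.smul_mem _ _ hu⟩
  | add v w h1 h2 =>
    intro u hu
    rw [add_mul, mul_add]
    exact ⟨add_mem (h1 u hu).1 (h2 u hu).1, add_mem (h1 u hu).2 (h2 u hu).2⟩
  | mul v w h1 h2 =>
    intro u hu
    refine ⟨?_, ?_⟩
    · rw [mul_assoc]; exact (h1 _ (h2 u hu).1).1
    · rw [← mul_assoc]; exact (h2 _ (h1 u hu).2).2
  | grade1 k =>
    intro u hu
    induction hu using Submodule.span_induction with
    | mem u hu =>
      obtain ⟨_, ⟨i, j, a, b, s, rfl, ha, hb, hs, rfl⟩⟩ := Set.mem_iUnion.mp hu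
      exact ⟨Submodule.subset_span (Set.mem_iUnion.mpr ⟨_, _, j, _, b, s, rfl,
          mul_mem_Hom (gen_mem k) ha, hb, hs, by simp only [mul_assoc]⟩),
        Submodule.subset_span (Set.mem_iUnion.mpr ⟨_, i, _, a, _, s, rfl, ha,
          mul_mem_Hom hb (gen_mem k), hs, by simp only [mul_assoc]⟩)⟩
    | zero => rw [mul_zero, zero_mul]; exact ⟨zero_mem _, zero_mem _⟩
    | add u v _ _ h1 h2 =>
      rw [mul_add, add_mul]; exact ⟨add_mem h1.1 h2.1, add_mem h1.2 h2.2⟩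
    | smul r u _ h =>
      rw [mul_smul_comm, smul_mul_assoc]
      exact ⟨Submodule.smul_mem _ _ h.1, Submodule.smul_mem _ _ h.2⟩

lemma serre_mem_J (q : ℂ) {s : ℂ → F} (hs : s = serre1 ∨ s = serre2) : s q ∈ J q :=
  Submodule.subset_span (Set.mem_iUnion.mpr
    ⟨4, 0, 0, 1, 1, s, rfl, one_mem_Hom, one_mem_Hom, hs, by simp⟩)

/-- left multiplication on the quotient by `J q` -/
def act (q : ℂ) : F →ₐ[ℂ] Module.End ℂ (F ⧸ J q) :=
  FreeAlgebra.lift ℂ fun i => (J q).mapQ (J q) (LinearMap.mulLeft ℂ (FreeAlgebra.ι ℂ i))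
    fun u hu => (mul_mem_J _ u hu).1

lemma act_mk (q : ℂ) (u : F) : ∀ v, act q u ((J q).mkQ v) = (J q).mkQ (u * v) := by
  induction u using FreeAlgebra.induction with
  | grade0 r => intro v; rw [AlgHom.commutes, ← Algebra.smul_def, map_smul]; rfl
  | add u w h1 h2 => intro v; rw [map_add, LinearMap.add_apply, h1, h2, add_mul, map_add]
  | mul u w h1 h2 => intro v; rw [map_mul, Module.End.mul_apply, h2, h1, mul_assoc]
  | grade1 k => intro v; rw [act, FreeAlgebra.lift_ι_apply]; rfl

lemma act_serre (q : ℂ) {s : ℂ → F} (hs : s = serre1 ∨ s = serre2) : act q (s q) = 0 := by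
  refine LinearMap.ext fun v => ?_
  obtain ⟨v, rfl⟩ := Submodule.mkQ_surjective _ v
  rw [act_mk, LinearMap.zero_apply, Submodule.mkQ_apply, Submodule.Quotient.mk_eq_zero]
  exact (mul_mem_J _ _ (serre_mem_J q hs)).2

lemma mem_J_of_π_eq_zero {q : ℂ} {u : F} (h : π q u = 0) : u ∈ J q := by
  have hr : ∀ ⦃a b : F⦄, Rel q a b → act q a = act q b := by
    rintro _ _ (_ | _)
    · rw [act_serre q (Or.inl rfl), map_zero]
    · rw [act_serre q (Or.inr rfl), map_zero]
  have : act q u = 0 := by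
    rw [← RingQuot.liftAlgHom_mkAlgHom_apply ℂ (act q) hr u]
    change RingQuot.liftAlgHom ℂ _ (π q u) = 0
    rw [h, map_zero]
  have := congrArg (fun f => f ((J q).mkQ 1)) this
  rwa [act_mk, mul_one, LinearMap.zero_apply, Submodule.mkQ_apply,
    Submodule.Quotient.mk_eq_zero] at this

lemma Psi_mem_J (q : ℂ) (u : F) : ∀ G : ℕ → F, (∀ k, G k ∈ J q) → ∀ k, Psi q u G k ∈ J q := by
  induction u using FreeAlgebra.induction with
  | grade0 r =>
    intro G hG k
    rw [AlgHom.commutes]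
    exact Submodule.smul_mem _ _ (hG k)
  | add u w h1 h2 => intro G hG k; rw [map_add]; exact add_mem (h1 G hG k) (h2 G hG k)
  | mul u w h1 h2 =>
    intro G hG k; rw [map_mul, Module.End.mul_apply]; exact h1 _ (h2 G hG) k
  | grade1 i =>
    intro G hG k
    have h (u : F) (k : ℕ) : u * G k ∈ J q := (mul_mem_J u _ (hG k)).1
    obtain ⟨m, hm⟩ := exists_four k
    fin_cases i
    · change Psi q x1 G k ∈ _
      rw [Psi_x1]
      rcases hm with rfl | rfl | rfl | rfl
      · rw [Psi1_zero]; exact add_mem (hG _) (h _ _)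
      · rw [Psi1_one]; exact add_mem (hG _) (Submodule.smul_mem _ _ (h _ _))
      · rw [Psi1_two]; exact Submodule.smul_mem _ _ (h _ _)
      · rw [Psi1_three]; exact Submodule.smul_mem _ _ (h _ _)
    · change Psi q x2 G k ∈ _
      rw [Psi_x2]
      rcases hm with rfl | rfl | rfl | rfl
      · rw [Psi2_zero]; exact h _ _
      · rw [Psi2_one]; exact Submodule.smul_mem _ _ (h _ _)
      · rw [Psi2_two]; exact add_mem (hG _) (Submodule.smul_mem _ _ (h _ _))
      · rw [Psi2_three]; exact sub_mem (hG _) (Submodule.smul_mem _ _ (h _ _))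

lemma Psi_J {q : ℂ} (hq0 : q ≠ 0) {u : F} (hu : u ∈ J q) (G : ℕ → F) (k : ℕ) :
    Psi q u G k ∈ J q := by
  induction hu using Submodule.span_induction with
  | mem u hu =>
    obtain ⟨_, ⟨i, j, a, b, s, rfl, ha, hb, hs, rfl⟩⟩ := Set.mem_iUnion.mp hu
    rw [map_mul, map_mul, Module.End.mul_apply, Module.End.mul_apply]
    refine Psi_mem_J q a _ (fun k => ?_) k
    have : ∃ c : ℂ, Psi q (s q) (Psi q b G) k = c • (s q * Psi q b G k) := by
      rcases hs with rfl | rfl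
      · exact Psi_serre1 hq0 _ k
      · exact Psi_serre2 hq0 _ k
    obtain ⟨c, hc⟩ := this
    rw [hc]
    exact Submodule.smul_mem _ _ (mul_mem_J _ _ (serre_mem_J q hs)).2
  | zero => rw [map_zero]; exact zero_mem _
  | add u v _ _ h1 h2 => rw [map_add]; exact add_mem h1 h2
  | smul r u _ h => rw [map_smul]; exact Submodule.smul_mem _ _ h

/-- the sequence with value `1` at `e` -/
def delta (e : ℕ) : ℕ → F := fun j => if j = e then 1 else 0

/-- the derivation-like operator removing the segment from `s.1` to `s.2` -/
def rem (q : ℂ) (s : ℕ × ℕ) : F →ₗ[ℂ] F :=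
  (LinearMap.proj s.1).comp ((LinearMap.applyₗ (delta s.2)).comp (Psi q).toLinearMap)

lemma rem_apply (q : ℂ) (s : ℕ × ℕ) (u : F) : rem q s u = Psi q u (delta s.2) s.1 := rfl

lemma rem_J {q : ℂ} (hq0 : q ≠ 0) (s : ℕ × ℕ) {u : F} (hu : u ∈ J q) : rem q s u ∈ J q :=
  Psi_J hq0 hu _ _

/-- the composite of the operators `rem` followed by the augmentation -/
def pair (q : ℂ) : List (ℕ × ℕ) → F →ₗ[ℂ] ℂ
  | [] => (FreeAlgebra.algebraMapInv : F →ₐ[ℂ] ℂ).toLinearMap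
  | s :: l => (pair q l).comp (rem q s)

lemma aug_eq_zero_of_mem {u : F} {n : ℕ} (hu : u ∈ Hom n) (hn : n ≠ 0) :
    (FreeAlgebra.algebraMapInv : F →ₐ[ℂ] ℂ) u = 0 := by
  obtain ⟨n, rfl⟩ := Nat.exists_eq_succ_of_ne_zero hn
  rw [Hom, Nat.succ_eq_add_one, pow_succ] at hu
  induction hu using Submodule.mul_induction_on' with
  | mem_mul_mem u _ v hv =>
    rw [map_mul]
    suffices (FreeAlgebra.algebraMapInv : F →ₐ[ℂ] ℂ) v = 0 by rw [this, mul_zero]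
    refine Submodule.span_induction (p := fun v _ => (FreeAlgebra.algebraMapInv : F →ₐ[ℂ] ℂ) v = 0)
        ?_ ?_ ?_ ?_ hv
    · rintro _ (rfl | rfl) <;> simp [FreeAlgebra.algebraMapInv, x1, x2]
    · simp
    · intro u v _ _ h1 h2; rw [map_add, h1, h2, add_zero]
    · intro r u _ h; rw [map_smul, h, smul_zero]
  | add u _ v _ h1 h2 => rw [map_add, h1, h2, add_zero]

lemma pair_J {q : ℂ} (hq0 : q ≠ 0) (l : List (ℕ × ℕ)) : ∀ u ∈ J q, pair q l u = 0 := by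
  induction l with
  | nil =>
    intro u hu
    induction hu using Submodule.span_induction with
    | mem u hu =>
      obtain ⟨n, hn⟩ := Set.mem_iUnion.mp hu
      refine aug_eq_zero_of_mem (relSet_subset q n hn) ?_
      obtain ⟨i, j, _, _, _, rfl, _⟩ := hn
      omega
    | zero => rw [map_zero]
    | add u v _ _ h1 h2 => rw [map_add, h1, h2, add_zero]
    | smul r u _ h => rw [map_smul, h, smul_zero]
  | cons s l ih => intro u hu; exact ih _ (rem_J hq0 s hu)

/-- lift of `Y_{n+1}` to the free algebra -/
def YF (q : ℂ) : ℕ → F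
  | 0 => x2
  | n + 1 => L1F q * YF q n - ((-1 : ℂ) ^ (n + 1)) • (YF q n * L1F q)

/-- lift of `X_{n+1}` to the free algebra -/
def XF (q : ℂ) : ℕ → F
  | 0 => x1
  | n + 1 => XF q n * L1F q - ((-1 : ℂ) ^ n) • (L1F q * XF q n)

/-- lift of `L_{n+1}` to the free algebra -/
def LF (q : ℂ) (n : ℕ) : F := x1 * YF q n - q⁻¹ • (YF q n * x1)

/-- lift of `M_{2n+1}` to the free algebra -/
def MF (q : ℂ) : ℕ → F
  | 0 => LF q 0
  | n + 1 => LF q 1 * MF q n - MF q n * LF q 1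

lemma π_L1F (q : ℂ) : π q (L1F q) = L1U q := by simp [L1F, L1U]

lemma π_YF (q : ℂ) (n : ℕ) : π q (YF q n) = Y q (n + 1) := by
  induction n with
  | zero => rfl
  | succ n ih => simp [YF, Y, ih, π_L1F]

lemma π_XF (q : ℂ) (n : ℕ) : π q (XF q n) = QAff.X q (n + 1) := by
  induction n with
  | zero => rfl
  | succ n ih => simp [XF, QAff.X, ih, π_L1F]

lemma π_LF (q : ℂ) (n : ℕ) : π q (LF q n) = L q (n + 1) := by
  simp [LF, L, π_YF, QAff.X]

lemma π_MF (q : ℂ) (n : ℕ) : π q (MF q n) = M q n := by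
  induction n with
  | zero => simp [MF, M, π_LF]
  | succ n ih => simp [MF, M, ih, π_LF]

lemma L1F_mem (q : ℂ) : L1F q ∈ Hom 2 :=
  sub_mem (mul_mem_Hom x1_mem x2_mem) (Submodule.smul_mem _ _ (mul_mem_Hom x2_mem x1_mem))

lemma YF_mem (q : ℂ) (n : ℕ) : YF q n ∈ Hom (2 * n + 1) := by
  induction n with
  | zero => exact x2_mem
  | succ n ih =>
    have h := mul_mem_Hom ih (L1F_mem q)
    have h' := mul_mem_Hom (L1F_mem q) ih
    rw [show 2 + (2 * n + 1) = 2 * n + 1 + 2 by ring] at h'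
    exact sub_mem h' (Submodule.smul_mem _ _ h)

lemma XF_mem (q : ℂ) (n : ℕ) : XF q n ∈ Hom (2 * n + 1) := by
  induction n with
  | zero => exact x1_mem
  | succ n ih =>
    have h := mul_mem_Hom ih (L1F_mem q)
    have h' := mul_mem_Hom (L1F_mem q) ih
    rw [show 2 + (2 * n + 1) = 2 * n + 1 + 2 by ring] at h'
    exact sub_mem h (Submodule.smul_mem _ _ h')

lemma LF_mem (q : ℂ) (n : ℕ) : LF q n ∈ Hom (2 * n + 2) := by
  have h := mul_mem_Hom (YF_mem q n) x1_mem
  have h' := mul_mem_Hom x1_mem (YF_mem q n)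
  rw [show 1 + (2 * n + 1) = 2 * n + 1 + 1 by ring] at h'
  exact sub_mem h' (Submodule.smul_mem _ _ h)

lemma MF_mem (q : ℂ) (n : ℕ) : MF q n ∈ Hom (4 * n + 2) := by
  induction n with
  | zero => exact LF_mem q 0
  | succ n ih =>
    have h := mul_mem_Hom ih (LF_mem q 1)
    have h' := mul_mem_Hom (LF_mem q 1) ih
    rw [show 2 * 1 + 2 + (4 * n + 2) = 4 * n + 2 + (2 * 1 + 2) by ring] at h'
    exact sub_mem h' h

/-- the index set of the monomials -/
abbrev Quad : Type := (ℕ →₀ ℕ) × (ℕ →₀ ℕ) × (ℕ →₀ ℕ) × (ℕ →₀ ℕ)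

/-- lift of the PBW monomial to the free algebra -/
def mono (q : ℂ) (t : Quad) : F :=
  asc (YF q) t.1 * asc (MF q) t.2.1 * asc (fun i => LF q (2 * i + 1)) t.2.2.1 *
    desc (XF q) t.2.2.2

lemma map_asc {A B : Type} [Ring A] [Algebra ℂ A] [Ring B] [Algebra ℂ B] (φ : A →ₐ[ℂ] B)
    (g : ℕ → A) (f : ℕ →₀ ℕ) : φ (asc g f) = asc (fun n => φ (g n)) f := by
  simp [asc, ascTo, map_list_prod, Function.comp_def]

lemma map_desc {A B : Type} [Ring A] [Algebra ℂ A] [Ring B] [Algebra ℂ B] (φ : A →ₐ[ℂ] B)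
    (g : ℕ → A) (f : ℕ →₀ ℕ) : φ (desc g f) = desc (fun n => φ (g n)) f := by
  simp [desc, map_list_prod, Function.comp_def]

lemma π_mono (q : ℂ) (t : Quad) : π q (mono q t) = pbwMonomial q t := by
  simp only [mono, map_mul, map_asc, map_desc, π_YF, π_XF, π_LF, π_MF]
  rfl

/-- the total degree of a monomial in generators of degrees `d` -/
def wt (d : ℕ → ℕ) (f : ℕ →₀ ℕ) : ℕ :=
  ((List.range (f.support.sup id + 1)).map fun i => f i * d i).sum

lemma list_prod_mem {g : ℕ → F} {d : ℕ → ℕ} (h : ∀ n, g n ∈ Hom (d n)) (f : ℕ →₀ ℕ) (l : List ℕ) :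
    (l.map fun i => g i ^ f i).prod ∈ Hom (l.map fun i => f i * d i).sum := by
  induction l with
  | nil => exact one_mem_Hom
  | cons a l ih => exact mul_mem_Hom (pow_mem_Hom (h a) _) ih

lemma asc_mem {g : ℕ → F} {d : ℕ → ℕ} (h : ∀ n, g n ∈ Hom (d n)) (f : ℕ →₀ ℕ) :
    asc g f ∈ Hom (wt d f) := list_prod_mem h f _

lemma desc_mem {g : ℕ → F} {d : ℕ → ℕ} (h : ∀ n, g n ∈ Hom (d n)) (f : ℕ →₀ ℕ) :
    desc g f ∈ Hom (wt d f) := by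
  have := list_prod_mem h f (List.range (f.support.sup id + 1)).reverse
  rwa [List.map_reverse, List.map_reverse, List.sum_reverse, ← List.map_reverse] at this

/-- the total degree of a PBW monomial -/
def deg (t : Quad) : ℕ :=
  wt (fun n => 2 * n + 1) t.1 + wt (fun n => 4 * n + 2) t.2.1 +
    wt (fun n => 2 * (2 * n + 1) + 2) t.2.2.1 + wt (fun n => 2 * n + 1) t.2.2.2

lemma mono_mem (q : ℂ) (t : Quad) : mono q t ∈ Hom (deg t) :=
  mul_mem_Hom (mul_mem_Hom (mul_mem_Hom (asc_mem (YF_mem q) _) (asc_mem (MF_mem q) _))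
    (asc_mem (fun n => LF_mem q (2 * n + 1)) _)) (desc_mem (XF_mem q) _)

/-- the functions given on nonzero numbers by Laurent polynomials -/
def laurent : Subalgebra ℂ (ℂ → ℂ) where
  carrier := {f | ∃ (N : ℕ) (p : Polynomial ℂ), ∀ u, u ≠ 0 → u ^ N * f u = p.eval u}
  mul_mem' := by
    rintro f g ⟨N, p, hp⟩ ⟨N', p', hp'⟩
    refine ⟨N + N', p * p', fun u hu => ?_⟩
    rw [Polynomial.eval_mul, ← hp u hu, ← hp' u hu, Pi.mul_apply]; ring
  add_mem' := by
    rintro f g ⟨N, p, hp⟩ ⟨N', p', hp'⟩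
    refine ⟨N + N', Polynomial.X ^ N' * p + Polynomial.X ^ N * p', fun u hu => ?_⟩
    simp only [Polynomial.eval_add, Polynomial.eval_mul, Polynomial.eval_pow, Polynomial.eval_X,
      ← hp u hu, ← hp' u hu, Pi.add_apply]
    ring
  algebraMap_mem' r := ⟨0, Polynomial.C r, fun u _ => by simp⟩

lemma id_mem_laurent : (fun q => q : ℂ → ℂ) ∈ laurent := ⟨0, Polynomial.X, by simp⟩

lemma inv_mem_laurent : (fun q => q⁻¹ : ℂ → ℂ) ∈ laurent := ⟨1, 1, by simp +contextual⟩

lemma laurent_finite {f : ℂ → ℂ} (hf : f ∈ laurent) {a : ℂ} (ha : a ≠ 0) (h : f a ≠ 0) :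
    {q | q ≠ 0 ∧ f q = 0}.Finite := by
  obtain ⟨N, p, hp⟩ := hf
  have hp0 : p ≠ 0 := by
    rintro rfl
    have := hp a ha
    simp [h, ha] at this
  refine (p.roots.toFinset.finite_toSet).subset ?_
  rintro u ⟨hu, hfu⟩
  simp [hp0, ← hp u hu, hfu]

/-- vector valued Laurent functions -/
def LV (V : Type) [AddCommGroup V] [Module ℂ V] : Submodule ℂ (ℂ → V) :=
  Submodule.span ℂ {g | ∃ f ∈ laurent, ∃ v : V, g = fun q => f q • v}

section
variable {V W Z : Type} [AddCommGroup V] [Module ℂ V] [AddCommGroup W] [Module ℂ W]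
  [AddCommGroup Z] [Module ℂ Z]

lemma const_mem_LV (v : V) : (fun _ => v) ∈ LV V :=
  Submodule.subset_span ⟨1, one_mem _, v, by simp⟩

lemma smul_mem_LV {f : ℂ → ℂ} (hf : f ∈ laurent) {g : ℂ → V} (hg : g ∈ LV V) :
    (fun q => f q • g q) ∈ LV V := by
  induction hg using Submodule.span_induction with
  | mem g hg =>
    obtain ⟨f', hf', v, rfl⟩ := hg
    exact Submodule.subset_span ⟨f * f', mul_mem hf hf', v, by simp [mul_smul]⟩
  | zero => simpa only [Pi.zero_apply, smul_zero] using const_mem_LV 0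
  | add g h _ _ h1 h2 =>
    convert add_mem h1 h2 using 1
    funext q
    simp
  | smul r g _ h =>
    convert Submodule.smul_mem _ r h using 1
    funext q
    simp [smul_comm r]

lemma map_mem_LV {g : ℂ → V} (hg : g ∈ LV V) (φ : ℂ → V →ₗ[ℂ] W)
    (hφ : ∀ v, (fun q => φ q v) ∈ LV W) : (fun q => φ q (g q)) ∈ LV W := by
  induction hg using Submodule.span_induction with
  | mem g hg =>
    obtain ⟨f, hf, v, rfl⟩ := hg
    simpa only [map_smul] using smul_mem_LV hf (hφ v)
  | zero => simpa only [Pi.zero_apply, map_zero] using const_mem_LV 0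
  | add g h _ _ h1 h2 =>
    convert add_mem h1 h2 using 1
    funext q
    simp
  | smul r g _ h =>
    convert Submodule.smul_mem _ r h using 1
    funext q
    simp

lemma linear_mem_LV (φ : V →ₗ[ℂ] W) {g : ℂ → V} (hg : g ∈ LV V) : (fun q => φ (g q)) ∈ LV W :=
  map_mem_LV hg (fun _ => φ) fun v => const_mem_LV (φ v)

lemma mul_mem_LV {g h : ℂ → F} (hg : g ∈ LV F) (hh : h ∈ LV F) : (fun q => g q * h q) ∈ LV F :=
  map_mem_LV hh (fun q => LinearMap.mulLeft ℂ (g q)) fun v =>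
    linear_mem_LV (LinearMap.mulRight ℂ v) hg

lemma add_mem_LV {g h : ℂ → V} (hg : g ∈ LV V) (hh : h ∈ LV V) : (fun q => g q + h q) ∈ LV V :=
  add_mem hg hh

lemma sub_mem_LV {g h : ℂ → V} (hg : g ∈ LV V) (hh : h ∈ LV V) : (fun q => g q - h q) ∈ LV V :=
  sub_mem hg hh

lemma csmul_mem_LV (r : ℂ) {g : ℂ → V} (hg : g ∈ LV V) : (fun q => r • g q) ∈ LV V :=
  Submodule.smul_mem _ r hg

lemma LV_le_laurent {f : ℂ → ℂ} (hf : f ∈ LV ℂ) : f ∈ laurent := by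
  induction hf using Submodule.span_induction with
  | mem g hg =>
    obtain ⟨f, hf, v, rfl⟩ := hg
    convert laurent.smul_mem hf v using 1
    funext q
    simp [mul_comm]
  | zero => exact zero_mem _
  | add g h _ _ h1 h2 => exact add_mem h1 h2
  | smul r g _ h => exact laurent.smul_mem h r

end

lemma list_prod_mem_LV {ι : Type} (l : List ι) (g : ι → ℂ → F) (h : ∀ i, g i ∈ LV F) :
    (fun q => (l.map fun i => g i q).prod) ∈ LV F := by
  induction l with
  | nil => exact const_mem_LV 1
  | cons a l ih => simpa only [List.map_cons, List.prod_cons] using mul_mem_LV (h a) ih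

lemma pow_mem_LV {g : ℂ → F} (h : g ∈ LV F) (n : ℕ) : (fun q => g q ^ n) ∈ LV F := by
  induction n with
  | zero => simpa only [pow_zero] using const_mem_LV 1
  | succ n ih => simpa only [pow_succ] using mul_mem_LV ih h

lemma L1F_mem_LV : L1F ∈ LV F :=
  sub_mem_LV (const_mem_LV _) (smul_mem_LV inv_mem_laurent (const_mem_LV _))

lemma serre1_mem_LV : serre1 ∈ LV F := by
  have h : X2F ∈ LV F :=
    sub_mem_LV (mul_mem_LV (const_mem_LV _) L1F_mem_LV) (mul_mem_LV L1F_mem_LV (const_mem_LV _))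
  exact sub_mem_LV (mul_mem_LV (const_mem_LV _) h)
    (smul_mem_LV id_mem_laurent (mul_mem_LV h (const_mem_LV _)))

lemma serre2_mem_LV : serre2 ∈ LV F := by
  have h : Y2F ∈ LV F :=
    add_mem_LV (mul_mem_LV L1F_mem_LV (const_mem_LV _)) (mul_mem_LV (const_mem_LV _) L1F_mem_LV)
  exact sub_mem_LV (mul_mem_LV h (const_mem_LV _))
    (smul_mem_LV id_mem_laurent (mul_mem_LV (const_mem_LV _) h))

lemma YF_mem_LV (n : ℕ) : (fun q => YF q n) ∈ LV F := by
  induction n with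
  | zero => exact const_mem_LV _
  | succ n ih => exact sub_mem_LV (mul_mem_LV L1F_mem_LV ih) (csmul_mem_LV _ (mul_mem_LV ih L1F_mem_LV))

lemma XF_mem_LV (n : ℕ) : (fun q => XF q n) ∈ LV F := by
  induction n with
  | zero => exact const_mem_LV _
  | succ n ih => exact sub_mem_LV (mul_mem_LV ih L1F_mem_LV) (csmul_mem_LV _ (mul_mem_LV L1F_mem_LV ih))

lemma LF_mem_LV (n : ℕ) : (fun q => LF q n) ∈ LV F :=
  sub_mem_LV (mul_mem_LV (const_mem_LV _) (YF_mem_LV n))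
    (smul_mem_LV inv_mem_laurent (mul_mem_LV (YF_mem_LV n) (const_mem_LV _)))

lemma MF_mem_LV (n : ℕ) : (fun q => MF q n) ∈ LV F := by
  induction n with
  | zero => exact LF_mem_LV 0
  | succ n ih => exact sub_mem_LV (mul_mem_LV (LF_mem_LV 1) ih) (mul_mem_LV ih (LF_mem_LV 1))

lemma mono_mem_LV (t : Quad) : (fun q => mono q t) ∈ LV F :=
  mul_mem_LV (mul_mem_LV (mul_mem_LV
    (list_prod_mem_LV _ _ fun i => pow_mem_LV (YF_mem_LV i) _)
    (list_prod_mem_LV _ _ fun i => pow_mem_LV (MF_mem_LV i) _))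
    (list_prod_mem_LV _ _ fun i => pow_mem_LV (LF_mem_LV (2 * i + 1)) _))
    (list_prod_mem_LV _ _ fun i => pow_mem_LV (XF_mem_LV i) _)

lemma Psi_mem_LV (u : F) : ∀ G : ℂ → ℕ → F, (∀ k, (fun q => G q k) ∈ LV F) →
    ∀ k, (fun q => Psi q u (G q) k) ∈ LV F := by
  induction u using FreeAlgebra.induction with
  | grade0 r =>
    intro G hG k
    simp only [AlgHom.commutes]
    exact csmul_mem_LV r (hG k)
  | add u w h1 h2 =>
    intro G hG k
    simp only [map_add]
    exact add_mem_LV (h1 G hG k) (h2 G hG k)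
  | mul u w h1 h2 =>
    intro G hG k
    simp only [map_mul, Module.End.mul_apply]
    exact h1 _ (h2 G hG) k
  | grade1 i =>
    intro G hG k
    have h (u : F) (k : ℕ) : (fun q => u * G q k) ∈ LV F := mul_mem_LV (const_mem_LV u) (hG k)
    obtain ⟨m, hm⟩ := exists_four k
    fin_cases i
    · change (fun q => Psi q x1 (G q) k) ∈ _
      simp only [Psi_x1]
      rcases hm with rfl | rfl | rfl | rfl
      · simp only [Psi1_zero]; exact add_mem_LV (hG _) (h _ _)
      · simp only [Psi1_one]; exact add_mem_LV (hG _) (smul_mem_LV inv_mem_laurent (h _ _))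
      · simp only [Psi1_two]
        exact smul_mem_LV (mul_mem inv_mem_laurent inv_mem_laurent) (h _ _)
      · simp only [Psi1_three]; exact smul_mem_LV inv_mem_laurent (h _ _)
    · change (fun q => Psi q x2 (G q) k) ∈ _
      simp only [Psi_x2]
      rcases hm with rfl | rfl | rfl | rfl
      · simp only [Psi2_zero]; exact h _ _
      · simp only [Psi2_one]; exact smul_mem_LV id_mem_laurent (h _ _)
      · simp only [Psi2_two]
        exact add_mem_LV (hG _) (smul_mem_LV (mul_mem id_mem_laurent id_mem_laurent) (h _ _))
      · simp only [Psi2_three]; exact sub_mem_LV (hG _) (smul_mem_LV id_mem_laurent (h _ _))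

lemma pair_mem_laurent (l : List (ℕ × ℕ)) : ∀ g ∈ LV F, (fun q => pair q l (g q)) ∈ laurent := by
  induction l with
  | nil => intro g hg; exact LV_le_laurent (linear_mem_LV _ hg)
  | cons s l ih =>
    intro g hg
    exact ih _ (map_mem_LV hg (fun q => rem q s) fun v =>
      Psi_mem_LV v (fun _ => delta s.2) (fun k => const_mem_LV _) s.1)

lemma det_mem_laurent {n : Type} [Fintype n] [DecidableEq n] (A : ℂ → Matrix n n ℂ)
    (h : ∀ i j, (fun q => A q i j) ∈ laurent) : (fun q => (A q).det) ∈ laurent := by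
  have : (fun q => (A q).det) =
      ∑ σ : Equiv.Perm n, (Equiv.Perm.sign σ : ℤ) • ∏ i, fun q => A q (σ i) i := by
    funext q
    rw [Matrix.det_apply, Finset.sum_apply]
    refine Finset.sum_congr rfl fun σ _ => ?_
    rw [Pi.smul_apply, Finset.prod_apply]
    rfl
  rw [this]
  exact sum_mem fun σ _ => zsmul_mem (prod_mem fun i _ => h _ _) _

/-- linear independence of a Laurent family at one point implies it at almost all points -/
lemma linearIndependent_generic {n : Type} [Fintype n] [DecidableEq n] (g : n → ℂ → F)
    (hg : ∀ i, g i ∈ LV F) {a : ℂ} (ha : a ≠ 0) (h : LinearIndependent ℂ fun i => g i a) :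
    {q | q ≠ 0 ∧ ¬ LinearIndependent ℂ fun i => g i q}.Finite := by
  obtain ⟨φ, hφ⟩ := LinearMap.exists_leftInverse_of_injective
    (Fintype.linearCombination ℂ fun i => g i a)
    (LinearMap.ker_eq_bot.mpr h.fintypeLinearCombination_injective)
  have hφ' (i : n) : φ (g i a) = Pi.single i 1 := by
    have := congrArg (fun f => f (Pi.single i 1)) hφ
    simpa [Fintype.linearCombination_apply_single] using this
  let A : ℂ → Matrix n n ℂ := fun q => Matrix.of fun i j => φ (g i q) j
  refine (laurent_finite (det_mem_laurent A fun i j => LV_le_laurent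
    (linear_mem_LV ((LinearMap.proj j).comp φ) (hg i))) ha ?_).subset ?_
  · have : A a = 1 := by
      ext i j
      simp [A, hφ', Matrix.one_apply, Pi.single_apply, eq_comm]
    simp [this]
  · rintro q ⟨hq, hd⟩
    refine ⟨hq, ?_⟩
    by_contra hdet
    refine hd ?_
    have hr : LinearIndependent ℂ (A q).row :=
      Matrix.linearIndependent_rows_iff_isUnit.mpr ((Matrix.isUnit_iff_isUnit_det _).mpr
        (isUnit_iff_ne_zero.mpr hdet))
    exact LinearIndependent.of_comp φ hr

/-- at `q = 1` the monomials are separated by functionals `pair` -/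
def Separated : Prop := ∀ T : Finset Quad, ∃ s : T → List (ℕ × ℕ),
  (Matrix.of fun i j : T => pair 1 (s i) (mono 1 j)).det ≠ 0

lemma card_add_card_le (hsep : Separated) {q : ℂ} (hq0 : q ≠ 0) {n m : ℕ} (R : Fin m → F)
    (hR : ∀ i, R i ∈ relSet q n) (hind : LinearIndependent ℂ R) (T : Finset Quad)
    (hT : ∀ t ∈ T, deg t = n) : m + T.card ≤ Module.finrank ℂ (Hom n) := by
  classical
  choose i j a b s hij ha hb hs hRe using hR
  let R' : Fin m → ℂ → F := fun k q => a k * s k q * b k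
  have hsL (k) : s k ∈ LV F := by
    rcases hs k with h | h <;> rw [h]
    exacts [serre1_mem_LV, serre2_mem_LV]
  obtain ⟨σ, hσ⟩ := hsep T
  have f1 := linearIndependent_generic R'
    (fun k => mul_mem_LV (mul_mem_LV (const_mem_LV _) (hsL k)) (const_mem_LV _)) hq0
    (by rwa [funext hRe] at hind)
  have f2 := laurent_finite (det_mem_laurent
    (fun q => Matrix.of fun i j : T => pair q (σ i) (mono q j))
    fun i j => pair_mem_laurent _ _ (mono_mem_LV j)) one_ne_zero hσ
  obtain ⟨p, hp⟩ := ((Set.finite_singleton (0 : ℂ)).union (f1.union f2)).exists_notMem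
  simp only [Set.mem_union, Set.mem_singleton_iff, Set.mem_ofPred_eq, not_or, not_and,
    not_not] at hp
  obtain ⟨hp0, hp1, hp2⟩ := hp
  replace hp1 := hp1 hp0
  replace hp2 := hp2 hp0
  have hmemR (k) : R' k p ∈ relSet p n := ⟨i k, j k, a k, b k, s k, hij k, ha k, hb k, hs k, rfl⟩
  let v : Fin m ⊕ T → Hom n := Sum.elim (fun k => ⟨R' k p, relSet_subset p n (hmemR k)⟩)
    (fun t => ⟨mono p t, hT t t.2 ▸ mono_mem p t⟩)
  have hv : LinearIndependent ℂ v := by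
    rw [Fintype.linearIndependent_iff]
    intro g hg
    have hg' : ∑ k, g (Sum.inl k) • R' k p + ∑ t : T, g (Sum.inr t) • mono p t = 0 := by
      have := congrArg (Hom n).subtype hg
      simpa [v, Fintype.sum_sum_type] using this
    have h2 : (fun t : T => g (Sum.inr t)) = 0 := by
      by_contra hne
      refine hp2 (Matrix.exists_mulVec_eq_zero_iff.mp ⟨_, hne, ?_⟩)
      funext k
      have hJ (k') : pair p (σ k) (R' k' p) = 0 :=
        pair_J hp0 _ _ (Submodule.subset_span (Set.mem_iUnion.mpr ⟨n, hmemR k'⟩))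
      have := congrArg (pair p (σ k)) hg'
      simp only [map_add, map_sum, map_smul, hJ, smul_zero, Finset.sum_const_zero, zero_add,
        map_zero] at this
      simpa [Matrix.mulVec, dotProduct, mul_comm] using this
    have h3 (t : T) : g (Sum.inr t) = 0 := congrFun h2 t
    simp only [h3, zero_smul, Finset.sum_const_zero, add_zero] at hg'
    rintro (k | t)
    · exact Fintype.linearIndependent_iff.mp hp1 (fun k => g (Sum.inl k)) hg' k
    · exact h3 t
  simpa using hv.fintype_card_le_finrank

/-- the monomials of degree `n` are independent modulo the relations -/
lemma eq_zero_of_sum_mem (hsep : Separated) {q : ℂ} (hq0 : q ≠ 0)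
    (hspan : Submodule.span ℂ (Set.range (pbwMonomial q)) = ⊤) (n : ℕ) (g : Quad →₀ ℂ)
    (hg : ∀ t ∈ g.support, deg t = n)
    (h : g.sum (fun t r => r • mono q t) ∈ Submodule.span ℂ (relSet q n)) : g = 0 := by
  classical
  set I := Submodule.span ℂ (relSet q n) with hI
  have hIle : I ≤ Hom n := Submodule.span_le.mpr (relSet_subset q n)
  have : FiniteDimensional ℂ I := Submodule.finiteDimensional_of_le hIle
  obtain ⟨R, hR, hRs, hRi⟩ := Submodule.exists_fun_fin_finrank_span_eq ℂ (relSet q n)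
  have hcard (T : Finset Quad) (hT : ∀ t ∈ T, deg t = n) :
      Module.finrank ℂ I + T.card ≤ Module.finrank ℂ (Hom n) :=
    card_add_card_le hsep hq0 R hR hRi T hT
  have hfin : {t | deg t = n}.Finite := by
    by_contra hinf
    obtain ⟨T, hT, hc⟩ := Set.Infinite.exists_subset_card_eq hinf (Module.finrank ℂ (Hom n) + 1)
    have := hcard T fun t ht => hT ht
    omega
  set S := hfin.toFinset with hS
  have hSd (t) : t ∈ S ↔ deg t = n := by simp [hS]
  let v : S → F ⧸ I := fun t => I.mkQ (mono q t)
  have hW : (Hom n).map I.mkQ ≤ Submodule.span ℂ (Set.range v) := by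
    rintro _ ⟨u, hu, rfl⟩
    have hπ : π q u ∈ Submodule.span ℂ (Set.range (pbwMonomial q)) := hspan ▸ Submodule.mem_top
    obtain ⟨c, hc⟩ := Finsupp.mem_span_range_iff_exists_finsupp.mp hπ
    have hJ : u - c.sum (fun t r => r • mono q t) ∈ J q := by
      refine mem_J_of_π_eq_zero ?_
      rw [map_sub, ← hc, map_finsuppSum]
      simp only [map_smul, π_mono, sub_self]
    have := proj_J hJ n
    rw [map_sub, proj_of_mem n hu, if_pos rfl, map_finsuppSum] at this
    have h' := (Submodule.Quotient.eq I).mpr this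
    change Submodule.Quotient.mk u ∈ _
    rw [h']
    change I.mkQ _ ∈ _
    rw [map_finsuppSum]
    refine Submodule.sum_mem _ fun t _ => ?_
    beta_reduce
    rw [map_smul, map_smul, proj_of_mem n (mono_mem q t)]
    refine Submodule.smul_mem _ _ ?_
    split_ifs with ht
    · exact Submodule.subset_span ⟨⟨t, (hSd t).mpr ht⟩, rfl⟩
    · rw [map_zero]; exact zero_mem _
  have hrank : Module.finrank ℂ ((Hom n).map I.mkQ) + Module.finrank ℂ I =
      Module.finrank ℂ (Hom n) := by
    have h1 := LinearMap.finrank_range_add_finrank_ker (I.mkQ.domRestrict (Hom n))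
    rw [LinearMap.range_domRestrict, LinearMap.ker_domRestrict, Submodule.ker_mkQ] at h1
    rw [← h1, ← (Submodule.submoduleOfEquivOfLe hIle).finrank_eq]
    rfl
  have hv : LinearIndependent ℂ v := by
    rw [linearIndependent_iff_card_le_finrank_span]
    have := hcard S fun t ht => (hSd t).mp ht
    have : FiniteDimensional ℂ (Submodule.span ℂ (Set.range v)) :=
      FiniteDimensional.span_of_finite ℂ (Set.finite_range v)
    have h2 : Module.finrank ℂ ((Hom n).map I.mkQ) ≤ (Set.range v).finrank ℂ :=
      Submodule.finrank_mono hW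
    rw [Fintype.card_coe]
    omega
  have hz := (Submodule.Quotient.mk_eq_zero I).mpr h
  change I.mkQ _ = 0 at hz
  rw [map_finsuppSum, Finsupp.sum_of_support_subset (s := S) g
    (fun t ht => (hSd t).mpr (hg t ht)) _ (by simp), ← Finset.sum_coe_sort] at hz
  simp only [map_smul] at hz
  have := Fintype.linearIndependent_iff.mp hv (fun t => g t) hz
  ext t
  by_cases ht : t ∈ g.support
  · exact this ⟨t, (hSd t).mpr (hg t ht)⟩
  · simpa using ht

theorem linearIndependent_pbwMonomial (hsep : Separated) {q : ℂ} (hq0 : q ≠ 0)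
    (hspan : Submodule.span ℂ (Set.range (pbwMonomial q)) = ⊤) :
    LinearIndependent ℂ (pbwMonomial q) := by
  classical
  rw [linearIndependent_iff]
  intro g hg
  have hJ : g.sum (fun t r => r • mono q t) ∈ J q := by
    refine mem_J_of_π_eq_zero ?_
    rw [map_finsuppSum]
    simpa only [map_smul, π_mono, Finsupp.linearCombination_apply] using hg
  ext t
  have h := proj_J hJ (deg t)
  have h0 := eq_zero_of_sum_mem hsep hq0 hspan (deg t) (g.filter fun t' => deg t' = deg t)
    (fun t' ht' => by
      rw [Finsupp.support_filter, Finset.mem_filter] at ht'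
      exact ht'.2) (by
    convert h using 1
    rw [map_finsuppSum, Finsupp.sum_filter_index, Finsupp.sum, Finsupp.support_filter,
      Finset.sum_filter]
    refine Finset.sum_congr rfl fun t' _ => ?_
    rw [map_smul, proj_of_mem _ (mono_mem q t')]
    split_ifs <;> simp)
  have := DFunLike.congr_fun h0 t
  rwa [Finsupp.filter_apply_pos (fun t' => deg t' = deg t) g rfl] at this

/-- the `4`-periodic function with given values -/
def per (a b c d : ℂ) (k : ℕ) : ℂ :=
  if k % 4 = 0 then a else if k % 4 = 1 then b else if k % 4 = 2 then c else d

/-- the `4`-periodic sign -/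
def sgn (k : ℕ) : ℂ := if k % 4 = 3 then -1 else 1

/-- elements acting by a shift plus (twisted) left multiplication at `q = 1` -/
structure IsPrim (p : F) (s n : ℕ) (c : ℕ → ℂ) : Prop where
  act : ∀ G k, Psi 1 p G k = c k • G (k + n) + sgn k ^ s • (p * G k)
  sgn_add : ∀ k, c k ≠ 0 → sgn (k + n) = (-1) ^ s * sgn k

variable {p p' : F} {s s' n n' : ℕ} {c c' : ℕ → ℂ}

lemma IsPrim.mul_apply (h : IsPrim p s n c) (h' : IsPrim p' s' n' c') (G : ℕ → F) (k : ℕ) :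
    Psi 1 (p * p') G k = (c k * c' (k + n)) • G (k + (n + n')) +
      ((-1) ^ (s * s') * c k * sgn k ^ s') • (p' * G (k + n)) +
      (sgn k ^ s * c' k) • (p * G (k + n')) + (sgn k ^ (s + s')) • (p * p' * G k) := by
  have e : c k * sgn (k + n) ^ s' = (-1) ^ (s * s') * c k * sgn k ^ s' := by
    by_cases h0 : c k = 0
    · simp [h0]
    · rw [h.sgn_add k h0, mul_pow, pow_mul]; ring
  rw [map_mul, Module.End.mul_apply, h.act, h'.act, h'.act, ← e]
  simp only [smul_add, smul_smul, mul_add, mul_smul_comm, mul_assoc, add_assoc, pow_add]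

lemma IsPrim.congr (h : IsPrim p s n c) (hp : p = p') (hn : n = n')
    (hs : s = s') (hc : ∀ k, c k = c' k) : IsPrim p' s' n' c' := by
  subst hp hn hs
  rwa [funext hc] at h

lemma IsPrim.bracket (h : IsPrim p s n c) (h' : IsPrim p' s' n' c') :
    IsPrim (p * p' - ((-1 : ℂ) ^ (s * s')) • (p' * p)) (s + s') (n + n')
      (fun k => c k * c' (k + n) - (-1) ^ (s * s') * (c' k * c (k + n'))) where
  act G k := by
    rw [map_sub, map_smul, LinearMap.sub_apply, LinearMap.smul_apply, Pi.sub_apply, Pi.smul_apply,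
      h.mul_apply h', h'.mul_apply h, add_comm n' n, add_comm s' s, mul_comm s' s]
    have e : ((-1 : ℂ) ^ (s * s')) * (-1) ^ (s * s') = 1 := by
      rw [← mul_pow]; simp
    simp only [sub_mul, smul_mul_assoc, smul_sub, smul_add, smul_smul]
    match_scalars <;> try ring
    linear_combination (-c' k * sgn k ^ s) * e
  sgn_add k hk := by
    rcases ne_or_eq (c k * c' (k + n)) 0 with h0 | h0
    · rw [← add_assoc, h'.sgn_add _ (right_ne_zero_of_mul h0), h.sgn_add _ (left_ne_zero_of_mul h0)]
      ring
    · have h0 : c' k * c (k + n') ≠ 0 := fun h1 => hk (by rw [h0, h1]; ring)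
      rw [add_comm n, ← add_assoc, h.sgn_add _ (right_ne_zero_of_mul h0),
        h'.sgn_add _ (left_ne_zero_of_mul h0)]
      ring

lemma IsPrim.sq (h : IsPrim p s n c) (hs : Odd s) :
    IsPrim (p * p) (s + s) (n + n) (fun k => c k * c (k + n)) where
  act G k := by
    rw [h.mul_apply h, (hs.mul hs).neg_one_pow]
    module
  sgn_add k hk := by
    rw [← add_assoc, h.sgn_add _ (right_ne_zero_of_mul hk), h.sgn_add _ (left_ne_zero_of_mul hk)]
    ring

lemma mod_four (k : ℕ) : k % 4 = 0 ∨ k % 4 = 1 ∨ k % 4 = 2 ∨ k % 4 = 3 := by omega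

lemma isPrim_x1 : IsPrim x1 0 1 (per 1 1 0 0) where
  act G k := by
    rw [Psi_x1]
    obtain ⟨m, rfl | rfl | rfl | rfl⟩ := exists_four k <;>
    simp [Psi1_zero, Psi1_one, Psi1_two, Psi1_three, per, Nat.add_mod]
  sgn_add k := by
    rcases mod_four k with h | h | h | h <;> simp [per, sgn, h, Nat.add_mod]

lemma isPrim_x2 : IsPrim x2 1 1 (per 0 0 1 1) where
  act G k := by
    rw [Psi_x2]
    obtain ⟨m, rfl | rfl | rfl | rfl⟩ := exists_four k <;>
    simp [Psi2_zero, Psi2_one, Psi2_two, Psi2_three, per, sgn, Nat.add_mod, mul_add, sub_eq_add_neg]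
  sgn_add k := by
    rcases mod_four k with h | h | h | h <;> simp [per, sgn, h, Nat.add_mod]

lemma isPrim_L1F : IsPrim (L1F 1) 1 2 (per 0 1 0 (-1)) := by
  refine (isPrim_x1.bracket isPrim_x2).congr (by simp [L1F]) rfl rfl fun k => ?_
  rcases mod_four k with h | h | h | h <;> simp [per, h, Nat.add_mod]

/-- the structure constants of `Y_{n+1}` -/
def cY (n : ℕ) : ℕ → ℂ :=
  if n % 4 = 0 then per 0 0 1 1 else if n % 4 = 1 then per 0 1 (-1) 0
  else if n % 4 = 2 then per 0 0 1 (-1) else per 0 (-1) (-1) 0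

/-- the structure constants of `X_{n+1}` -/
def cX (n : ℕ) : ℕ → ℂ :=
  if n % 4 = 0 then per 1 1 0 0 else if n % 4 = 1 then per 1 0 0 1
  else if n % 4 = 2 then per (-1) 1 0 0 else per (-1) 0 0 1

/-- the structure constants of `L_{2n+2}` -/
def cL (n : ℕ) : ℕ → ℂ := if n % 2 = 0 then per 1 (-2) 1 0 else per (-1) 0 1 0

/-- the structure constants of `M_{2n+1}` -/
def cM (n : ℕ) : ℕ → ℂ := per 0 ((-2) ^ n) 0 (-2 ^ n)

lemma neg_one_pow_mod (n r : ℕ) (h : n % 4 = r) : (-1 : ℂ) ^ n = (-1) ^ r := by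
  rw [← Nat.div_add_mod n 4, h, pow_add, pow_mul]; norm_num

lemma isPrim_YF (n : ℕ) : IsPrim (YF 1 n) (n + 1) (2 * n + 1) (cY n) := by
  induction n with
  | zero => exact isPrim_x2.congr rfl rfl rfl fun k => by simp [cY]
  | succ n ih =>
    refine (isPrim_L1F.bracket ih).congr (by simp [YF]) (by ring) (by ring) fun k => ?_
    rw [one_mul, pow_succ]
    rcases mod_four n with hn | hn | hn | hn <;> rw [neg_one_pow_mod n _ hn] <;>
    rcases mod_four k with h | h | h | h <;> simp [cY, per, h, hn, Nat.add_mod, Nat.mul_mod] <;> norm_num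

lemma isPrim_XF (n : ℕ) : IsPrim (XF 1 n) n (2 * n + 1) (cX n) := by
  induction n with
  | zero => exact isPrim_x1.congr rfl rfl rfl fun k => by simp [cX]
  | succ n ih =>
    refine (ih.bracket isPrim_L1F).congr (by simp [XF]) (by ring) (by ring) fun k => ?_
    rw [mul_one]
    rcases mod_four n with hn | hn | hn | hn <;> rw [neg_one_pow_mod n _ hn] <;>
    rcases mod_four k with h | h | h | h <;> simp [cX, per, h, hn, Nat.add_mod, Nat.mul_mod] <;> norm_num

lemma isPrim_LF (n : ℕ) : IsPrim (LF 1 (2 * n + 1)) (2 * n + 2) (4 * n + 4) (cL n) := by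
  refine (isPrim_x1.bracket (isPrim_YF (2 * n + 1))).congr (by simp [LF]) (by ring) (by ring)
    fun k => ?_
  rw [zero_mul, pow_zero]
  have h4 : (2 * n + 1) % 4 = 2 * (n % 2) + 1 := by omega
  have h5 : 2 * (2 * n + 1) + 1 = 4 * n + 3 := by ring
  rw [cY, h4, h5]
  rcases Nat.mod_two_eq_zero_or_one n with hn | hn <;>
  rcases mod_four k with h | h | h | h <;> simp [cL, per, h, hn, Nat.add_mod, Nat.mul_mod] <;> norm_num

lemma isPrim_MF (n : ℕ) : IsPrim (MF 1 n) (2 * n + 1) (4 * n + 2) (cM n) := by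
  induction n with
  | zero => exact isPrim_L1F.congr (by simp [MF, LF, YF, L1F]) rfl rfl fun k => by simp [cM]
  | succ n ih =>
    refine ((isPrim_LF 0).bracket ih).congr (by simp [MF]) (by ring) (by ring) fun k => ?_
    rw [mul_zero, zero_add, pow_mul]
    rcases mod_four k with h | h | h | h <;>
      simp [cM, cL, per, h, Nat.add_mod, Nat.mul_mod, pow_succ] <;> ring_nf

/-- the root vectors together with the squares of the odd ones, the index being that of the
(unsquared) family, of its even part for `y2` and of its odd part for `x2` -/
inductive Letter
  | y (n : ℕ) | y2 (n : ℕ) | m (n : ℕ) | m2 (n : ℕ) | l (n : ℕ) | x (n : ℕ) | x2 (n : ℕ)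

namespace Letter

/-- the element at `q = 1` -/
def el : Letter → F
  | y n => YF 1 n
  | y2 n => YF 1 (2 * n) * YF 1 (2 * n)
  | m n => MF 1 n
  | m2 n => MF 1 n * MF 1 n
  | l n => LF 1 (2 * n + 1)
  | x n => XF 1 n
  | x2 n => XF 1 (2 * n + 1) * XF 1 (2 * n + 1)

/-- the parity -/
def par : Letter → ℕ
  | y n => n + 1
  | y2 n => (2 * n + 1) + (2 * n + 1)
  | m n => 2 * n + 1
  | m2 n => (2 * n + 1) + (2 * n + 1)
  | l n => 2 * n + 2
  | x n => n
  | x2 n => (2 * n + 1) + (2 * n + 1)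

/-- the total degree -/
def len : Letter → ℕ
  | y n => 2 * n + 1
  | y2 n => (2 * (2 * n) + 1) + (2 * (2 * n) + 1)
  | m n => 4 * n + 2
  | m2 n => (4 * n + 2) + (4 * n + 2)
  | l n => 4 * n + 4
  | x n => 2 * n + 1
  | x2 n => (2 * (2 * n + 1) + 1) + (2 * (2 * n + 1) + 1)

/-- the shift coefficients -/
def cf : Letter → ℕ → ℂ
  | y n => cY n
  | y2 n => fun k => cY (2 * n) k * cY (2 * n) (k + (2 * (2 * n) + 1))
  | m n => cM n
  | m2 n => fun k => cM n k * cM n (k + (4 * n + 2))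
  | l n => cL n
  | x n => cX n
  | x2 n => fun k => cX (2 * n + 1) k * cX (2 * n + 1) (k + (2 * (2 * n + 1) + 1))

/-- a position where the letter is the only one of its degree with a nonzero coefficient -/
def st : Letter → ℕ
  | y _ => 2
  | y2 _ => 2
  | m _ => 1
  | m2 _ => 3
  | l _ => 0
  | x _ => 0
  | x2 _ => 0

lemma isPrim (a : Letter) : IsPrim a.el a.par a.len a.cf := by
  cases a with
  | y n => exact isPrim_YF n
  | y2 n => exact (isPrim_YF (2 * n)).sq (by simp)
  | m n => exact isPrim_MF n
  | m2 n => exact (isPrim_MF n).sq (by simp)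
  | l n => exact isPrim_LF n
  | x n => exact isPrim_XF n
  | x2 n => exact (isPrim_XF (2 * n + 1)).sq (by simp)

lemma len_pos (a : Letter) : 0 < a.len := by cases a <;> simp [len]

lemma cf_st_ne_zero (a : Letter) : a.cf a.st ≠ 0 := by
  cases a with
  | y n => rcases mod_four n with h | h | h | h <;> simp [cf, st, cY, per, h]
  | y2 n =>
    have h : (2 * n) % 4 = 0 ∨ (2 * n) % 4 = 2 := by omega
    have h' : (2 + (2 * (2 * n) + 1)) % 4 = 3 := by omega
    rcases h with h | h <;> simp [cf, st, cY, per, h, h']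
  | m n => simp [cf, st, cM, per]
  | m2 n =>
    have h' : (3 + (4 * n + 2)) % 4 = 1 := by omega
    simp [cf, st, cM, per, h']
  | l n => rcases Nat.mod_two_eq_zero_or_one n with h | h <;> simp [cf, st, cL, per, h]
  | x n => rcases mod_four n with h | h | h | h <;> simp [cf, st, cX, per, h]
  | x2 n =>
    have h : (2 * n + 1) % 4 = 1 ∨ (2 * n + 1) % 4 = 3 := by omega
    have h' : (2 * (2 * n + 1) + 1) % 4 = 3 := by omega
    rcases h with h | h <;> simp [cf, st, cX, per, h, h']

lemma cf_st_eq_zero {a b : Letter} (hl : b.len = a.len) (hne : b ≠ a) : b.cf a.st = 0 := by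
  have hY (n k : ℕ) (hk : k % 4 = 0) : cY n k = 0 := by
    rcases mod_four n with h | h | h | h <;> simp [cY, per, h, hk]
  have hX (n k : ℕ) (hk : k % 4 = 2) : cX n k = 0 := by
    rcases mod_four n with h | h | h | h <;> simp [cX, per, h, hk]
  have hY1 (n k : ℕ) (hk : k % 4 = 1) : cY (2 * n) k = 0 := by
    have h : (2 * n) % 4 = 0 ∨ (2 * n) % 4 = 2 := by omega
    rcases h with h | h <;> simp [cY, per, h, hk]
  have hX1 (n k : ℕ) (hk : k % 4 = 1) : cX (2 * n + 1) k = 0 := by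
    have h : (2 * n + 1) % 4 = 1 ∨ (2 * n + 1) % 4 = 3 := by omega
    rcases h with h | h <;> simp [cX, per, h, hk]
  have hM (n k : ℕ) (hk : k % 2 = 0) : cM n k = 0 := by
    have h : k % 4 = 0 ∨ k % 4 = 2 := by omega
    rcases h with h | h <;> simp [cM, per, h]
  have hL (n k : ℕ) (hk : k % 4 = 3) : cL n k = 0 := by
    rcases Nat.mod_two_eq_zero_or_one n with h | h <;> simp [cL, per, h, hk]
  cases a <;> cases b <;>
  first
  | (exfalso; simp only [len] at hl; omega)
  | (exfalso; apply hne; congr 1; simp only [len] at hl; omega)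
  | simp [cf, st, hY, hX, hY1, hX1, hM, hL]

/-- the segment detecting the letter -/
def seg (a : Letter) : ℕ × ℕ := (a.st, a.st + a.len)

end Letter

open Letter

/-- the product of the elements attached to the letters of a word -/
def wd (w : List Letter) : F := (w.map el).prod

lemma wd_cons (a : Letter) (w : List Letter) : wd (a :: w) = a.el * wd w := by simp [wd]

/-- the span of the words with a given property -/
def wspan (p : List Letter → Prop) : Submodule ℂ F := Submodule.span ℂ {u | ∃ w, p w ∧ u = wd w}

lemma wd_mem {p : List Letter → Prop} {w : List Letter} (h : p w) : wd w ∈ wspan p :=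
  Submodule.subset_span ⟨w, h, rfl⟩

lemma wspan_mono {p p' : List Letter → Prop} (h : ∀ w, p w → p' w) : wspan p ≤ wspan p' := by
  refine Submodule.span_mono ?_
  rintro _ ⟨w, hw, rfl⟩
  exact ⟨w, h w hw, rfl⟩

lemma el_mul_mem {p p' : List Letter → Prop} (b : Letter) (h : ∀ w, p w → p' (b :: w)) {u : F}
    (hu : u ∈ wspan p) : b.el * u ∈ wspan p' := by
  induction hu using Submodule.span_induction with
  | mem u hu =>
    obtain ⟨w, hw, rfl⟩ := hu
    rw [← wd_cons]
    exact wd_mem (h w hw)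
  | zero => rw [mul_zero]; exact zero_mem _
  | add u v _ _ h1 h2 => rw [mul_add]; exact add_mem h1 h2
  | smul r u _ h => rw [mul_smul_comm]; exact Submodule.smul_mem _ _ h

lemma Psi_cons (b : Letter) (w : List Letter) (G : ℕ → F) (k : ℕ) :
    Psi 1 (wd (b :: w)) G k =
      b.cf k • Psi 1 (wd w) G (k + b.len) + sgn k ^ b.par • (b.el * Psi 1 (wd w) G k) := by
  rw [wd_cons, map_mul, Module.End.mul_apply, b.isPrim.act]

lemma Psi_nil (G : ℕ → F) (k : ℕ) : Psi 1 (wd []) G k = G k := by simp [wd]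

lemma Psi_of_lt (w : List Letter) {j e : ℕ} (h : e < j) : Psi 1 (wd w) (delta e) j = 0 := by
  induction w generalizing j with
  | nil => rw [Psi_nil, delta, if_neg h.ne']
  | cons b w ih => rw [Psi_cons, ih h, ih (by omega)]; simp

lemma Psi_self (w : List Letter) (e : ℕ) :
    Psi 1 (wd w) (delta e) e = sgn e ^ (w.map par).sum • wd w := by
  induction w with
  | nil => simp [Psi_nil, delta, wd]
  | cons b w ih =>
    have := b.len_pos
    rw [Psi_cons, ih, Psi_of_lt w (by omega), wd_cons, List.map_cons, List.sum_cons, pow_add]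
    simp [smul_smul]

lemma Psi_mem_of_lt (w : List Letter) {j e : ℕ} (h : j < e) :
    Psi 1 (wd w) (delta e) j ∈ wspan fun w' => w'.length + 1 ≤ w.length := by
  induction w generalizing j with
  | nil => rw [Psi_nil, delta, if_neg h.ne]; exact zero_mem _
  | cons b w ih =>
    rw [Psi_cons]
    refine add_mem (Submodule.smul_mem _ _ ?_) (Submodule.smul_mem _ _ ?_)
    · rcases lt_trichotomy (j + b.len) e with h1 | h1 | h1
      · exact wspan_mono (fun w' hw' => by simp only [List.length_cons]; omega) (ih h1)
      · rw [h1, Psi_self]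
        exact Submodule.smul_mem _ _ (wd_mem (by simp))
      · rw [Psi_of_lt w h1]; exact zero_mem _
    · exact el_mul_mem b (fun w' hw' => by simpa using hw') (ih h)

lemma rem_cons_self (a : Letter) (w : List Letter) : rem 1 a.seg (wd (a :: w)) =
    (a.cf a.st * sgn (a.st + a.len) ^ (w.map par).sum) • wd w +
      sgn a.st ^ a.par • (a.el * rem 1 a.seg (wd w)) := by
  rw [rem_apply, Psi_cons, seg, Psi_self, smul_smul, rem_apply]

lemma rem_mem (a : Letter) (w : List Letter) : rem 1 a.seg (wd w) ∈
    wspan fun w' => w'.length + 2 ≤ w.length ∨ (a :: w').Perm w := by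
  induction w with
  | nil =>
    have := a.len_pos
    rw [rem_apply, Psi_nil, delta, seg, if_neg (by simp only; omega)]
    exact zero_mem _
  | cons b w ih =>
    have h2 : b.el * rem 1 a.seg (wd w) ∈
        wspan fun w' => w'.length + 2 ≤ (b :: w).length ∨ (a :: w').Perm (b :: w) := by
      refine el_mul_mem b (fun w' hw' => ?_) ih
      rcases hw' with h | h
      · left; simpa using h
      · right; exact (List.Perm.swap b a w').trans (h.cons b)
    rw [rem_apply, Psi_cons]
    refine add_mem ?_ (Submodule.smul_mem _ _ h2)
    rcases lt_trichotomy b.len a.len with h1 | h1 | h1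
    · refine Submodule.smul_mem _ _ (wspan_mono (fun w' hw' => ?_)
        (Psi_mem_of_lt w (show a.st + b.len < a.st + a.len by omega)))
      left; simp only [List.length_cons]; omega
    · by_cases hba : b = a
      · subst hba
        simp only [seg]
        rw [Psi_self]
        exact Submodule.smul_mem _ _ (Submodule.smul_mem _ _ (wd_mem (Or.inr (List.Perm.refl _))))
      · simp only [seg]
        rw [cf_st_eq_zero h1 hba, zero_smul]; exact zero_mem _
    · simp only [seg]
      rw [Psi_of_lt w (by omega), smul_zero]; exact zero_mem _

/-- removing a letter occurring in a block -/
lemma rem_replicate (a : Letter) (w : List Letter) (hw : a ∉ w) (e : ℕ)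
    (he : Odd a.par → e = 0) : ∃ c : ℂ, c ≠ 0 ∧
    rem 1 a.seg (wd (List.replicate (e + 1) a ++ w)) - c • wd (List.replicate e a ++ w) ∈
      wspan fun w' => w'.length + 1 ≤ (List.replicate e a ++ w).length := by
  have h0 : a.el * rem 1 a.seg (wd w) ∈ wspan fun w' => w'.length + 1 ≤ w.length := by
    refine el_mul_mem a (fun w' hw' => ?_) (rem_mem a w)
    rcases hw' with h | h
    · simp only [List.length_cons]; omega
    · exact absurd (h.subset (by simp)) hw
  set c := a.cf a.st * sgn (a.st + a.len) ^ (w.map par).sum with hc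
  have hsg (k : ℕ) : sgn k ≠ 0 := by rw [sgn]; split_ifs <;> norm_num
  have hc0 : c ≠ 0 := mul_ne_zero a.cf_st_ne_zero (pow_ne_zero _ (hsg _))
  rcases Nat.even_or_odd a.par with hp | hp
  · refine ⟨(e + 1 : ℕ) * c, mul_ne_zero (Nat.cast_ne_zero.mpr e.succ_ne_zero) hc0, ?_⟩
    have hs (k : ℕ) : sgn k ^ a.par = 1 := by
      rw [sgn]; split_ifs <;> simp [hp]
    have hc' (e : ℕ) : a.cf a.st * sgn (a.st + a.len) ^
        ((List.replicate e a ++ w).map par).sum = c := by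
      rw [hc]
      congr 1
      simp [pow_add, pow_mul', hs, mul_comm e]
      rw [← pow_mul, mul_comm e, pow_mul, hs, one_pow, one_mul]
    induction e with
    | zero =>
      have h1 := rem_cons_self a w
      rw [hs, one_smul, ← hc] at h1
      simpa [h1] using h0
    | succ e ih =>
      have h1 := rem_cons_self a (List.replicate (e + 1) a ++ w)
      rw [hs, one_smul, hc'] at h1
      have h2 := el_mul_mem (p' := fun w' => w'.length + 1 ≤ (List.replicate (e + 1) a ++ w).length)
        a (fun w' hw' => by simp at hw' ⊢; omega) (ih fun h => absurd h (Nat.not_odd_iff_even.mpr hp))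
      rw [mul_sub, mul_smul_comm, ← wd_cons] at h2
      have e1 (k : ℕ) : a :: (List.replicate k a ++ w) = List.replicate (k + 1) a ++ w := by
        rw [List.replicate_succ, List.cons_append]
      rw [e1] at h1 h2
      rw [h1]
      convert h2 using 1
      push_cast
      module
  · rw [he hp]
    refine ⟨c, hc0, ?_⟩
    have h1 := rem_cons_self a w
    rw [← hc] at h1
    simp only [List.replicate_succ, List.replicate_zero, List.cons_append, List.nil_append, h1,
      add_sub_cancel_left]
    exact Submodule.smul_mem _ _ h0

lemma pair_eq_zero (s : List Letter) : ∀ w : List Letter, w.length ≤ s.length → ¬ w.Perm s →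
    pair 1 (s.map seg) (wd w) = 0 := by
  induction s with
  | nil =>
    intro w hw hp
    simp at hw
    exact absurd (by simp [hw]) hp
  | cons a s ih =>
    intro w hw hp
    change pair 1 (s.map seg) (rem 1 a.seg (wd w)) = 0
    have := rem_mem a w
    generalize rem 1 a.seg (wd w) = u at this
    induction this using Submodule.span_induction with
    | mem u hu =>
      obtain ⟨w', h | h, rfl⟩ := hu
      · simp only [List.length_cons] at hw
        exact ih w' (by omega) fun h' => by have := h'.length_eq; omega
      · have hl := h.length_eq
        simp only [List.length_cons] at hw hl
        exact ih w' (by omega) fun h' => hp (h.symm.trans (h'.cons a))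
    | zero => rw [map_zero]
    | add u v _ _ h1 h2 => rw [map_add, h1, h2, add_zero]
    | smul r u _ h => rw [map_smul, h, smul_zero]

lemma pair_replicate_ne_zero (a : Letter) (w : List Letter) (hw : a ∉ w) (e : ℕ)
    (he : Odd a.par → e ≤ 1) (h : pair 1 (w.map seg) (wd w) ≠ 0) :
    pair 1 ((List.replicate e a ++ w).map seg) (wd (List.replicate e a ++ w)) ≠ 0 := by
  induction e with
  | zero => simpa using h
  | succ e ih =>
    obtain ⟨c, hc, hr⟩ := rem_replicate a w hw e fun h => by have := he h; omega
    set W := List.replicate e a ++ w with hW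
    have e1 : List.replicate (e + 1) a ++ w = a :: W := by
      rw [List.replicate_succ, List.cons_append]
    rw [e1] at hr ⊢
    change pair 1 (W.map seg) (rem 1 a.seg (wd (a :: W))) ≠ 0
    have h0 : pair 1 (W.map seg) (rem 1 a.seg (wd (a :: W)) - c • wd W) = 0 := by
      generalize rem 1 a.seg (wd (a :: W)) - c • wd W = u at hr
      induction hr using Submodule.span_induction with
      | mem u hu =>
        obtain ⟨w', h, rfl⟩ := hu
        exact pair_eq_zero W w' (by omega) fun h' => by have := h'.length_eq; omega
      | zero => rw [map_zero]
      | add u v _ _ h1 h2 => rw [map_add, h1, h2, add_zero]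
      | smul r u _ h => rw [map_smul, h, smul_zero]
    rw [map_sub, sub_eq_zero] at h0
    rw [h0, map_smul]
    exact mul_ne_zero hc (ih fun h => by have := he h; omega)

/-- the word with letters from the list `ls` and given multiplicities -/
def word (ls : List Letter) (μ : Letter → ℕ) : List Letter :=
  ls.flatMap fun a => List.replicate (μ a) a

lemma pair_word_ne_zero (ls : List Letter) (hls : ls.Nodup) (μ : Letter → ℕ)
    (hμ : ∀ a : Letter, Odd a.par → μ a ≤ 1) :
    pair 1 ((word ls μ).map seg) (wd (word ls μ)) ≠ 0 := by
  induction ls with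
  | nil => simp [word, wd, pair]
  | cons a ls ih =>
    rw [List.nodup_cons] at hls
    refine pair_replicate_ne_zero a (word ls μ) (fun h => ?_) (μ a) (hμ a) (ih hls.2)
    obtain ⟨b, hb, h⟩ := List.mem_flatMap.mp h
    rw [List.eq_of_mem_replicate h] at hls
    exact hls.1 hb

open Classical in
lemma count_word (ls : List Letter) (hls : ls.Nodup) (μ : Letter → ℕ) (a : Letter) (ha : a ∈ ls) :
    (word ls μ).count a = μ a := by
  have h0 (ls : List Letter) (h : a ∉ ls) : (word ls μ).count a = 0 := by
    refine List.count_eq_zero.mpr fun h' => ?_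
    obtain ⟨b, hb, h'⟩ := List.mem_flatMap.mp h'
    rw [List.eq_of_mem_replicate h'] at h
    exact h hb
  induction ls with
  | nil => simp at ha
  | cons b ls ih =>
    rw [List.nodup_cons] at hls
    have e : word (b :: ls) μ = List.replicate (μ b) b ++ word ls μ := by simp [word]
    rw [e, List.count_append]
    by_cases hb : a = b
    · subst hb
      rw [h0 ls hls.1, List.count_replicate_self, add_zero]
    · rw [ih hls.2 (by simpa [hb] using ha), List.count_eq_zero.mpr fun h =>
        hb (List.eq_of_mem_replicate h), zero_add]

/-- the multiplicities of the letters in a monomial -/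
def mult (t : Quad) : Letter → ℕ
  | .y n => if Even n then t.1 n % 2 else t.1 n
  | .y2 n => t.1 (2 * n) / 2
  | .m n => t.2.1 n % 2
  | .m2 n => t.2.1 n / 2
  | .l n => t.2.2.1 n
  | .x n => if Odd n then t.2.2.2 n % 2 else t.2.2.2 n
  | .x2 n => t.2.2.2 (2 * n + 1) / 2

lemma mult_le_one (t : Quad) (a : Letter) (h : Odd a.par) : mult t a ≤ 1 := by
  cases a with
  | y n =>
    have hn : Even n := by simpa [Letter.par, Nat.odd_add_one] using h
    simp only [mult, if_pos hn]; omega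
  | y2 n => exact absurd h (by simp [Letter.par])
  | m n => simp only [mult]; omega
  | m2 n => exact absurd h (by simp [Letter.par])
  | l n => exact absurd h (by simp [Letter.par, parity_simps])
  | x n =>
    have hn : Odd n := h
    simp only [mult, if_pos hn]; omega
  | x2 n => exact absurd h (by simp [Letter.par])

/-- the letters for `Y` -/
def lettersY (N : ℕ) : List Letter :=
  (List.range N).flatMap fun n => [.y2 n, .y (2 * n), .y (2 * n + 1)]

/-- the letters for `M` -/
def lettersM (N : ℕ) : List Letter := (List.range N).flatMap fun n => [.m2 n, .m n]

/-- the letters for `L` -/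
def lettersL (N : ℕ) : List Letter := (List.range N).map .l

/-- the letters for `X` -/
def lettersX (N : ℕ) : List Letter :=
  (List.range N).reverse.flatMap fun n => [.x (2 * n + 1), .x2 n, .x (2 * n)]

/-- the letters in the order of the PBW monomials -/
def letters (N : ℕ) : List Letter := lettersY N ++ (lettersM N ++ (lettersL N ++ lettersX N))

lemma nodup_letters (N : ℕ) : (letters N).Nodup := by
  have hY : (lettersY N).Nodup := by
    refine List.nodup_flatMap.mpr ⟨fun n _ => by simp, List.nodup_range.imp fun {a b} h => ?_⟩
    simp [Function.onFun, List.Disjoint, h]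
    omega
  have hM : (lettersM N).Nodup := by
    refine List.nodup_flatMap.mpr ⟨fun n _ => by simp, List.nodup_range.imp fun {a b} h => ?_⟩
    simp [Function.onFun, List.Disjoint, h]
  have hL : (lettersL N).Nodup := List.nodup_range.map fun a b h => by simpa using h
  have hX : (lettersX N).Nodup := by
    refine List.nodup_flatMap.mpr ⟨fun n _ => by simp,
      (List.nodup_reverse.mpr List.nodup_range).imp fun {a b} h => ?_⟩
    simp [Function.onFun, List.Disjoint, h]
    omega
  refine hY.append (hM.append (hL.append hX ?_) ?_) ?_ <;>
    simp [List.Disjoint, lettersY, lettersM, lettersL, lettersX] <;> aesop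

lemma word_append (l l' : List Letter) (μ : Letter → ℕ) : word (l ++ l') μ = word l μ ++ word l' μ := by
  simp [word]

lemma wd_append (w w' : List Letter) : wd (w ++ w') = wd w * wd w' := by simp [wd]

lemma wd_word_cons (a : Letter) (l : List Letter) (μ : Letter → ℕ) :
    wd (word (a :: l) μ) = a.el ^ μ a * wd (word l μ) := by
  simp [word, wd]

lemma wd_word_nil (μ : Letter → ℕ) : wd (word [] μ) = 1 := by simp [word, wd]

lemma wd_word_append (l l' : List Letter) (μ : Letter → ℕ) :
    wd (word (l ++ l') μ) = wd (word l μ) * wd (word l' μ) := by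
  rw [word_append, wd_append]

lemma sq_pow_mul (u : F) (n : ℕ) : (u * u) ^ (n / 2) * u ^ (n % 2) = u ^ n := by
  rw [← sq, ← pow_mul, ← pow_add, Nat.div_add_mod]

lemma pow_mul_sq (u : F) (n : ℕ) : u ^ (n % 2) * (u * u) ^ (n / 2) = u ^ n := by
  rw [← sq, ← pow_mul, ← pow_add, Nat.mod_add_div]

lemma wd_lettersY (t : Quad) (N : ℕ) : wd (word (lettersY N) (mult t)) = ascTo (YF 1) t.1 (2 * N) := by
  induction N with
  | zero => simp [lettersY, wd_word_nil, ascTo]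
  | succ N ih =>
    rw [lettersY, List.range_succ, List.flatMap_append, wd_word_append, ← lettersY, ih,
      show 2 * (N + 1) = 2 * N + 1 + 1 by ring, ascTo_succ, ascTo_succ]
    simp only [List.flatMap_singleton, wd_word_cons, wd_word_nil, mul_one, mult, Letter.el]
    rw [if_pos (by simp), if_neg (by simp), ← mul_assoc (_ ^ _) (_ ^ _), sq_pow_mul, mul_assoc]

lemma wd_lettersM (t : Quad) (N : ℕ) : wd (word (lettersM N) (mult t)) = ascTo (MF 1) t.2.1 N := by
  induction N with
  | zero => simp [lettersM, wd_word_nil, ascTo]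
  | succ N ih =>
    rw [lettersM, List.range_succ, List.flatMap_append, wd_word_append, ← lettersM, ih, ascTo_succ]
    simp only [List.flatMap_singleton, wd_word_cons, wd_word_nil, mul_one, mult, Letter.el]
    rw [sq_pow_mul]

lemma wd_lettersL (t : Quad) (N : ℕ) :
    wd (word (lettersL N) (mult t)) = ascTo (fun i => LF 1 (2 * i + 1)) t.2.2.1 N := by
  induction N with
  | zero => simp [lettersL, wd_word_nil, ascTo]
  | succ N ih =>
    rw [lettersL, List.range_succ, List.map_append, wd_word_append, ← lettersL, ih, ascTo_succ]
    simp only [List.map_singleton, wd_word_cons, wd_word_nil, mul_one, mult, Letter.el]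

lemma wd_lettersX (t : Quad) (N : ℕ) : wd (word (lettersX N) (mult t)) =
    (ascTo (fun i => MulOpposite.op (XF 1 i)) t.2.2.2 (2 * N)).unop := by
  induction N with
  | zero => simp [lettersX, wd_word_nil, ascTo]
  | succ N ih =>
    rw [lettersX, List.range_succ, List.reverse_append, List.flatMap_append, wd_word_append,
      ← lettersX, ih, show 2 * (N + 1) = 2 * N + 1 + 1 by ring, ascTo_succ, ascTo_succ]
    simp only [List.reverse_singleton, List.flatMap_singleton, wd_word_cons, wd_word_nil, mul_one,
      mult, Letter.el, MulOpposite.unop_mul, MulOpposite.unop_pow, MulOpposite.unop_op]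
    rw [if_pos (by simp), if_neg (by simp), ← mul_assoc (_ ^ _) (_ ^ _), pow_mul_sq, mul_assoc]

/-- the exponents vanish from `N` on -/
def Bdd (N : ℕ) (t : Quad) : Prop :=
  ∀ i, N ≤ i → t.1 i = 0 ∧ t.2.1 i = 0 ∧ t.2.2.1 i = 0 ∧ t.2.2.2 i = 0

lemma exists_bdd (T : Finset Quad) : ∃ N, ∀ t ∈ T, Bdd N t := by
  have h1 (f : ℕ →₀ ℕ) (N i : ℕ) (hN : f.support.sup id < N) (h : N ≤ i) : f i = 0 := by
    by_contra h'
    have : i ≤ f.support.sup id := Finset.le_sup (f := id) (Finsupp.mem_support_iff.mpr h')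
    omega
  let B (t : Quad) : ℕ := t.1.support.sup id + t.2.1.support.sup id + t.2.2.1.support.sup id +
    t.2.2.2.support.sup id
  refine ⟨T.sup B + 1, fun t ht i hi => ?_⟩
  have hB : B t = t.1.support.sup id + t.2.1.support.sup id + t.2.2.1.support.sup id +
    t.2.2.2.support.sup id := rfl
  have : B t ≤ T.sup B := Finset.le_sup ht
  refine ⟨h1 _ _ i ?_ hi, h1 _ _ i ?_ hi, h1 _ _ i ?_ hi, h1 _ _ i ?_ hi⟩ <;> omega

lemma mono_eq_wd {N : ℕ} {t : Quad} (h : Bdd N t) : mono 1 t = wd (word (letters N) (mult t)) := by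
  rw [letters, wd_word_append, wd_word_append, wd_word_append, wd_lettersY, wd_lettersM, wd_lettersL,
    wd_lettersX, mono, ← QDatum.unop_asc,
    asc_eq_ascTo (n := 2 * N) _ fun i hi => (h i (by omega)).1,
    asc_eq_ascTo (n := N) _ fun i hi => (h i hi).2.1,
    asc_eq_ascTo (n := N) _ fun i hi => (h i hi).2.2.1,
    asc_eq_ascTo (n := 2 * N) _ fun i hi => (h i (by omega)).2.2.2]
  simp only [mul_assoc]

lemma mult_injOn {N : ℕ} {t t' : Quad} (ht : Bdd N t) (ht' : Bdd N t')
    (h : ∀ a ∈ letters N, mult t a = mult t' a) : t = t' := by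
  have key (i : ℕ) (hi : i < N) : t.1 i = t'.1 i ∧ t.2.1 i = t'.2.1 i ∧ t.2.2.1 i = t'.2.2.1 i ∧
      t.2.2.2 i = t'.2.2.2 i := by
    have hm := h (.m i) (by simp [letters, lettersM, lettersY, lettersL, lettersX, hi])
    have hm2 := h (.m2 i) (by simp [letters, lettersM, lettersY, lettersL, lettersX, hi])
    have hl := h (.l i) (by simp [letters, lettersM, lettersY, lettersL, lettersX, hi])
    have hy := h (.y i) (by
      simp [letters, lettersM, lettersY, lettersL, lettersX]
      exact ⟨i / 2, by omega⟩)
    have hx := h (.x i) (by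
      simp [letters, lettersM, lettersY, lettersL, lettersX]
      exact ⟨i / 2, by omega⟩)
    have hy2 := h (.y2 (i / 2)) (by
      simp [letters, lettersM, lettersY, lettersL, lettersX]; omega)
    have hx2 := h (.x2 (i / 2)) (by
      simp [letters, lettersM, lettersY, lettersL, lettersX]; omega)
    simp only [mult] at hm hm2 hl hy hx hy2 hx2
    refine ⟨?_, by omega, hl, ?_⟩
    · rcases Nat.even_or_odd i with hi | hi
      · rw [if_pos hi, if_pos hi] at hy
        rw [Nat.two_mul_div_two_of_even hi] at hy2
        omega
      · rwa [if_neg (Nat.not_even_iff_odd.mpr hi), if_neg (Nat.not_even_iff_odd.mpr hi)] at hy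
    · rcases Nat.even_or_odd i with hi | hi
      · rwa [if_neg (Nat.not_odd_iff_even.mpr hi), if_neg (Nat.not_odd_iff_even.mpr hi)] at hx
      · rw [if_pos hi, if_pos hi] at hx
        rw [Nat.two_mul_div_two_add_one_of_odd hi] at hx2
        omega
  refine Prod.ext ?_ (Prod.ext ?_ (Prod.ext ?_ ?_)) <;> ext i <;>
    rcases lt_or_ge i N with hi | hi
  · exact (key i hi).1
  · rw [(ht i hi).1, (ht' i hi).1]
  · exact (key i hi).2.1
  · rw [(ht i hi).2.1, (ht' i hi).2.1]
  · exact (key i hi).2.2.1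
  · rw [(ht i hi).2.2.1, (ht' i hi).2.2.1]
  · exact (key i hi).2.2.2
  · rw [(ht i hi).2.2.2, (ht' i hi).2.2.2]

lemma separated : Separated := by
  classical
  intro T
  obtain ⟨N, hN⟩ := exists_bdd T
  let W (t : T) : List Letter := word (letters N) (mult t)
  refine ⟨fun t => (W t).map Letter.seg, fun hdet => ?_⟩
  obtain ⟨v, hv, h0⟩ := Matrix.exists_mulVec_eq_zero_iff.mpr hdet
  obtain ⟨t0, ht0⟩ := Function.ne_iff.mp hv
  obtain ⟨t, ht, hmax⟩ := (Finset.univ.filter fun t : T => v t ≠ 0).exists_max_image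
    (fun t => (W t).length) ⟨t0, by simpa using ht0⟩
  simp only [Finset.mem_filter, Finset.mem_univ, true_and] at ht hmax
  have h1 := congrFun h0 t
  rw [Matrix.mulVec, dotProduct, Finset.sum_eq_single t] at h1
  · refine absurd h1 (mul_ne_zero ?_ ht)
    rw [Matrix.of_apply, mono_eq_wd (hN t t.2)]
    exact pair_word_ne_zero _ (nodup_letters N) _ (mult_le_one t)
  · intro t' _ hne
    by_cases hv' : v t' = 0
    · rw [hv', mul_zero]
    · rw [Matrix.of_apply, mono_eq_wd (hN t' t'.2), pair_eq_zero _ _ (hmax t' hv'), zero_mul]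
      intro hp
      refine hne (Subtype.ext (mult_injOn (hN _ t'.2) (hN _ t.2) fun a ha => ?_))
      rw [← count_word _ (nodup_letters N) (mult t) a ha,
        ← count_word _ (nodup_letters N) (mult t') a ha]
      exact hp.count_eq a
  · simp

end Indep

/-- PBW theorem: the ordered monomials in the root vectors
`Y₁ < Y₂ < ⋯ < M₁ < M₃ < ⋯ < L₂ < L₄ < ⋯ < ⋯ < X₂ < X₁` form a `ℂ`-vector space basis of
`U = U_q(A(0,2)^{(4)})^+`: they are linearly independent and span `U`. -/
theorem stmt19 (q : ℂ) (hq0 : q ≠ 0) (hq : NotRootOfUnity q) :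
    LinearIndependent ℂ (pbwMonomial q) ∧
    Submodule.span ℂ (Set.range (pbwMonomial q)) = ⊤ :=
  ⟨Indep.linearIndependent_pbwMonomial Indep.separated hq0 (span_pbwMonomial hq0 hq),
    span_pbwMonomial hq0 hq⟩
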